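/- Suppose that T and T' are a pair of unrooted binary phylogenetic trees on the same label set X with d_MP(T,T') = 1 or d_TBR(T,T') = 1. Then d_tw(T,T') = 1. -/

import Mathlib

open SimpleGraph

/-- `G` has a tree decomposition of width at most `k`: a tree `t` together with
bags satisfying (tw1), (tw2) and (tw3), all of whose bags have size at most `k+1`. -/
def HasTreeDecompWidthLE {V : Type*} (G : SimpleGraph V) (k : ℕ) : Prop :=
  ∃ (n : ℕ) (t : SimpleGraph (Fin (n + 1))) (bag : Fin (n + 1) → Finset V),
    t.IsTree ∧
    (∀ v : V, ∃ i, v ∈ bag i) ∧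
    (∀ u v : V, G.Adj u v → ∃ i, u ∈ bag i ∧ v ∈ bag i) ∧
    (∀ v : V, (t.induce {i | v ∈ bag i}).Connected) ∧
    (∀ i, (bag i).card ≤ k + 1)

/-- The treewidth of a graph: the least `k` such that `G` has a tree decomposition
of width `k`. -/
noncomputable def treewidth {V : Type*} (G : SimpleGraph V) : ℕ :=
  sInf {k | HasTreeDecompWidthLE G k}

/-- An unrooted binary phylogenetic graph (tree or network) on label set `X`:
a finite connected graph whose degree-1 vertices are bijectively labelled by `X`
and all of whose other vertices have degree 3. -/
structure PhyloGraph (V : Type*) (X : Type*) where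
  graph : SimpleGraph V
  finite : Finite V
  connected : graph.Connected
  leaf : X → V
  leaf_inj : Function.Injective leaf
  leaf_deg : ∀ x : X, (graph.neighborSet (leaf x)).ncard = 1
  internal_deg : ∀ v : V, (∀ x : X, leaf x ≠ v) → (graph.neighborSet v).ncard = 3

/-- An unrooted binary phylogenetic tree on label set `X`. -/
structure PhyloTree (V : Type*) (X : Type*) extends PhyloGraph V X where
  acyclic : graph.IsAcyclic

open Classical in
/-- The map identifying a leaf of the second graph with the leaf of the first
graph carrying the same label. -/
noncomputable def mergeMap {V1 V2 X : Type*} (l1 : X → V1) (l2 : X → V2) :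
    V1 ⊕ V2 → V1 ⊕ V2
  | Sum.inl v => Sum.inl v
  | Sum.inr w => if h : ∃ x, l2 x = w then Sum.inl (l1 h.choose) else Sum.inr w

lemma mergeMap_idem {V1 V2 X : Type*} (l1 : X → V1) (l2 : X → V2) (u : V1 ⊕ V2) :
    mergeMap l1 l2 (mergeMap l1 l2 u) = mergeMap l1 l2 u := by
  classical
  cases u with
  | inl v => rfl
  | inr w =>
    by_cases h : ∃ x, l2 x = w
    · simp [mergeMap, h]
    · simp [mergeMap, h]

/-- The vertex set of the display graph: the disjoint union of the vertex sets
of the two graphs, with leaves carrying the same label identified. -/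
def DisplayVertex {V1 V2 X : Type*} (l1 : X → V1) (l2 : X → V2) : Type _ :=
  {u : V1 ⊕ V2 // mergeMap l1 l2 u = u}

/-- The canonical map from `V1 ⊕ V2` to the vertex set of the display graph. -/
noncomputable def toDisplay {V1 V2 X : Type*} (l1 : X → V1) (l2 : X → V2) (u : V1 ⊕ V2) :
    DisplayVertex l1 l2 :=
  ⟨mergeMap l1 l2 u, mergeMap_idem l1 l2 u⟩

/-- The display graph of two leaf-labelled graphs: their disjoint union with the
leaves carrying the same label identified. -/
noncomputable def displayGraph {V1 V2 X : Type*} (G1 : SimpleGraph V1) (l1 : X → V1)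
    (G2 : SimpleGraph V2) (l2 : X → V2) : SimpleGraph (DisplayVertex l1 l2) :=
  SimpleGraph.fromRel (fun a b =>
    (∃ u v : V1, G1.Adj u v ∧ a = toDisplay l1 l2 (Sum.inl u) ∧ b = toDisplay l1 l2 (Sum.inl v)) ∨
    (∃ u v : V2, G2.Adj u v ∧ a = toDisplay l1 l2 (Sum.inr u) ∧ b = toDisplay l1 l2 (Sum.inr v)))

/-- The treewidth distance between two phylogenetic trees:
`d_tw(T1,T2) = tw(D(T1,T2)) - 2`. -/
noncomputable def dtw {V1 V2 X : Type*} (T1 : PhyloTree V1 X) (T2 : PhyloTree V2 X) : ℕ :=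
  treewidth (displayGraph T1.graph T1.leaf T2.graph T2.leaf) - 2

/-- Two phylogenetic trees are compatible if there is a label-preserving
isomorphism between them. -/
def Compatible {V1 V2 X : Type*} (T1 : PhyloTree V1 X) (T2 : PhyloTree V2 X) : Prop :=
  ∃ φ : T1.graph ≃g T2.graph, ∀ x : X, φ (T1.leaf x) = T2.leaf x

/-- The graph obtained from `H` by suppressing all its degree-2 vertices: its
vertices are the vertices of `H` of degree other than 2, two of them being
adjacent iff they are joined in `H` by a path all of whose internal vertices
have degree 2. -/
def Smoothing {W : Type*} (H : SimpleGraph W) :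
    SimpleGraph {w : W // (H.neighborSet w).ncard ≠ 2} :=
  SimpleGraph.fromRel (fun a b =>
    ∃ p : H.Walk a.1 b.1, p.IsPath ∧
      ∀ x ∈ p.support, x = a.1 ∨ x = b.1 ∨ (H.neighborSet x).ncard = 2)

/-- The parsimony score of the character `f` on the leaf-labelled graph `(G, l)`:
the minimum, over all extensions `g` of `f` to the vertices, of the number of
edges whose endpoints receive different states. -/
noncomputable def parsimonyScore {V X C : Type*} (G : SimpleGraph V) (l : X → V)
    (f : X → C) : ℕ :=
  sInf {m | ∃ g : V → C, (∀ x, g (l x) = f x) ∧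
    {e | e ∈ G.edgeSet ∧ ∃ u v : V, e = s(u, v) ∧ g u ≠ g v}.ncard = m}

/-- The maximum parsimony distance between two phylogenetic trees:
`d_MP(T1,T2) = max_f |l_f(T1) - l_f(T2)|`, the maximum over all characters `f`
(surjections from `X` to a finite set of states) of the absolute difference of
the parsimony scores. -/
noncomputable def dMP {V1 V2 X : Type*} (T1 : PhyloTree V1 X) (T2 : PhyloTree V2 X) : ℕ :=
  sSup {m | ∃ (k : ℕ) (f : X → Fin k), Function.Surjective f ∧
    m = max (parsimonyScore T1.graph T1.leaf f - parsimonyScore T2.graph T2.leaf f)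
            (parsimonyScore T2.graph T2.leaf f - parsimonyScore T1.graph T1.leaf f)}

/-- `y` is an attachment point of the reattachment datum `s`: an endpoint of the
chosen edge to be subdivided (left case) or the chosen lone-leaf vertex (right
case). -/
def attachAt {V : Type*} (s : (V × V) ⊕ V) (y : V) : Prop :=
  match s with
  | Sum.inl (p, q) => y = p ∨ y = q
  | Sum.inr v => y = v

/-- The auxiliary graph of a TBR move on `T`: the edge `{a, b}` is deleted, the
chosen edges `s1`, `s2` (one in each resulting component) are subdivided by the
two new vertices (if a component is a single leaf, the new vertex is attached to
that leaf instead), and the two new vertices are joined by an edge.  The tree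
resulting from the TBR move is obtained by suppressing all degree-2 vertices of
this graph. -/
def tbrGraph {V X : Type*} (T : PhyloTree V X) (a b : V) (s1 s2 : (V × V) ⊕ V) :
    SimpleGraph (V ⊕ Fin 2) :=
  SimpleGraph.fromRel (fun y z =>
    (∃ p q : V, T.graph.Adj p q ∧ y = Sum.inl p ∧ z = Sum.inl q ∧
      s(p, q) ≠ s(a, b) ∧
      (∀ r r' : V, s1 = Sum.inl (r, r') → s(p, q) ≠ s(r, r')) ∧
      (∀ r r' : V, s2 = Sum.inl (r, r') → s(p, q) ≠ s(r, r'))) ∨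
    (∃ p : V, y = Sum.inl p ∧ z = Sum.inr 0 ∧ attachAt s1 p) ∨
    (∃ p : V, y = Sum.inl p ∧ z = Sum.inr 1 ∧ attachAt s2 p) ∨
    (y = Sum.inr 0 ∧ z = Sum.inr 1))

/-- Validity of the reattachment datum `s` for the component of `c` after
deleting the edge `{a, b}` of `T`: either `s` picks an edge of that component,
or the component is the single leaf `c` and `s` picks it. -/
def ValidAttach {V X : Type*} (T : PhyloTree V X) (a b c : V) (s : (V × V) ⊕ V) : Prop :=
  match s with
  | Sum.inl (p, q) => T.graph.Adj p q ∧
      (T.graph.deleteEdges {s(a, b)}).Reachable c p ∧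
      (T.graph.deleteEdges {s(a, b)}).Reachable c q
  | Sum.inr v => v = c ∧ ∃ x, T.leaf x = c

/-- `T'` is obtained from `T` by a single TBR (Tree Bisection and Reconnect)
move: delete an edge `{a,b}`, subdivide a chosen edge in each of the two
resulting components (or use the component itself if it is a single leaf), join
the two subdivision vertices by a new edge and suppress all degree-2 vertices. -/
def TBRStep {V V' : Type} {X : Type} (T : PhyloTree V X) (T' : PhyloTree V' X) : Prop :=
  ∃ (a b : V) (s1 s2 : (V × V) ⊕ V),
    T.graph.Adj a b ∧ ValidAttach T a b a s1 ∧ ValidAttach T a b b s2 ∧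
    ∃ e : T'.graph ≃g Smoothing (tbrGraph T a b s1 s2),
      ∀ x : X, ((e (T'.leaf x)).1 : V ⊕ Fin 2) = Sum.inl (T.leaf x)

/-- Phylogenetic trees on the label set `X` (with arbitrary vertex type). -/
def PTree (X : Type) : Type 1 := Σ V : Type, PhyloTree V X

/-- `tbrChain n A B` holds if the tree `B` can be obtained from the tree `A` by
(at most) `n` TBR moves (identifying label-isomorphic trees). -/
def tbrChain {X : Type} : ℕ → PTree X → PTree X → Prop
  | 0, A, B => Compatible A.2 B.2
  | n + 1, A, B => ∃ C : PTree X, TBRStep A.2 C.2 ∧ tbrChain n C B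

/-- The TBR distance between two phylogenetic trees on the same label set: the
minimum number of TBR moves needed to transform one into the other. -/
noncomputable def dTBR {V1 V2 X : Type} (T1 : PhyloTree V1 X) (T2 : PhyloTree V2 X) : ℕ :=
  sInf {n | tbrChain n ⟨V1, T1⟩ ⟨V2, T2⟩}


section Sides
variable {V : Type*}

/-- The side of `q` after removing the edge `pq`. -/
def side (G : SimpleGraph V) (p q : V) : Set V :=
  {w | (G.deleteEdges {s(p, q)}).Reachable q w}

lemma side_self (G : SimpleGraph V) (p q : V) : q ∈ side G p q := Reachable.refl _

lemma side_step {G : SimpleGraph V} {p q u v : V} (h : G.Adj u v) (hu : u ∈ side G p q)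
    (hv : v ∉ side G p q) : s(u, v) = s(p, q) := by
  by_contra hne
  apply hv
  refine Reachable.trans hu (Adj.reachable ?_)
  rw [deleteEdges_adj]
  exact ⟨h, by simpa using hne⟩

lemma side_not_mem {G : SimpleGraph V} (hG : G.IsAcyclic) {p q : V} (h : G.Adj p q) :
    p ∉ side G p q := by
  intro hp
  have := isAcyclic_iff_forall_adj_isBridge.1 hG h
  rw [isBridge_iff] at this
  exact this (Reachable.symm hp)

/-- the only edge leaving `side p q` is `qp`. -/
lemma side_cross {G : SimpleGraph V} (hG : G.IsAcyclic) {p q u v : V} (hpq : G.Adj p q)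
    (h : G.Adj u v) (hu : u ∈ side G p q)
    (hv : v ∉ side G p q) : u = q ∧ v = p := by
  have := side_step h hu hv
  rcases Sym2.eq_iff.1 this with ⟨rfl, rfl⟩ | ⟨rfl, rfl⟩
  · exact absurd hu (side_not_mem hG hpq)
  · exact ⟨rfl, rfl⟩

lemma closed_of_connected {G : SimpleGraph V} (hG : G.Connected) (S : Set V) {a : V} (ha : a ∈ S)
    (hS : ∀ u v, G.Adj u v → u ∈ S → v ∈ S) (w : V) : w ∈ S := by
  obtain ⟨p⟩ := hG.preconnected a w
  induction p with
  | nil => exact ha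
  | cons h p ih => exact ih (hS _ _ h ha)

/-- an induction principle for sides: closed sets. -/
lemma side_induct {G : SimpleGraph V} {p q : V} (S : Set V) (hq : q ∈ S)
    (hS : ∀ u v, G.Adj u v → u ∈ side G p q → v ∈ side G p q → u ∈ S → v ∈ S) :
    side G p q ⊆ S := by
  intro w hw
  obtain ⟨W⟩ := hw
  have key : ∀ (a b : V) (W : (G.deleteEdges {s(p, q)}).Walk a b), a ∈ side G p q → a ∈ S → b ∈ S := by
    intro a b W
    induction W with
    | nil => intro _ h; exact h
    | cons h W ih =>
      intro h1 h2
      have h3 := Reachable.trans (show (G.deleteEdges {s(p, q)}).Reachable q _ from h1) h.reachable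
      exact ih h3 (hS _ _ (deleteEdges_le _ h) h1 h3 h2)
  exact key _ _ W (side_self G p q) hq

lemma side_union {G : SimpleGraph V} (hc : G.Connected) (p q : V)  (w : V) :
    w ∈ side G p q ∨ w ∈ side G q p := by
  refine closed_of_connected hc {w | w ∈ side G p q ∨ w ∈ side G q p} (a := q)
    (Or.inl (side_self G p q)) ?_ w
  rintro u v h hu
  by_contra hv
  simp only [Set.mem_setOf_eq, not_or] at hv hu
  have := side_self G p q
  have := side_self G q p
  rcases hu with hu | hu
  · have := side_step h hu hv.1
    rcases Sym2.eq_iff.1 this with ⟨rfl, rfl⟩ | ⟨rfl, rfl⟩ <;> simp_all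
  · have := side_step h hu hv.2
    rcases Sym2.eq_iff.1 this with ⟨rfl, rfl⟩ | ⟨rfl, rfl⟩ <;> simp_all

lemma side_disj {G : SimpleGraph V} (hG : G.IsAcyclic) {p q : V} (h : G.Adj p q) {w : V}
    (h1 : w ∈ side G p q) (h2 : w ∈ side G q p) : False := by
  have h2' : (G.deleteEdges {s(p, q)}).Reachable p w := by
    have : (G.deleteEdges {s(q, p)}).Reachable p w := h2
    rwa [Sym2.eq_swap] at this
  exact side_not_mem hG h (Reachable.trans (show (G.deleteEdges {s(p, q)}).Reachable q w from h1) h2'.symm)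

lemma side_compl {G : SimpleGraph V} (hc : G.Connected) (hG : G.IsAcyclic) {p q : V}
    (h : G.Adj p q) {w : V} : w ∈ side G q p ↔ w ∉ side G p q :=
  ⟨fun h1 h2 => side_disj hG h h2 h1, fun h1 => (side_union hc p q w).resolve_left h1⟩

/-- nested sides. -/
lemma side_subset {G : SimpleGraph V} (hG : G.IsAcyclic) {a b p q : V}
    (hab : G.Adj a b) (hq : q ∈ side G a b) (hb : b ∉ side G p q) :
    side G p q ⊆ side G a b := by
  refine side_induct _ hq ?_
  intro u v h hu hv hu'
  by_contra hv'
  have := side_cross hG hab h hu' hv'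
  rw [this.1] at hu
  exact hb hu

lemma side_disj_nbr {G : SimpleGraph V} (hG : G.IsAcyclic) {u v v' w : V}
    (h : G.Adj u v) (h' : G.Adj u v') (hne : v ≠ v') (h1 : w ∈ side G u v) (h2 : w ∈ side G u v') :
    False := by
  have hv' : v' ∉ side G u v := fun hv' =>
    hne (side_cross hG h h'.symm hv' (side_not_mem hG h)).1.symm
  have : side G u v' ⊆ (side G u v)ᶜ := by
    refine side_induct _ hv' ?_
    intro x y hxy hx hy hx' hy'
    have hx'' : x ∉ side G u v := hx'
    have := side_cross hG h hxy.symm hy' hx''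
    rw [this.2] at hx
    exact side_not_mem hG h' hx
  exact this h2 h1

lemma side_cover_nbr {G : SimpleGraph V} (hc : G.Connected) (u w : V)
    (hw : w ≠ u) : ∃ v, G.Adj u v ∧ w ∈ side G u v := by
  have : w ∈ {w | w = u ∨ ∃ v, G.Adj u v ∧ w ∈ side G u v} := by
    refine closed_of_connected hc _ (a := u) (Or.inl rfl) ?_ w
    rintro x y hxy (rfl | ⟨v, hv, hx⟩)
    · exact Or.inr ⟨y, hxy, side_self G _ _⟩
    · by_cases hy : y ∈ side G u v
      · exact Or.inr ⟨v, hv, hy⟩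
      · have := side_step hxy hx hy
        rcases Sym2.eq_iff.1 this with ⟨rfl, rfl⟩ | ⟨rfl, rfl⟩
        · exact Or.inr ⟨y, hv, side_self G _ _⟩
        · exact Or.inl rfl
  exact this.resolve_left hw

/-- `side w u` for `w ~ u` consists of `u` and the sides `side u v`, `v ≠ w`. -/
lemma side_decomp {G : SimpleGraph V} (hc : G.Connected) (hG : G.IsAcyclic) {u w : V}
    (h : G.Adj w u) (z : V) :
    z ∈ side G w u ↔ z = u ∨ ∃ v, G.Adj u v ∧ v ≠ w ∧ z ∈ side G u v := by
  constructor
  · intro hz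
    by_cases hzu : z = u
    · exact Or.inl hzu
    obtain ⟨v, hv, hzv⟩ := side_cover_nbr hc u z hzu
    refine Or.inr ⟨v, hv, ?_, hzv⟩
    rintro rfl
    exact side_disj hG h hz hzv
  · rintro (rfl | ⟨v, hv, hne, hz⟩)
    · exact side_self G _ _
    · by_contra hz'
      rw [← side_compl hc hG h] at hz'
      exact side_disj_nbr hG hv h.symm hne hz hz'

/-- Moving across an edge other than `pq` does not change sides. -/
lemma side_adj_iff {G : SimpleGraph V} {p q u v : V} (h : G.Adj u v)
    (hne : s(u, v) ≠ s(p, q)) : u ∈ side G p q ↔ v ∈ side G p q := by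
  constructor
  · intro h1
    by_contra h2
    exact hne (side_step h h1 h2)
  · intro h1
    by_contra h2
    exact hne (Sym2.eq_swap.trans (side_step h.symm h1 h2))

end Sides


section Good
variable {V : Type}

/-- Vertices incident both with `F` and with `E \ F`. -/
def bdry (E F : Set (Sym2 V)) : Set V :=
  {v | (∃ e ∈ F, v ∈ e) ∧ ∃ e ∈ E, e ∉ F ∧ v ∈ e}

/-- The edge set `F` has a rooted tree decomposition of width at most `k` such that the root bag
contains the boundary of `F` in `E`. -/
def Good (k : ℕ) (E F : Set (Sym2 V)) : Prop :=
  ∃ (ι : Type) (_ : Finite ι) (r : ι) (par : ι → ι) (dep : ι → ℕ) (bag : ι → Set V),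
    par r = r ∧ (∀ i, i ≠ r → dep (par i) < dep i) ∧
    (∀ i v, v ∈ bag i → ∃ e ∈ F, v ∈ e) ∧
    (∀ e ∈ F, ∃ i, ∀ v ∈ e, v ∈ bag i) ∧
    (∀ v i j, v ∈ bag i → v ∈ bag j → (i = r ∨ v ∉ bag (par i)) → (j = r ∨ v ∉ bag (par j)) →
      i = j) ∧
    (∀ i, (bag i).ncard ≤ k + 1) ∧ ∀ v ∈ bdry E F, v ∈ bag r

lemma good_empty (k : ℕ) (E : Set (Sym2 V)) : Good k E ∅ := by
  refine ⟨Unit, inferInstance, (), id, fun _ => 0, fun _ => ∅, rfl, ?_, ?_, ?_, ?_, ?_, ?_⟩ <;>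
    simp [bdry]

lemma good_single (k : ℕ) (hk : 1 ≤ k) (E : Set (Sym2 V)) (a b : V) : Good k E {s(a, b)} := by
  refine ⟨Unit, inferInstance, (), id, fun _ => 0, fun _ => {a, b}, rfl, ?_, ?_, ?_, ?_, ?_, ?_⟩
  · simp
  · simp
  · simp
  · simp
  · intro _
    have := Set.ncard_insert_le a {b}
    simp only [Set.ncard_singleton] at this
    change ({a, b} : Set V).ncard ≤ k + 1
    omega
  · simp +contextual [bdry]

lemma bdry_subset_of {E F : Set (Sym2 V)} {v : V} (h : v ∈ bdry E F) : ∃ e ∈ F, v ∈ e := h.1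

lemma good_join [Finite V] {k : ℕ} {E F₁ F₂ : Set (Sym2 V)} (h₁ : Good k E F₁) (h₂ : Good k E F₂)
    (hs₁ : F₁ ⊆ E) (hs₂ : F₂ ⊆ E)
    (hd : Disjoint F₁ F₂) (hc : (bdry E F₁ ∪ bdry E F₂).ncard ≤ k + 1) : Good k E (F₁ ∪ F₂) := by
  classical
  obtain ⟨ι₁, _, r₁, p₁, d₁, b₁, hr₁, hdep₁, hin₁, hcov₁, htop₁, hcard₁, hbd₁⟩ := h₁
  obtain ⟨ι₂, _, r₂, p₂, d₂, b₂, hr₂, hdep₂, hin₂, hcov₂, htop₂, hcard₂, hbd₂⟩ := h₂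
  have hd' : ∀ e, e ∈ F₁ → e ∈ F₂ → False := fun e h h' => Set.disjoint_left.1 hd h h'
  have key1 : ∀ v, (∃ e ∈ F₁, v ∈ e) → (∃ e ∈ F₂, v ∈ e) → v ∈ bdry E F₁ := by
    rintro v h ⟨e, he, hv⟩
    exact ⟨h, e, hs₂ he, fun h' => hd' e h' he, hv⟩
  have key2 : ∀ v, (∃ e ∈ F₁, v ∈ e) → (∃ e ∈ F₂, v ∈ e) → v ∈ bdry E F₂ := by
    rintro v ⟨e, he, hv⟩ h
    exact ⟨h, e, hs₁ he, fun h' => hd' e he h', hv⟩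
  let par : Option (ι₁ ⊕ ι₂) → Option (ι₁ ⊕ ι₂) := fun o => match o with
    | none => none
    | some (Sum.inl i) => if i = r₁ then none else some (Sum.inl (p₁ i))
    | some (Sum.inr i) => if i = r₂ then none else some (Sum.inr (p₂ i))
  let dep : Option (ι₁ ⊕ ι₂) → ℕ := fun o => match o with
    | none => 0
    | some (Sum.inl i) => d₁ i + 1
    | some (Sum.inr i) => d₂ i + 1
  let bag : Option (ι₁ ⊕ ι₂) → Set V := fun o => match o with
    | none => bdry E F₁ ∪ bdry E F₂
    | some (Sum.inl i) => b₁ i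
    | some (Sum.inr i) => b₂ i
  -- tops of the two sides
  have t1 : ∀ v i, v ∈ b₁ i → (v ∉ bag (par (some (Sum.inl i)))) →
      (i = r₁ ∨ v ∉ b₁ (p₁ i)) ∧ v ∉ bdry E F₁ ∪ bdry E F₂ := by
    intro v i hv hp
    by_cases hi : i = r₁
    · simp only [par, hi, if_true, bag] at hp
      exact ⟨Or.inl hi, hp⟩
    · simp only [par, hi, if_false, bag] at hp
      refine ⟨Or.inr hp, ?_⟩
      intro hb
      have hb1 : v ∈ bdry E F₁ := by
        rcases hb with hb | hb
        · exact hb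
        · exact key1 v (hin₁ i v hv) hb.1
      exact hi (htop₁ v i r₁ hv (hbd₁ v hb1) (Or.inr hp) (Or.inl rfl))
  have t2 : ∀ v i, v ∈ b₂ i → (v ∉ bag (par (some (Sum.inr i)))) →
      (i = r₂ ∨ v ∉ b₂ (p₂ i)) ∧ v ∉ bdry E F₁ ∪ bdry E F₂ := by
    intro v i hv hp
    by_cases hi : i = r₂
    · simp only [par, hi, if_true, bag] at hp
      exact ⟨Or.inl hi, hp⟩
    · simp only [par, hi, if_false, bag] at hp
      refine ⟨Or.inr hp, ?_⟩
      intro hb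
      have hb1 : v ∈ bdry E F₂ := by
        rcases hb with hb | hb
        · exact key2 v hb.1 (hin₂ i v hv)
        · exact hb
      exact hi (htop₂ v i r₂ hv (hbd₂ v hb1) (Or.inr hp) (Or.inl rfl))
  refine ⟨Option (ι₁ ⊕ ι₂), inferInstance, none, par, dep, bag, rfl, ?_, ?_, ?_, ?_, ?_, ?_⟩
  · rintro (_ | i | i) h
    · exact absurd rfl h
    · by_cases hi : i = r₁
      · simp [par, dep, hi]
      · simp only [par, hi, if_false, dep]; exact Nat.succ_lt_succ (hdep₁ i hi)
    · by_cases hi : i = r₂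
      · simp [par, dep, hi]
      · simp only [par, hi, if_false, dep]; exact Nat.succ_lt_succ (hdep₂ i hi)
  · rintro (_ | i | i) v hv
    · rcases hv with hv | hv
      · obtain ⟨e, he, h⟩ := hv.1; exact ⟨e, Or.inl he, h⟩
      · obtain ⟨e, he, h⟩ := hv.1; exact ⟨e, Or.inr he, h⟩
    · obtain ⟨e, he, h⟩ := hin₁ i v hv; exact ⟨e, Or.inl he, h⟩
    · obtain ⟨e, he, h⟩ := hin₂ i v hv; exact ⟨e, Or.inr he, h⟩
  · rintro e (he | he)
    · obtain ⟨i, hi⟩ := hcov₁ e he; exact ⟨some (Sum.inl i), hi⟩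
    · obtain ⟨i, hi⟩ := hcov₂ e he; exact ⟨some (Sum.inr i), hi⟩
  · rintro v (_ | i | i) (_ | j | j) hi hj ti tj
    · rfl
    · exact absurd hi (t1 v j hj (tj.resolve_left (by simp))).2
    · exact absurd hi (t2 v j hj (tj.resolve_left (by simp))).2
    · exact absurd hj (t1 v i hi (ti.resolve_left (by simp))).2
    · rw [htop₁ v i j hi hj (t1 v i hi (ti.resolve_left (by simp))).1
        (t1 v j hj (tj.resolve_left (by simp))).1]
    · exact absurd (Or.inl (key1 v (hin₁ i v hi) (hin₂ j v hj)))
        (t1 v i hi (ti.resolve_left (by simp))).2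
    · exact absurd hj (t2 v i hi (ti.resolve_left (by simp))).2
    · exact absurd (Or.inl (key1 v (hin₁ j v hj) (hin₂ i v hi)))
        (t2 v i hi (ti.resolve_left (by simp))).2
    · rw [htop₂ v i j hi hj (t2 v i hi (ti.resolve_left (by simp))).1
        (t2 v j hj (tj.resolve_left (by simp))).1]
  · rintro (_ | i | i)
    · exact hc
    · exact hcard₁ i
    · exact hcard₂ i
  · rintro v ⟨⟨e, he, hv⟩, e', he', hn, hv'⟩
    rcases he with he | he
    · exact Or.inl ⟨⟨e, he, hv⟩, e', he', fun h => hn (Or.inl h), hv'⟩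
    · exact Or.inr ⟨⟨e, he, hv⟩, e', he', fun h => hn (Or.inr h), hv'⟩

/-- The graph of a parent function. -/
def parGraph {ι : Type} (par : ι → ι) : SimpleGraph ι :=
  SimpleGraph.fromRel (fun i j => par i = j)

lemma parGraph_adj {ι : Type} (par : ι → ι) {i : ι} (h : par i ≠ i) : (parGraph par).Adj i (par i) := by
  rw [parGraph, fromRel_adj]
  exact ⟨h.symm, Or.inl rfl⟩

lemma par_ne {ι : Type} {r : ι} {par : ι → ι} {dep : ι → ℕ}
    (hdep : ∀ i, i ≠ r → dep (par i) < dep i) {i : ι} (h : i ≠ r) : par i ≠ i := by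
  intro h'
  have := hdep i h
  rw [h'] at this
  exact lt_irrefl _ this

lemma parGraph_isTree {ι : Type} [Finite ι] {r : ι} {par : ι → ι} {dep : ι → ℕ} (hr : par r = r)
    (hdep : ∀ i, i ≠ r → dep (par i) < dep i) : (parGraph par).IsTree := by
  classical
  have hconn : (parGraph par).Connected := by
    rw [connected_iff_exists_forall_reachable]
    refine ⟨r, ?_⟩
    intro w
    induction hn : dep w using Nat.strong_induction_on generalizing w with
    | _ n ih =>
      by_cases hw : w = r
      · rw [hw]
      · have := ih (dep (par w)) (hn ▸ hdep w hw) (par w) rfl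
        exact this.trans (parGraph_adj par (par_ne hdep hw)).symm.reachable
  rw [isTree_iff_connected_and_card]
  refine ⟨hconn, le_antisymm ?_ hconn.card_vert_le_card_edgeSet_add_one⟩
  have hsub : (parGraph par).edgeSet ⊆ (fun i => s(i, par i)) '' {i | i ≠ r} := by
    intro e
    induction e with
    | _ x y =>
      intro he
      rw [mem_edgeSet, parGraph, fromRel_adj] at he
      rcases he with ⟨hne, h | h⟩
      · refine ⟨x, ?_, by simp [h]⟩
        rintro rfl
        exact hne (hr.symm.trans h)
      · refine ⟨y, ?_, by simp [h, Sym2.eq_swap]⟩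
        rintro rfl
        exact hne (h.symm.trans hr)
  have h1 : (parGraph par).edgeSet.ncard ≤ {i | i ≠ r}.ncard :=
    (Set.ncard_le_ncard hsub (Set.toFinite _)).trans (Set.ncard_image_le (Set.toFinite _))
  have h2 : {i | i ≠ r}.ncard + 1 = Nat.card ι := by
    have := Set.ncard_add_ncard_compl {r}
    rw [Set.ncard_singleton] at this
    rw [add_comm]; exact this
  rw [← h2]
  exact Nat.add_le_add_right h1 1

/-- Tree decompositions over arbitrary finite index types. -/
lemma hasTD_of {W : Type*} [Finite W] {G : SimpleGraph W} {k : ℕ} {ι : Type} [Finite ι]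
    {t : SimpleGraph ι} (ht : t.IsTree) (bag : ι → Set W) (h1 : ∀ v, ∃ i, v ∈ bag i)
    (h2 : ∀ u v, G.Adj u v → ∃ i, u ∈ bag i ∧ v ∈ bag i)
    (h3 : ∀ v, (t.induce {i | v ∈ bag i}).Connected) (h4 : ∀ i, (bag i).ncard ≤ k + 1) :
    HasTreeDecompWidthLE G k := by
  classical
  have := ht.1.nonempty
  haveI := Fintype.ofFinite ι
  obtain ⟨n, hn⟩ : ∃ n, Fintype.card ι = n + 1 :=
    ⟨Fintype.card ι - 1, by have := Fintype.card_pos (α := ι); omega⟩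
  let e : ι ≃ Fin (n + 1) := (Fintype.equivFin ι).trans (finCongr hn)
  let f : t ≃g t.map e.toEmbedding := Iso.map e t
  refine ⟨n, t.map e.toEmbedding, fun i => (Set.toFinite (bag (e.symm i))).toFinset, ?_, ?_, ?_, ?_, ?_⟩
  · exact (Iso.isTree_iff f).1 ht
  · intro v
    obtain ⟨i, hi⟩ := h1 v
    exact ⟨e i, by simpa using hi⟩
  · intro u v h
    obtain ⟨i, hi, hi'⟩ := h2 u v h
    exact ⟨e i, by simpa using hi, by simpa using hi'⟩
  · intro v
    let g : t.induce {i | v ∈ bag i} ≃g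
        (t.map e.toEmbedding).induce {i | v ∈ (Set.toFinite (bag (e.symm i))).toFinset} :=
      { toEquiv := e.subtypeEquiv (by intro a; simp)
        map_rel_iff' := by
          intro a b
          exact f.map_adj_iff (v := a.1) (w := b.1) }
    exact (Iso.connected_iff g).1 (h3 v)
  · intro i
    rw [← Set.ncard_eq_toFinset_card]
    exact h4 _

lemma hasTD_of_good [Finite V] {G : SimpleGraph V} {k : ℕ} (hiso : ∀ v, ∃ w, G.Adj v w)
    (h : Good k G.edgeSet G.edgeSet) : HasTreeDecompWidthLE G k := by
  classical
  obtain ⟨ι, _, r, par, dep, bag, hr, hdep, hin, hcov, htop, hcard, hbd⟩ := h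
  refine hasTD_of (parGraph_isTree hr hdep) bag ?_ ?_ ?_ hcard
  · intro v
    obtain ⟨w, hw⟩ := hiso v
    obtain ⟨i, hi⟩ := hcov s(v, w) hw
    exact ⟨i, hi v (by simp)⟩
  · intro u v huv
    obtain ⟨i, hi⟩ := hcov s(u, v) huv
    exact ⟨i, hi u (by simp), hi v (by simp)⟩
  · intro v
    -- every index in the set reaches a top one
    have reach : ∀ i (hi : v ∈ bag i), ∃ (j : ι) (hj : v ∈ bag j), (j = r ∨ v ∉ bag (par j)) ∧
        ((parGraph par).induce {i | v ∈ bag i}).Reachable ⟨i, hi⟩ ⟨j, hj⟩ := by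
      intro i
      induction hn : dep i using Nat.strong_induction_on generalizing i with
      | _ n ih =>
        intro hi
        by_cases hw : i = r ∨ v ∉ bag (par i)
        · exact ⟨i, hi, hw, Reachable.refl _⟩
        · push Not at hw
          obtain ⟨j, hj, h1, h2⟩ := ih _ (hn ▸ hdep i hw.1) (par i) rfl hw.2
          refine ⟨j, hj, h1, Reachable.trans (Adj.reachable ?_) h2⟩
          exact parGraph_adj par (par_ne hdep hw.1)
    obtain ⟨w, hw⟩ := hiso v
    obtain ⟨i, hi⟩ := hcov s(v, w) hw
    obtain ⟨j, hj, h1, -⟩ := reach i (hi v (by simp))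
    rw [connected_iff_exists_forall_reachable]
    refine ⟨⟨j, hj⟩, ?_⟩
    rintro ⟨i', hi'⟩
    obtain ⟨j', hj', h1', h2'⟩ := reach i' hi'
    have := htop v j j' hj hj' h1 h1'
    subst this
    exact h2'.symm

end Good


section Sweep
variable {V : Type}

/-- Edges inside `W`. -/
def innerE (G : SimpleGraph V) (W : Set V) : Set (Sym2 V) := {e | e ∈ G.edgeSet ∧ ∀ v ∈ e, v ∈ W}

/-- Edges leaving `W`. -/
def deltaE (G : SimpleGraph V) (W : Set V) : Set (Sym2 V) :=
  {e | e ∈ G.edgeSet ∧ (∃ v ∈ e, v ∈ W) ∧ ∃ v ∈ e, v ∉ W}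

lemma innerE_sub (G : SimpleGraph V) (W : Set V) : innerE G W ⊆ G.edgeSet := fun _ h => h.1

lemma deltaE_sub (G : SimpleGraph V) (W : Set V) : deltaE G W ⊆ G.edgeSet := fun _ h => h.1

lemma deltaE_eq {G : SimpleGraph V} {W : Set V} {e : Sym2 V} (h : e ∈ deltaE G W) :
    ∃ a b, a ∈ W ∧ b ∉ W ∧ e = s(a, b) := by
  obtain ⟨-, ⟨a, ha, haW⟩, b, hb, hbW⟩ := h
  refine ⟨a, b, haW, hbW, ?_⟩
  have hab : a ≠ b := by rintro rfl; exact hbW haW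
  exact ((Sym2.mem_and_mem_iff hab).1 ⟨ha, hb⟩)

lemma bdry_push {G : SimpleGraph V} {W : Set V} {K : Set (Sym2 V)} (hK : K ⊆ deltaE G W) {v : V}
    (hv : v ∈ bdry G.edgeSet (innerE G W ∪ K)) :
    (v ∈ W ∧ ∃ e ∈ deltaE G W, e ∉ K ∧ v ∈ e) ∨ (v ∉ W ∧ ∃ e ∈ K, v ∈ e) := by
  obtain ⟨⟨f, hf, hvf⟩, e, he, hne, hve⟩ := hv
  by_cases hW : v ∈ W
  · left
    refine ⟨hW, e, ⟨he, ⟨v, hve, hW⟩, ?_⟩, fun h => hne (Or.inr h), hve⟩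
    by_contra hcon
    push Not at hcon
    exact hne (Or.inl ⟨he, hcon⟩)
  · right
    refine ⟨hW, f, ?_, hvf⟩
    rcases hf with hf | hf
    · exact absurd (hf.2 v hvf) hW
    · exact hf

lemma good_push [Finite V] [Nonempty V] {G : SimpleGraph V} {W : Set V} (hW : Good 3 G.edgeSet (innerE G W))
    (hd : (deltaE G W).ncard ≤ 3) (K : Set (Sym2 V)) (hK : K ⊆ deltaE G W) :
    Good 3 G.edgeSet (innerE G W ∪ K) := by
  classical
  have hfin : K.Finite := Set.toFinite K
  induction K, hfin using Set.Finite.induction_on with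
  | empty => simpa using hW
  | @insert k K' hk hfin ih =>
    have hK' : K' ⊆ deltaE G W := fun e he => hK (Set.mem_insert_of_mem _ he)
    have hkd : k ∈ deltaE G W := hK (Set.mem_insert _ _)
    have ih' := ih hK'
    choose! a b hab using fun e (h : e ∈ deltaE G W) => deltaE_eq h
    have h1 : innerE G W ∪ insert k K' = (innerE G W ∪ K') ∪ {k} := by
      ext e; simp only [Set.mem_union, Set.mem_insert_iff, Set.mem_singleton_iff]; tauto
    rw [h1]
    have hkeq := (hab k hkd).2.2
    have hsing : Good 3 G.edgeSet {k} := by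
      rw [hkeq]; exact good_single 3 (by norm_num) _ _ _
    refine good_join ih' hsing ?_ ?_ ?_ ?_
    · exact Set.union_subset (innerE_sub G W) (hK'.trans (deltaE_sub G W))
    · exact Set.singleton_subset_iff.2 hkd.1
    · rw [Set.disjoint_singleton_right]
      rintro (h | h)
      · obtain ⟨v, hv, hvW⟩ := hkd.2.2
        exact hvW (h.2 v hv)
      · exact hk h
    · have hsub : bdry G.edgeSet (innerE G W ∪ K') ∪ bdry G.edgeSet {k} ⊆
          insert (b k) ((fun e => if e ∈ K' then b e else a e) '' deltaE G W) := by
        rintro v (hv | hv)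
        · right
          rcases bdry_push hK' hv with ⟨hvW, e, he, heK, hve⟩ | ⟨hvW, e, he, hve⟩
          · refine ⟨e, he, ?_⟩
            simp only [heK, if_false]
            obtain ⟨h1, h2, h3⟩ := hab e he
            rw [h3, Sym2.mem_iff] at hve
            rcases hve with h | h
            · exact h.symm
            · exact absurd (h ▸ hvW) h2
          · refine ⟨e, hK' he, ?_⟩
            simp only [he, if_true]
            obtain ⟨h1, h2, h3⟩ := hab e (hK' he)
            rw [h3, Sym2.mem_iff] at hve
            rcases hve with h | h
            · exact absurd (h ▸ h1) hvW
            · exact h.symm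
        · obtain ⟨e, he, hve⟩ := hv.1
          rw [Set.mem_singleton_iff] at he
          rw [he, hkeq, Sym2.mem_iff] at hve
          rcases hve with h | h
          · right
            refine ⟨k, hkd, ?_⟩
            simp only [hk, if_false]
            exact h.symm
          · left; exact h
      calc _ ≤ _ := Set.ncard_le_ncard hsub (Set.toFinite _)
        _ ≤ ((fun e => if e ∈ K' then b e else a e) '' deltaE G W).ncard + 1 := Set.ncard_insert_le _ _
        _ ≤ 3 + 1 := by
          have := Set.ncard_image_le (f := (fun e => if e ∈ K' then b e else a e))
            (Set.toFinite (deltaE G W))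
          omega

lemma good_small [Finite V] {G : SimpleGraph V} {N : Set V} (hN : N.ncard ≤ 4)
    (K : Set (Sym2 V)) (hK : K ⊆ innerE G N) : Good 3 G.edgeSet K := by
  classical
  have hfin : K.Finite := Set.toFinite K
  have hb : ∀ K : Set (Sym2 V), K ⊆ innerE G N → bdry G.edgeSet K ⊆ N := by
    rintro K hK v ⟨⟨e, he, hv⟩, -⟩
    exact (hK he).2 v hv
  induction K, hfin using Set.Finite.induction_on with
  | empty => exact good_empty 3 _
  | @insert k K' hk hfin ih =>
    have hK' : K' ⊆ innerE G N := fun e he => hK (Set.mem_insert_of_mem _ he)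
    have hkd : k ∈ innerE G N := hK (Set.mem_insert _ _)
    rw [Set.insert_eq, Set.union_comm]
    refine good_join (ih hK') ?_ (hK'.trans (innerE_sub G N)) (Set.singleton_subset_iff.2 hkd.1) ?_ ?_
    · induction k with
      | _ a b => exact good_single 3 (by norm_num) _ _ _
    · rwa [Set.disjoint_singleton_right]
    · refine le_trans (Set.ncard_le_ncard (Set.union_subset (hb _ hK')
        (hb _ (Set.singleton_subset_iff.2 hkd))) (Set.toFinite _)) hN

lemma good_step [Finite V] [Nonempty V] {G : SimpleGraph V} {W₀ W₁ W₂ N : Set V}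
    (h0 : ∀ v, v ∈ W₀ ↔ v ∈ W₁ ∨ v ∈ W₂ ∨ v ∈ N)
    (h12 : ∀ v, v ∈ W₁ → v ∉ W₂) (h1N : ∀ v, v ∈ W₁ → v ∉ N) (h2N : ∀ v, v ∈ W₂ → v ∉ N)
    (g1 : Good 3 G.edgeSet (innerE G W₁)) (g2 : Good 3 G.edgeSet (innerE G W₂))
    (d1 : (deltaE G W₁).ncard ≤ 3) (d2 : (deltaE G W₂).ncard ≤ 3)
    (hc : N.ncard + {e | (e ∈ deltaE G W₁ ∨ e ∈ deltaE G W₂) ∧ ∀ v ∈ e, v ∉ N}.ncard ≤ 4) :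
    Good 3 G.edgeSet (innerE G W₀) := by
  classical
  set D : Set (Sym2 V) := {e | (e ∈ deltaE G W₁ ∨ e ∈ deltaE G W₂) ∧ ∀ v ∈ e, v ∉ N} with hD
  let K₁ : Set (Sym2 V) := {e | e ∈ deltaE G W₁ ∧ ∃ v ∈ e, v ∈ N ∨ v ∈ W₂}
  let K₂ : Set (Sym2 V) := {e | e ∈ deltaE G W₂ ∧ ∃ v ∈ e, v ∈ N}
  have hK1 : K₁ ⊆ deltaE G W₁ := fun e h => h.1
  have hK2 : K₂ ⊆ deltaE G W₂ := fun e h => h.1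
  have g1' := good_push g1 d1 K₁ hK1
  have g2' := good_push g2 d2 K₂ hK2
  have hNc : N.ncard ≤ 4 := by omega
  have g3 := good_small hNc (innerE G N) (le_refl _)
  have hcf : ∀ e ∈ D, ∃ c, (c ∈ e ∧ c ∈ W₂) ∨ ((∀ v ∈ e, v ∉ W₂) ∧ c ∈ e ∧ c ∈ W₁) := by
    rintro e ⟨he | he, -⟩
    · by_cases h : ∃ c ∈ e, c ∈ W₂
      · obtain ⟨c, hc⟩ := h; exact ⟨c, Or.inl hc⟩
      · push Not at h
        obtain ⟨c, hc, hc'⟩ := he.2.1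
        exact ⟨c, Or.inr ⟨h, hc, hc'⟩⟩
    · obtain ⟨c, hc, hc'⟩ := he.2.1
      exact ⟨c, Or.inl ⟨hc, hc'⟩⟩
  choose! c hcc using hcf
  let B : Set V := N ∪ c '' D
  have hBc : B.ncard ≤ 4 := by
    have h1 := Set.ncard_union_le N (c '' D)
    have h2 := Set.ncard_image_le (f := c) (Set.toFinite D)
    have h3 : B.ncard ≤ N.ncard + (c '' D).ncard := h1
    omega
  -- both edges in `delta` with two different ends in a set
  have two : ∀ (W : Set V) (e : Sym2 V), e ∈ deltaE G W → ∀ x y, x ∈ e → y ∈ e → x ∈ W → y ∈ W →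
      x = y := by
    intro W e he x y hx hy hxW hyW
    obtain ⟨a, b, ha, hb, rfl⟩ := deltaE_eq he
    rw [Sym2.mem_iff] at hx hy
    rcases hx with rfl | rfl <;> rcases hy with rfl | rfl <;> first | rfl | exact absurd hxW hb | exact absurd hyW hb
  have two' : ∀ (W : Set V) (e : Sym2 V), e ∈ deltaE G W → ∀ x y, x ∈ e → y ∈ e → x ∉ W → y ∉ W →
      x = y := by
    intro W e he x y hx hy hxW hyW
    obtain ⟨a, b, ha, hb, rfl⟩ := deltaE_eq he
    rw [Sym2.mem_iff] at hx hy
    rcases hx with rfl | rfl <;> rcases hy with rfl | rfl <;> first | rfl | exact absurd ha hxW | exact absurd ha hyW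
  have hb1 : bdry G.edgeSet (innerE G W₁ ∪ K₁) ⊆ B := by
    intro v hv
    rcases bdry_push hK1 hv with ⟨hvW, e, he, heK, hve⟩ | ⟨hvW, e, he, hve⟩
    · right
      have hno : ∀ w ∈ e, ¬ (w ∈ N ∨ w ∈ W₂) := by
        intro w hw h
        exact heK ⟨he, w, hw, h⟩
      have heD : e ∈ D := ⟨Or.inl he, fun w hw h => hno w hw (Or.inl h)⟩
      refine ⟨e, heD, ?_⟩
      rcases hcc e heD with ⟨h1, h2⟩ | ⟨h1, h2, h3⟩
      · exact absurd (Or.inr h2) (hno _ h1)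
      · exact two W₁ e he _ _ h2 hve h3 hvW
    · obtain ⟨he', w, hw, hwN⟩ := he
      have hwv : w = v := by
        refine two' W₁ e he' w v hw hve ?_ hvW
        intro hwW
        rcases hwN with h | h
        · exact h1N w hwW h
        · exact h12 w hwW h
      subst hwv
      rcases hwN with h | h
      · exact Or.inl h
      · right
        have heD : e ∈ D := by
          refine ⟨Or.inl he', ?_⟩
          intro x hx hxN
          have : x = w := two' W₁ e he' x w hx hw (fun h => h1N x h hxN) hvW
          exact h2N w h (this ▸ hxN)
        refine ⟨e, heD, ?_⟩
        rcases hcc e heD with ⟨h1, h2⟩ | ⟨h1, h2, h3⟩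
        · exact two' W₁ e he' _ _ h1 hve (fun h' => h12 _ h' h2) hvW
        · exact absurd h (h1 w hw)
  have hb2 : bdry G.edgeSet (innerE G W₂ ∪ K₂) ⊆ B := by
    intro v hv
    rcases bdry_push hK2 hv with ⟨hvW, e, he, heK, hve⟩ | ⟨hvW, e, he, hve⟩
    · right
      have heD : e ∈ D := ⟨Or.inr he, fun w hw h => heK ⟨he, w, hw, h⟩⟩
      refine ⟨e, heD, ?_⟩
      rcases hcc e heD with ⟨h1, h2⟩ | ⟨h1, h2, h3⟩
      · exact two W₂ e he _ _ h1 hve h2 hvW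
      · exact absurd hvW (h1 v hve)
    · obtain ⟨he', w, hw, hwN⟩ := he
      have hwv : w = v := two' W₂ e he' w v hw hve (fun h => h2N w h hwN) hvW
      exact Or.inl (hwv ▸ hwN)
  have hb3 : bdry G.edgeSet (innerE G N) ⊆ B := by
    rintro v ⟨⟨e, he, hv⟩, -⟩
    exact Or.inl (he.2 v hv)
  have hbu : ∀ F F' : Set (Sym2 V), bdry G.edgeSet (F ∪ F') ⊆ bdry G.edgeSet F ∪ bdry G.edgeSet F' := by
    rintro F F' v ⟨⟨e, he, hv⟩, e', he', hn, hv'⟩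
    rcases he with he | he
    · exact Or.inl ⟨⟨e, he, hv⟩, e', he', fun h => hn (Or.inl h), hv'⟩
    · exact Or.inr ⟨⟨e, he, hv⟩, e', he', fun h => hn (Or.inr h), hv'⟩
  have s1 : innerE G W₁ ∪ K₁ ⊆ G.edgeSet := Set.union_subset (innerE_sub _ _) (hK1.trans (deltaE_sub _ _))
  have s2 : innerE G W₂ ∪ K₂ ⊆ G.edgeSet := Set.union_subset (innerE_sub _ _) (hK2.trans (deltaE_sub _ _))
  have dis12 : Disjoint (innerE G W₁ ∪ K₁) (innerE G W₂ ∪ K₂) := by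
    rw [Set.disjoint_left]
    have h1 : ∀ e, e ∈ innerE G W₁ ∪ K₁ → ∃ v ∈ e, v ∈ W₁ := by
      rintro e (he | he)
      · induction e with
        | _ a b => exact ⟨a, by simp, he.2 a (by simp)⟩
      · exact he.1.2.1
    rintro e he (he' | he')
    · obtain ⟨v, hv, hvW⟩ := h1 e he
      exact h12 v hvW (he'.2 v hv)
    · obtain ⟨he'', w, hw, hwN⟩ := he'
      obtain ⟨v, hv, hvW⟩ := h1 e he
      obtain ⟨x, hx, hxW⟩ := he''.2.1
      have : v = w := two' W₂ e he'' v w hv hw (h12 v hvW) (fun h => h2N w h hwN)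
      exact h1N v hvW (this ▸ hwN)
  have g12 := good_join g1' g2' s1 s2 dis12
    ((Set.ncard_le_ncard (Set.union_subset hb1 hb2) (Set.toFinite _)).trans hBc)
  have dis3 : Disjoint ((innerE G W₁ ∪ K₁) ∪ (innerE G W₂ ∪ K₂)) (innerE G N) := by
    rw [Set.disjoint_right]
    rintro e he h
    have : ∃ v ∈ e, v ∈ W₁ ∨ v ∈ W₂ := by
      rcases h with (h | h) | (h | h)
      · induction e with
        | _ a b => exact ⟨a, by simp, Or.inl (h.2 a (by simp))⟩
      · obtain ⟨v, hv, hvW⟩ := h.1.2.1; exact ⟨v, hv, Or.inl hvW⟩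
      · induction e with
        | _ a b => exact ⟨a, by simp, Or.inr (h.2 a (by simp))⟩
      · obtain ⟨v, hv, hvW⟩ := h.1.2.1; exact ⟨v, hv, Or.inr hvW⟩
    obtain ⟨v, hv, h | h⟩ := this
    · exact h1N v h (he.2 v hv)
    · exact h2N v h (he.2 v hv)
  have g123 := good_join g12 g3 (Set.union_subset s1 s2) (innerE_sub _ _) dis3
    ((Set.ncard_le_ncard (Set.union_subset ((hbu _ _).trans (Set.union_subset hb1 hb2)) hb3)
      (Set.toFinite _)).trans hBc)
  convert g123 using 1
  ext e
  induction e with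
  | _ a b =>
    simp only [innerE, K₁, K₂, deltaE, Set.mem_union, Set.mem_setOf_eq, Sym2.mem_iff,
      forall_eq_or_imp, forall_eq, exists_eq_or_imp, exists_eq_left, h0]
    have q1 := h12 a; have q2 := h12 b; have q3 := h1N a; have q4 := h1N b
    have q5 := h2N a; have q6 := h2N b
    clear * - q1 q2 q3 q4 q5 q6
    generalize (s(a, b) ∈ G.edgeSet) = P
    grind

theorem good_sweep [Finite V] [Nonempty V] {U : Type} [Finite U] {G : SimpleGraph V} {T : SimpleGraph U}
    (hTc : T.Connected) (hTa : T.IsAcyclic) (ψ : V → U)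
    (hdeg : ∀ w u, T.Adj w u → (∀ v, T.Adj u v → v = w) ∨ ∃ v₁ v₂, v₁ ≠ v₂ ∧ v₁ ≠ w ∧ v₂ ≠ w ∧
      T.Adj u v₁ ∧ T.Adj u v₂ ∧ ∀ v, T.Adj u v → v = w ∨ v = v₁ ∨ v = v₂)
    (r v₀ : U) (hr : T.Adj r v₀) (hr' : ∀ v, T.Adj r v → v = v₀)
    (hcut : ∀ p q, T.Adj p q → (deltaE G (ψ ⁻¹' side T p q)).ncard ≤ 3)
    (hnode : ∀ u, (ψ ⁻¹' {u}).ncard +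
      {e | (∃ v, T.Adj u v ∧ e ∈ deltaE G (ψ ⁻¹' side T u v)) ∧ ∀ x ∈ e, ψ x ≠ u}.ncard ≤ 4) :
    Good 3 G.edgeSet G.edgeSet := by
  classical
  have inner0 : innerE G ∅ = ∅ := by
    ext e
    induction e with
    | _ a b =>
      constructor
      · intro h; exact absurd (h.2 a (by simp)) (by simp)
      · intro h; exact absurd h (by simp)
  have delta0 : deltaE G ∅ = ∅ := by
    ext e
    simp [deltaE]
  have main : ∀ n w u, T.Adj w u → (side T w u).ncard = n →
      Good 3 G.edgeSet (innerE G (ψ ⁻¹' side T w u)) := by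
    intro n
    induction n using Nat.strong_induction_on with
    | _ n ih =>
      intro w u hwu hn
      have hdec := side_decomp hTc hTa hwu
      have hnu := hnode u
      rcases hdeg w u hwu with hd | ⟨v₁, v₂, hne, hne1, hne2, ha1, ha2, hall⟩
      · refine good_step (W₁ := ∅) (W₂ := ∅) (N := ψ ⁻¹' {u}) ?_ (by simp) (by simp) (by simp)
          (by rw [inner0]; exact good_empty _ _) (by rw [inner0]; exact good_empty _ _)
          (by simp [delta0]) (by simp [delta0]) ?_
        · intro v
          simp only [Set.mem_preimage, hdec, Set.mem_empty_iff_false, false_or, Set.mem_singleton_iff]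
          constructor
          · rintro (h | ⟨x, hx, hx', -⟩)
            · exact h
            · exact absurd (hd x hx) hx'
          · exact Or.inl
        · simp only [delta0]
          simp only [Set.mem_empty_iff_false, false_and, or_self]
          simp only [Set.setOf_false, Set.ncard_empty]
          omega
      · have sub : ∀ v, T.Adj u v → v ≠ w → (side T u v).ncard < n := by
          intro v hv hvw
          rw [← hn]
          refine Set.ncard_lt_ncard ?_ (Set.toFinite _)
          rw [Set.ssubset_iff_of_subset]
          · exact ⟨u, side_self T w u, side_not_mem hTa hv⟩
          · intro z hz
            exact (hdec z).2 (Or.inr ⟨v, hv, hvw, hz⟩)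
        refine good_step (W₁ := ψ ⁻¹' side T u v₁) (W₂ := ψ ⁻¹' side T u v₂) (N := ψ ⁻¹' {u})
          ?_ ?_ ?_ ?_ (ih _ (sub v₁ ha1 hne1) u v₁ ha1 rfl) (ih _ (sub v₂ ha2 hne2) u v₂ ha2 rfl)
          (hcut _ _ ha1) (hcut _ _ ha2) ?_
        · intro v
          simp only [Set.mem_preimage, hdec, Set.mem_singleton_iff]
          constructor
          · rintro (h | ⟨x, hx, hx', hx''⟩)
            · exact Or.inr (Or.inr h)
            · rcases hall x hx with h | h | h
              · exact absurd h hx'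
              · exact Or.inl (h ▸ hx'')
              · exact Or.inr (Or.inl (h ▸ hx''))
          · rintro (h | h | h)
            · exact Or.inr ⟨v₁, ha1, hne1, h⟩
            · exact Or.inr ⟨v₂, ha2, hne2, h⟩
            · exact Or.inl h
        · intro v h1 h2
          exact side_disj_nbr hTa ha1 ha2 hne h1 h2
        · intro v h1 h2
          rw [Set.mem_preimage, Set.mem_singleton_iff] at h2
          rw [Set.mem_preimage, h2] at h1
          exact side_not_mem hTa ha1 h1
        · intro v h1 h2
          rw [Set.mem_preimage, Set.mem_singleton_iff] at h2
          rw [Set.mem_preimage, h2] at h1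
          exact side_not_mem hTa ha2 h1
        · refine le_trans (Nat.add_le_add_left (Set.ncard_le_ncard ?_ (Set.toFinite _)) _) hnu
          rintro e ⟨h | h, h'⟩
          · exact ⟨⟨v₁, ha1, h⟩, h'⟩
          · exact ⟨⟨v₂, ha2, h⟩, h'⟩
  have hfin := good_step (W₀ := Set.univ) (W₁ := ψ ⁻¹' side T r v₀) (W₂ := ∅) (N := ψ ⁻¹' {r})
    (G := G) ?_ (by simp) ?_ (by simp) (main _ r v₀ hr rfl) (by rw [inner0]; exact good_empty _ _)
    (hcut _ _ hr) (by simp [delta0]) ?_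
  · convert hfin using 1
    ext e
    simp [innerE]
  · intro v
    simp only [Set.mem_univ, true_iff, Set.mem_preimage, Set.mem_empty_iff_false, false_or,
      Set.mem_singleton_iff]
    by_cases h : ψ v = r
    · exact Or.inr h
    · obtain ⟨x, hx, hx'⟩ := side_cover_nbr hTc r (ψ v) h
      exact Or.inl (hr' x hx ▸ hx')
  · intro v h1 h2
    rw [Set.mem_preimage, Set.mem_singleton_iff] at h2
    rw [Set.mem_preimage, h2] at h1
    exact side_not_mem hTa hr h1
  · refine le_trans (Nat.add_le_add_left (Set.ncard_le_ncard ?_ (Set.toFinite _)) _) (hnode r)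
    rintro e ⟨h | h, h'⟩
    · exact ⟨⟨v₀, hr, h⟩, h'⟩
    · rw [delta0] at h; exact absurd h (by simp)

end Sweep


section Cuts
variable {Y : Type} [Fintype Y]

open Classical in
/-- number of ordered adjacent pairs from `A` to `B`. -/
noncomputable def ee (G : SimpleGraph Y) (A B : Set Y) : ℕ :=
  ∑ y, ∑ z, if G.Adj y z ∧ y ∈ A ∧ z ∈ B then 1 else 0

/-- The cut function. -/
noncomputable def dcut (G : SimpleGraph Y) (S : Set Y) : ℕ := ee G S Sᶜ

lemma ee_eq_ncard (G : SimpleGraph Y) (A B : Set Y) :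
    ee G A B = {p : Y × Y | G.Adj p.1 p.2 ∧ p.1 ∈ A ∧ p.2 ∈ B}.ncard := by
  classical
  rw [Set.ncard_eq_toFinset_card', ee, ← Finset.sum_product', Finset.card_eq_sum_ones,
    Set.toFinset_setOf, Finset.sum_filter]
  rfl

lemma ee_comm (G : SimpleGraph Y) (A B : Set Y) : ee G A B = ee G B A := by
  classical
  unfold ee
  rw [Finset.sum_comm]
  refine Finset.sum_congr rfl fun y _ => Finset.sum_congr rfl fun z _ => ?_
  refine if_congr ?_ rfl rfl
  rw [G.adj_comm]; tauto

lemma ee_union_left (G : SimpleGraph Y) {A A' : Set Y} (B : Set Y) (h : ∀ y ∈ A, y ∉ A') :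
    ee G (A ∪ A') B = ee G A B + ee G A' B := by
  classical
  unfold ee
  simp only [← Finset.sum_add_distrib]
  refine Finset.sum_congr rfl fun y _ => Finset.sum_congr rfl fun z _ => ?_
  have := h y
  simp only [Set.mem_union]
  split_ifs <;> first | rfl | (exfalso; tauto)

lemma ee_union_right (G : SimpleGraph Y) {A A' : Set Y} (B : Set Y) (h : ∀ y ∈ A, y ∉ A') :
    ee G B (A ∪ A') = ee G B A + ee G B A' := by
  rw [ee_comm, ee_union_left G B h, ee_comm G A, ee_comm G A']

lemma dcut_compl (G : SimpleGraph Y) (A : Set Y) : dcut G Aᶜ = dcut G A := by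
  unfold dcut
  rw [compl_compl, ee_comm]

lemma dcut_submod (G : SimpleGraph Y) (A B : Set Y) :
    dcut G (A ∩ B) + dcut G (A ∪ B) ≤ dcut G A + dcut G B := by
  classical
  unfold dcut ee
  simp only [← Finset.sum_add_distrib]
  refine Finset.sum_le_sum fun y _ => Finset.sum_le_sum fun z _ => ?_
  simp only [Set.mem_union, Set.mem_inter_iff, Set.mem_compl_iff]
  by_cases h0 : G.Adj y z <;> by_cases h1 : y ∈ A <;> by_cases h2 : y ∈ B <;>
    by_cases h3 : z ∈ A <;> by_cases h4 : z ∈ B <;> simp [*]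

lemma dcut_posimod (G : SimpleGraph Y) (A B : Set Y) :
    dcut G (A \ B) + dcut G (B \ A) ≤ dcut G A + dcut G B := by
  have := dcut_submod G A Bᶜ
  rw [dcut_compl] at this
  have h : A ∪ Bᶜ = (B \ A)ᶜ := by
    ext x; simp only [Set.mem_union, Set.mem_compl_iff, Set.mem_diff]; tauto
  rw [h, dcut_compl] at this
  exact this

lemma ee_univ_deg (G : SimpleGraph Y) (A : Set Y) (k : Y → ℕ)
    (hk : ∀ y ∈ A, (G.neighborSet y).ncard = k y) [DecidablePred (· ∈ A)] :
    ee G A Set.univ = ∑ y, if y ∈ A then k y else 0 := by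
  classical
  unfold ee
  refine Finset.sum_congr rfl fun y _ => ?_
  by_cases hy : y ∈ A
  · simp only [hy, true_and, Set.mem_univ, and_true, if_true]
    rw [← hk y hy, Set.ncard_eq_toFinset_card', Finset.card_eq_sum_ones]
    rw [← Finset.sum_filter]
    refine Finset.sum_congr ?_ fun _ _ => rfl
    ext z; simp
  · simp [hy]

lemma ee_split (G : SimpleGraph Y) (A : Set Y) : ee G A Set.univ = ee G A A + dcut G A := by
  rw [dcut, ← ee_union_right G A (A := A) (A' := Aᶜ) (by simp), Set.union_compl_self]

lemma ee_forest {G : SimpleGraph Y} (hG : G.IsAcyclic) {M : Set Y} (hM : M.Nonempty) :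
    ee G M M + 2 ≤ 2 * M.ncard := by
  classical
  haveI : Nonempty M := hM.to_subtype
  have hac := hG.induce M
  obtain ⟨t, hle, -, ht⟩ := (connected_top (V := M)).exists_isTree_le_of_le_of_isAcyclic le_top hac
  have h1 := ht.card_edgeFinset
  have h2 : (G.induce M).edgeFinset.card ≤ t.edgeFinset.card :=
    Finset.card_le_card (edgeFinset_mono hle)
  have h3 := (G.induce M).two_mul_card_edgeFinset
  have h4 : ee G M M = (Finset.univ.filter fun p : M × M => (G.induce M).Adj p.1 p.2).card := by
    rw [ee_eq_ncard]
    rw [← Set.ncard_coe_finset]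
    symm
    refine Set.ncard_congr (fun p _ => (p.1.1, p.2.1)) ?_ ?_ ?_
    · rintro ⟨a, b⟩ h
      simp at h
      exact ⟨h, a.2, b.2⟩
    · rintro ⟨⟨a, _⟩, b, _⟩ ⟨⟨c, _⟩, d, _⟩ _ _ h
      simp at h ⊢; exact h
    · rintro ⟨a, b⟩ ⟨h, ha, hb⟩
      exact ⟨⟨⟨a, ha⟩, b, hb⟩, by simpa using h, rfl⟩
  rw [Set.ncard_eq_toFinset_card', Set.toFinset_card]
  rw [h4]
  have h5 : (Finset.univ.filter fun p : M × M => (G.induce M).Adj p.1 p.2).card = 2 * (G.induce M).edgeFinset.card := by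
    rw [h3]
  omega

/-- The number of edges changed by `g`. -/
noncomputable def changes {V C : Type*} (G : SimpleGraph V) (g : V → C) : ℕ :=
  {e | e ∈ G.edgeSet ∧ ∃ u v : V, e = s(u, v) ∧ g u ≠ g v}.ncard

lemma lt_le_changes (G : SimpleGraph Y) {k : ℕ} (g : Y → Fin k) :
    {p : Y × Y | G.Adj p.1 p.2 ∧ g p.1 < g p.2}.ncard ≤ changes G g := by
  unfold changes
  refine Set.ncard_le_ncard_of_injOn (fun p => s(p.1, p.2)) ?_ ?_ (Set.toFinite _)
  · rintro ⟨y, z⟩ ⟨h1, h2⟩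
    exact ⟨h1, y, z, rfl, h2.ne⟩
  · rintro ⟨y, z⟩ ⟨h1, h2⟩ ⟨y', z'⟩ ⟨h1', h2'⟩ h
    rcases Sym2.eq_iff.1 h with ⟨h3, h4⟩ | ⟨h3, h4⟩
    · simp only at h3 h4; rw [h3, h4]
    · simp only at h3 h4 h2 h2'
      subst h3; subst h4
      exact absurd h2 (not_lt.2 h2'.le)

lemma dcut_le_changes (G : SimpleGraph Y) (g : Y → Fin 2) :
    dcut G {y | g y = 0} ≤ changes G g := by
  refine le_trans ?_ (lt_le_changes G g)
  rw [dcut, ee_eq_ncard]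
  refine Set.ncard_le_ncard ?_ (Set.toFinite _)
  rintro ⟨y, z⟩ ⟨h, h1, h2⟩
  refine ⟨h, ?_⟩
  simp only [Set.mem_setOf_eq, Set.mem_compl_iff] at h1 h2 ⊢
  rw [h1]; exact Fin.pos_of_ne_zero h2

lemma dcut3_le_changes (G : SimpleGraph Y) (g : Y → Fin 3) :
    dcut G {y | g y = 0} + dcut G {y | g y = 1} + dcut G {y | g y = 2} ≤ 2 * changes G g := by
  classical
  have h1 := lt_le_changes G g
  have h2 : {p : Y × Y | G.Adj p.1 p.2 ∧ g p.2 < g p.1}.ncard ≤ changes G g := by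
    refine le_trans (le_of_eq ?_) h1
    refine Set.ncard_congr (fun p _ => (p.2, p.1)) ?_ ?_ ?_
    · rintro ⟨y, z⟩ ⟨h, h'⟩; exact ⟨h.symm, h'⟩
    · rintro ⟨y, z⟩ ⟨y', z'⟩ _ _ h; simp at h ⊢; tauto
    · rintro ⟨y, z⟩ ⟨h, h'⟩; exact ⟨(z, y), ⟨h.symm, h'⟩, rfl⟩
  have e : ∀ P : Y × Y → Prop, {p : Y × Y | P p}.ncard = ∑ y, ∑ z, if P (y, z) then 1 else 0 := by
    intro P
    rw [Set.ncard_eq_toFinset_card', ← Finset.sum_product', Finset.card_eq_sum_ones,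
      Set.toFinset_setOf, Finset.sum_filter]
    rfl
  rw [e] at h1 h2
  rw [two_mul]
  refine le_trans ?_ (add_le_add h1 h2)
  unfold dcut ee
  simp only [← Finset.sum_add_distrib]
  refine Finset.sum_le_sum fun y _ => Finset.sum_le_sum fun z _ => ?_
  simp only [Set.mem_setOf_eq, Set.mem_compl_iff]
  by_cases h : G.Adj y z
  · simp only [h, true_and]
    generalize g y = a
    generalize g z = b
    revert a b
    decide
  · simp [h]

end Cuts


section Exchange
variable {U Y X : Type} [Fintype U] [Fintype Y]

open Classical in
/-- total cost of a placement. -/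
noncomputable def cost (T : SimpleGraph U) (G : SimpleGraph Y) (φ : Y → U) : ℕ :=
  ∑ p, ∑ q, if T.Adj p q then dcut G (φ ⁻¹' side T p q) else 0

/-- depth of a vertex with respect to a root. -/
noncomputable def depth (T : SimpleGraph U) (r u : U) : ℕ :=
  {pq : U × U | T.Adj pq.1 pq.2 ∧ r ∉ side T pq.1 pq.2 ∧ u ∈ side T pq.1 pq.2}.ncard

lemma depth_lt {T : SimpleGraph U} (hTc : T.Connected) (hTa : T.IsAcyclic) {r u v : U}
    (h : T.Adj u v) (hr : r ∉ side T u v) : depth T r u < depth T r v := by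
  unfold depth
  refine Set.ncard_lt_ncard ?_ (Set.toFinite _)
  rw [Set.ssubset_iff_of_subset]
  · exact ⟨(u, v), ⟨h, hr, side_self T u v⟩, fun h' => side_not_mem hTa h h'.2.2⟩
  · rintro ⟨p, q⟩ ⟨h1, h2, h3⟩
    refine ⟨h1, h2, ?_⟩
    simp only at h1 h2 h3 ⊢
    by_cases he : s(u, v) = s(p, q)
    · rcases Sym2.eq_iff.1 he with ⟨rfl, rfl⟩ | ⟨rfl, rfl⟩
      · exact side_self T _ _
      · exact absurd ((side_compl hTc hTa h).2 hr) h2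
    · exact (side_adj_iff h he).1 h3

open Classical in
/-- The exchanged placement. -/
noncomputable def exch (T : SimpleGraph U) (φ : Y → U) (a b : U) (S : Set Y) (y : Y) : U :=
  if y ∈ S then (if φ y ∈ side T a b then φ y else b) else (if φ y ∈ side T a b then a else φ y)

lemma exch_symm {T : SimpleGraph U} (hTc : T.Connected) (hTa : T.IsAcyclic) (φ : Y → U) {a b : U}
    (hab : T.Adj a b) (S : Set Y) : exch T φ b a Sᶜ = exch T φ a b S := by
  funext y
  unfold exch
  have := side_compl hTc hTa hab (w := φ y)
  by_cases h1 : y ∈ S <;> by_cases h2 : φ y ∈ side T a b <;> by_cases h3 : φ y ∈ side T b a <;>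
    simp [h1, h2, h3] <;> tauto

lemma exch_le {T : SimpleGraph U} {G : SimpleGraph Y} {l : X → U} {l' : X → Y}
    (hTa : T.IsAcyclic) {φ : Y → U} (hφ : ∀ x, φ (l' x) = l x)
    {a b : U} (hab : T.Adj a b) {S : Set Y} (hS : ∀ x, l' x ∈ S ↔ l x ∈ side T a b)
    (hmin : ∀ S' : Set Y, (∀ x, l' x ∈ S' ↔ l x ∈ side T a b) → dcut G S ≤ dcut G S')
    {p q : U} (hq : q ∈ side T a b) (hb : b ∉ side T p q) :
    dcut G (exch T φ a b S ⁻¹' side T p q) ≤ dcut G (φ ⁻¹' side T p q) := by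
  have hsub := side_subset hTa hab hq hb
  have ha := side_not_mem hTa hab
  have h1 : exch T φ a b S ⁻¹' side T p q = (φ ⁻¹' side T p q) ∩ S := by
    ext y
    simp only [Set.mem_preimage, exch, Set.mem_inter_iff]
    have := @hsub (φ y)
    have := @hsub a
    split_ifs <;> tauto
  rw [h1]
  have h2 := dcut_submod G (φ ⁻¹' side T p q) S
  have h3 := hmin ((φ ⁻¹' side T p q) ∪ S) (by
    intro x
    simp only [Set.mem_union, Set.mem_preimage, hφ, hS]
    have := @hsub (l x)
    tauto)
  omega

lemma dcut_side_symm {T : SimpleGraph U} (hTc : T.Connected) (hTa : T.IsAcyclic)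
    (G : SimpleGraph Y) (φ : Y → U) {p q : U} (h : T.Adj p q) :
    dcut G (φ ⁻¹' side T q p) = dcut G (φ ⁻¹' side T p q) := by
  rw [← dcut_compl]
  congr 1
  ext y
  simp only [Set.mem_compl_iff, Set.mem_preimage, side_compl hTc hTa h, not_not]

lemma cost_lt {T : SimpleGraph U} {G : SimpleGraph Y} {φ φ' : Y → U}
    (h : ∀ p q, T.Adj p q → dcut G (φ' ⁻¹' side T p q) ≤ dcut G (φ ⁻¹' side T p q))
    {a b : U} (hab : T.Adj a b)
    (hlt : dcut G (φ' ⁻¹' side T a b) < dcut G (φ ⁻¹' side T a b)) : cost T G φ' < cost T G φ := by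
  classical
  unfold cost
  have key : ∀ p q, (if T.Adj p q then dcut G (φ' ⁻¹' side T p q) else 0) ≤
      (if T.Adj p q then dcut G (φ ⁻¹' side T p q) else 0) := by
    intro p q
    split_ifs with hpq
    · exact h p q hpq
    · exact le_rfl
  refine Finset.sum_lt_sum (fun p _ => Finset.sum_le_sum fun q _ => key p q) ⟨a, Finset.mem_univ _, ?_⟩
  refine Finset.sum_lt_sum (fun q _ => key a q) ⟨b, Finset.mem_univ _, ?_⟩
  simpa [hab] using hlt

lemma cost_le {T : SimpleGraph U} {G : SimpleGraph Y} {φ φ' : Y → U}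
    (h : ∀ p q, T.Adj p q → dcut G (φ' ⁻¹' side T p q) ≤ dcut G (φ ⁻¹' side T p q)) :
    cost T G φ' ≤ cost T G φ := by
  classical
  unfold cost
  refine Finset.sum_le_sum fun p _ => Finset.sum_le_sum fun q _ => ?_
  split_ifs with hpq
  · exact h p q hpq
  · exact le_rfl

/-- In a cost-minimal placement every cut is minimum. -/
lemma opt_min_cut {T : SimpleGraph U} {G : SimpleGraph Y} {l : X → U} {l' : X → Y}
    (hTc : T.Connected) (hTa : T.IsAcyclic) {φ : Y → U} (hφ : ∀ x, φ (l' x) = l x)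
    (hopt : ∀ φ' : Y → U, (∀ x, φ' (l' x) = l x) → cost T G φ ≤ cost T G φ')
    {a b : U} (hab : T.Adj a b) (S₀ : Set Y) (hS₀ : ∀ x, l' x ∈ S₀ ↔ l x ∈ side T a b) :
    dcut G (φ ⁻¹' side T a b) ≤ dcut G S₀ := by
  obtain ⟨S, hS, hmin⟩ := Set.exists_min_image {S : Set Y | ∀ x, l' x ∈ S ↔ l x ∈ side T a b}
    (dcut G) (Set.toFinite _) ⟨S₀, hS₀⟩
  refine le_trans ?_ (hmin S₀ hS₀)
  by_contra hlt
  push Not at hlt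
  have hS : ∀ x, l' x ∈ S ↔ l x ∈ side T a b := hS
  have hmin : ∀ S' : Set Y, (∀ x, l' x ∈ S' ↔ l x ∈ side T a b) → dcut G S ≤ dcut G S' := hmin
  have hS2 : ∀ x, l' x ∈ Sᶜ ↔ l x ∈ side T b a := by
    intro x; rw [side_compl hTc hTa hab, Set.mem_compl_iff, hS]
  have hmin2 : ∀ S' : Set Y, (∀ x, l' x ∈ S' ↔ l x ∈ side T b a) → dcut G Sᶜ ≤ dcut G S' := by
    intro S' hS'
    rw [dcut_compl, ← dcut_compl G S']
    refine hmin _ fun x => ?_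
    rw [Set.mem_compl_iff, hS', side_compl hTc hTa hab, not_not]
  have ha := side_not_mem hTa hab
  have hpre : exch T φ a b S ⁻¹' side T a b = S := by
    ext y
    have := side_self T a b
    simp only [Set.mem_preimage, exch]
    split_ifs <;> tauto
  have hall : ∀ p q, T.Adj p q →
      dcut G (exch T φ a b S ⁻¹' side T p q) ≤ dcut G (φ ⁻¹' side T p q) := by
    intro p q hpq
    by_cases he : s(p, q) = s(a, b)
    · rcases Sym2.eq_iff.1 he with ⟨rfl, rfl⟩ | ⟨rfl, rfl⟩
      · rw [hpre]; exact hlt.le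
      · rw [dcut_side_symm hTc hTa G _ hab, dcut_side_symm hTc hTa G _ hab, hpre]
        exact hlt.le
    · have hiff := side_adj_iff hpq he
      by_cases hq : q ∈ side T a b
      · by_cases hb : b ∈ side T p q
        · rw [dcut_side_symm hTc hTa G _ hpq.symm, dcut_side_symm hTc hTa G _ hpq.symm]
          exact exch_le hTa hφ hab hS hmin (hiff.2 hq) (fun h => side_disj hTa hpq hb h)
        · exact exch_le hTa hφ hab hS hmin hq hb
      · rw [← exch_symm hTc hTa φ hab]
        have hq' : q ∈ side T b a := (side_compl hTc hTa hab).2 hq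
        have hp' : p ∈ side T b a := (side_compl hTc hTa hab).2 (fun h => hq (hiff.1 h))
        by_cases hb : a ∈ side T p q
        · rw [dcut_side_symm hTc hTa G _ hpq.symm, dcut_side_symm hTc hTa G _ hpq.symm]
          exact exch_le hTa hφ hab.symm hS2 hmin2 hp' (fun h => side_disj hTa hpq hb h)
        · exact exch_le hTa hφ hab.symm hS2 hmin2 hq' hb
  have hlt' := cost_lt hall hab (by rw [hpre]; exact hlt)
  refine absurd (hopt (exch T φ a b S) ?_) (not_le.2 hlt')
  intro x
  have h1 := hS x
  have h2 := hφ x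
  by_cases h3 : l x ∈ side T a b
  · simp [exch, h1, h2, h3]
  · simp [exch, h1, h2, h3]

/-- optimal placements. -/
def Opt (T : SimpleGraph U) (G : SimpleGraph Y) (l : X → U) (l' : X → Y) (r : U) (φ : Y → U) : Prop :=
  (∀ x, φ (l' x) = l x) ∧
  (∀ φ' : Y → U, (∀ x, φ' (l' x) = l x) → cost T G φ ≤ cost T G φ') ∧
  (∀ φ' : Y → U, (∀ x, φ' (l' x) = l x) → cost T G φ' ≤ cost T G φ →
    ∑ y, depth T r (φ' y) ≤ ∑ y, depth T r (φ y))

lemma exists_opt (T : SimpleGraph U) (G : SimpleGraph Y) (l : X → U) (l' : X → Y)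
    (hl' : Function.Injective l') (r : U) : ∃ φ, Opt T G l l' r φ := by
  classical
  let A : Set (Y → U) := {φ | ∀ x, φ (l' x) = l x}
  have hA : A.Nonempty := by
    refine ⟨fun y => if h : ∃ x, l' x = y then l h.choose else r, fun x => ?_⟩
    have h : ∃ x', l' x' = l' x := ⟨x, rfl⟩
    have h2 := hl' h.choose_spec
    simp only [h, dif_pos, h2]
  obtain ⟨φ₀, h0, hm0⟩ := Set.exists_min_image A (cost T G) (Set.toFinite _) hA
  obtain ⟨φ, ⟨h1, h1'⟩, hm1⟩ := Set.exists_max_image {φ | φ ∈ A ∧ cost T G φ ≤ cost T G φ₀}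
    (fun φ => ∑ y, depth T r (φ y)) (Set.toFinite _) ⟨φ₀, h0, le_rfl⟩
  refine ⟨φ, h1, fun φ' h' => h1'.trans (hm0 φ' h'), fun φ' h' hc => hm1 φ' ⟨h', hc.trans h1'⟩⟩

lemma opt_push {T : SimpleGraph U} {G : SimpleGraph Y} {l : X → U} {l' : X → Y} {r : U}
    (hTc : T.Connected) (hTa : T.IsAcyclic) {φ : Y → U} (h : Opt T G l l' r φ)
    {u v : U} (huv : T.Adj u v) (hr : r ∉ side T u v) {N : Set Y} (hN : ∀ y ∈ N, φ y = u)
    (hne : N.Nonempty) (hleaf : ∀ x, l' x ∉ N)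
    (hle : dcut G ((φ ⁻¹' side T u v) ∪ N) ≤ dcut G (φ ⁻¹' side T u v)) : False := by
  classical
  obtain ⟨h1, h2, h3⟩ := h
  let φ' : Y → U := fun y => if y ∈ N then v else φ y
  have hpre : φ' ⁻¹' side T u v = (φ ⁻¹' side T u v) ∪ N := by
    ext y
    have := side_self T u v
    simp only [Set.mem_preimage, φ', Set.mem_union]
    split_ifs <;> tauto
  have hcost : cost T G φ' ≤ cost T G φ := by
    refine cost_le ?_
    intro p q hpq
    by_cases he : s(u, v) = s(p, q)
    · rcases Sym2.eq_iff.1 he with ⟨rfl, rfl⟩ | ⟨rfl, rfl⟩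
      · rw [hpre]; exact hle
      · rw [dcut_side_symm hTc hTa G _ huv, dcut_side_symm hTc hTa G _ huv, hpre]
        exact hle
    · have hiff := side_adj_iff huv he
      have : φ' ⁻¹' side T p q = φ ⁻¹' side T p q := by
        ext y
        simp only [Set.mem_preimage, φ']
        split_ifs with hy
        · rw [hN y hy]; exact hiff.symm
        · rfl
      rw [this]
  have h4 := h3 φ' (fun x => by simp only [φ', hleaf x, if_false]; exact h1 x) hcost
  refine absurd h4 (not_le.2 ?_)
  have hd := depth_lt hTc hTa huv hr
  obtain ⟨n, hn⟩ := hne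
  refine Finset.sum_lt_sum (fun y _ => ?_) ⟨n, Finset.mem_univ _, ?_⟩
  · simp only [φ']
    split_ifs with hy
    · rw [hN y hy]; exact hd.le
    · exact le_rfl
  · simp only [φ', hn, if_true, hN n hn]; exact hd

end Exchange


section Node
variable {U Y X : Type} [Fintype U] [Fintype Y]

/-- The consequence of `d_MP = 1` or `d_TBR = 1` that we use. -/
def HH {U Y X : Type} (T : SimpleGraph U) (G : SimpleGraph Y) (l : X → U) (l' : X → Y) : Prop :=
  ∀ (k : ℕ) (g : U → Fin k), ∃ g' : Y → Fin k, (∀ x, g' (l' x) = g (l x)) ∧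
    changes G g' ≤ changes T g + 1

lemma opt_cut_le_two {T : SimpleGraph U} {G : SimpleGraph Y} {l : X → U} {l' : X → Y} {r : U}
    (hTc : T.Connected) (hTa : T.IsAcyclic) (hH : HH T G l l') {φ : Y → U} (h : Opt T G l l' r φ)
    {a b : U} (hab : T.Adj a b) : dcut G (φ ⁻¹' side T a b) ≤ 2 := by
  classical
  obtain ⟨g', h1, h2⟩ := hH 2 (fun v => if v ∈ side T a b then 0 else 1)
  have h3 : changes T (fun v => if v ∈ side T a b then (0 : Fin 2) else 1) ≤ 1 := by
    unfold changes
    refine le_trans (Set.ncard_le_ncard (t := {s(a, b)}) ?_ (Set.toFinite _)) (by simp)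
    rintro e ⟨he, p, q, rfl, hne⟩
    by_contra hcon
    have := side_adj_iff (p := a) (q := b) he hcon
    simp [this] at hne
  have h4 := dcut_le_changes G g'
  have h5 := opt_min_cut hTc hTa h.1 h.2.1 hab {y | g' y = 0} (by
    intro x
    simp only [Set.mem_setOf_eq, h1]
    split_ifs <;> simp [*])
  omega

lemma uncross {G : SimpleGraph Y} {l' : X → Y} {P1 P2 P3 : X → Prop} {S1 S2 S3 A : Set Y}
    (h12 : ∀ x, P1 x → ¬ P2 x) (h13 : ∀ x, P1 x → ¬ P3 x) (h23 : ∀ x, P2 x → ¬ P3 x)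
    (t1 : ∀ x, l' x ∈ S1 ↔ P1 x) (t2 : ∀ x, l' x ∈ S2 ↔ P2 x) (t3 : ∀ x, l' x ∈ S3 ↔ P3 x)
    (tA : ∀ x, l' x ∈ A ↔ P1 x)
    (m1 : ∀ S' : Set Y, (∀ x, l' x ∈ S' ↔ P1 x) → dcut G S1 ≤ dcut G S')
    (m2 : ∀ S' : Set Y, (∀ x, l' x ∈ S' ↔ P2 x) → dcut G S2 ≤ dcut G S')
    (m3 : ∀ S' : Set Y, (∀ x, l' x ∈ S' ↔ P3 x) → dcut G S3 ≤ dcut G S') :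
    dcut G (((A ∪ S1) \ S2) \ S3) ≤ dcut G A ∧ dcut G S1 ≤ dcut G (((A ∪ S1) \ S2) \ S3) := by
  have a1 := dcut_submod G A S1
  have a2 := dcut_posimod G (A ∪ S1) S2
  have a3 := dcut_posimod G ((A ∪ S1) \ S2) S3
  have b1 := m1 (A ∩ S1) (fun x => by simp [t1, tA])
  have b2 := m2 (S2 \ (A ∪ S1)) (fun x => by
    have := h12 x
    simp only [Set.mem_diff, Set.mem_union, t1, t2, tA]; tauto)
  have b3 := m3 (S3 \ ((A ∪ S1) \ S2)) (fun x => by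
    have := h13 x
    simp only [Set.mem_diff, Set.mem_union, t1, t2, t3, tA]; tauto)
  have b4 := m1 (((A ∪ S1) \ S2) \ S3) (fun x => by
    have := h13 x; have := h12 x
    simp only [Set.mem_diff, Set.mem_union, t1, t2, t3, tA]; tauto)
  omega

set_option maxHeartbeats 1000000 in
lemma node_bad {T : SimpleGraph U} {G : SimpleGraph Y} {l : X → U} {l' : X → Y} {r : U}
    (hTc : T.Connected) (hTa : T.IsAcyclic) (hH : HH T G l l') {φ : Y → U} (h : Opt T G l l' r φ)
    {u v1 v2 v3 : U} (a1 : T.Adj u v1) (a2 : T.Adj u v2) (a3 : T.Adj u v3)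
    (n12 : v1 ≠ v2) (n13 : v1 ≠ v3) (n23 : v2 ≠ v3)
    (hall : ∀ v, T.Adj u v → v = v1 ∨ v = v2 ∨ v = v3) (hl : ∀ x, l x ≠ u)
    (hr : r ∈ side T u v1)
    (d1 : dcut G (φ ⁻¹' side T u v1) = 2) (d2 : dcut G (φ ⁻¹' side T u v2) = 2)
    (d3 : dcut G (φ ⁻¹' side T u v3) = 2)
    (e23 : ee G (φ ⁻¹' side T u v2) (φ ⁻¹' side T u v3) = 0) : False := by
  classical
  have hφ := h.1
  have s12 : ∀ w, w ∈ side T u v1 → w ∉ side T u v2 := fun w p q => side_disj_nbr hTa a1 a2 n12 p q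
  have s13 : ∀ w, w ∈ side T u v1 → w ∉ side T u v3 := fun w p q => side_disj_nbr hTa a1 a3 n13 p q
  have s23 : ∀ w, w ∈ side T u v2 → w ∉ side T u v3 := fun w p q => side_disj_nbr hTa a2 a3 n23 p q
  have u1 := side_not_mem hTa a1
  have u2 := side_not_mem hTa a2
  have u3 := side_not_mem hTa a3
  have hcov : ∀ w, w ≠ u → w ∈ side T u v1 ∨ w ∈ side T u v2 ∨ w ∈ side T u v3 := by
    intro w hw
    obtain ⟨v, hv, hwv⟩ := side_cover_nbr hTc u w hw
    rcases hall v hv with rfl | rfl | rfl <;> tauto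
  have m : ∀ v, T.Adj u v → ∀ S' : Set Y, (∀ x, l' x ∈ S' ↔ l x ∈ side T u v) →
      dcut G (φ ⁻¹' side T u v) ≤ dcut G S' := fun v hv S' hS' =>
    opt_min_cut hTc hTa h.1 h.2.1 hv S' hS'
  have t : ∀ v x, l' x ∈ φ ⁻¹' side T u v ↔ l x ∈ side T u v := by
    intro v x; simp only [Set.mem_preimage, hφ]
  obtain ⟨g', h1, h2⟩ := hH 3 (fun v => if v ∈ side T u v2 then 1 else if v ∈ side T u v3 then 2 else 0)
  have h3 : changes T (fun v => if v ∈ side T u v2 then (1 : Fin 3) else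
      if v ∈ side T u v3 then 2 else 0) ≤ 2 := by
    unfold changes
    refine le_trans (Set.ncard_le_ncard (t := {s(u, v2), s(u, v3)}) ?_ (Set.toFinite _))
      ((Set.ncard_insert_le _ _).trans (by simp))
    rintro e ⟨he, p, q, rfl, hne⟩
    by_contra hcon
    simp only [Set.mem_insert_iff, Set.mem_singleton_iff, not_or] at hcon
    have k2 := side_adj_iff (p := u) (q := v2) he hcon.1
    have k3 := side_adj_iff (p := u) (q := v3) he hcon.2
    simp [k2, k3] at hne
  have h4 := dcut3_le_changes G g'
  have tA1 : ∀ x, l' x ∈ {y | g' y = 0} ↔ l x ∈ side T u v1 := by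
    intro x
    simp only [Set.mem_setOf_eq, h1]
    have c := hcov _ (hl x); have c1 := s12 (l x); have c2 := s13 (l x)
    clear * - c c1 c2
    split_ifs <;> simp <;> tauto
  have tA2 : ∀ x, l' x ∈ {y | g' y = 1} ↔ l x ∈ side T u v2 := by
    intro x
    simp only [Set.mem_setOf_eq, h1]
    have c := hcov _ (hl x); have c1 := s12 (l x); have c2 := s23 (l x)
    clear * - c c1 c2
    split_ifs <;> simp <;> tauto
  have tA3 : ∀ x, l' x ∈ {y | g' y = 2} ↔ l x ∈ side T u v3 := by
    intro x
    simp only [Set.mem_setOf_eq, h1]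
    have c := hcov _ (hl x); have c1 := s13 (l x); have c2 := s23 (l x)
    clear * - c c1 c2
    split_ifs <;> simp <;> tauto
  have q1 := uncross (fun x => s12 (l x)) (fun x => s13 (l x)) (fun x => s23 (l x))
    (t v1) (t v2) (t v3) tA1 (m v1 a1) (m v2 a2) (m v3 a3)
  have q2 := uncross (fun x p q => s12 (l x) q p) (fun x => s23 (l x)) (fun x => s13 (l x))
    (t v2) (t v1) (t v3) tA2 (m v2 a2) (m v1 a1) (m v3 a3)
  have q3 := uncross (fun x p q => s13 (l x) q p) (fun x p q => s23 (l x) q p) (fun x => s12 (l x))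
    (t v3) (t v1) (t v2) tA3 (m v3 a3) (m v1 a1) (m v2 a2)
  have push : ∀ v, T.Adj u v → r ∉ side T u v → ∀ N : Set Y, (∀ y ∈ N, φ y = u) →
      dcut G ((φ ⁻¹' side T u v) ∪ N) ≤ dcut G (φ ⁻¹' side T u v) → ¬ N.Nonempty := by
    intro v hv hrv N hN hle hne
    refine opt_push hTc hTa h hv hrv hN hne (fun x hx => ?_) hle
    have := hN _ hx
    rw [hφ] at this
    exact hl x this
  have p2 := push v2 a2 (s12 r hr) {y | φ y = u ∧ g' y = 1} (fun y hy => hy.1) (by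
    have : (φ ⁻¹' side T u v2) ∪ {y | φ y = u ∧ g' y = 1} =
      ((({y | g' y = 1} ∪ φ ⁻¹' side T u v2) \ (φ ⁻¹' side T u v1)) \ (φ ⁻¹' side T u v3)) := by
      ext y
      simp only [Set.mem_union, Set.mem_diff, Set.mem_preimage, Set.mem_setOf_eq]
      by_cases hy : φ y = u
      · simp [hy, u1, u2, u3]
      · have c0 := hcov _ hy; have c1 := s12 (φ y); have c2 := s13 (φ y); have c3 := s23 (φ y)
        clear * - c0 c1 c2 c3 hy
        tauto
    rw [this]; omega)
  have p3 := push v3 a3 (s13 r hr) {y | φ y = u ∧ g' y = 2} (fun y hy => hy.1) (by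
    have : (φ ⁻¹' side T u v3) ∪ {y | φ y = u ∧ g' y = 2} =
      ((({y | g' y = 2} ∪ φ ⁻¹' side T u v3) \ (φ ⁻¹' side T u v1)) \ (φ ⁻¹' side T u v2)) := by
      ext y
      simp only [Set.mem_union, Set.mem_diff, Set.mem_preimage, Set.mem_setOf_eq]
      by_cases hy : φ y = u
      · simp [hy, u1, u2, u3]
      · have c0 := hcov _ hy; have c1 := s12 (φ y); have c2 := s13 (φ y); have c3 := s23 (φ y)
        clear * - c0 c1 c2 c3 hy
        tauto
    rw [this]; omega)
  rw [Set.not_nonempty_iff_eq_empty] at p2 p3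
  have hB : ((({y | g' y = 0} ∪ φ ⁻¹' side T u v1) \ (φ ⁻¹' side T u v2)) \ (φ ⁻¹' side T u v3)) =
      ((φ ⁻¹' side T u v2) ∪ (φ ⁻¹' side T u v3))ᶜ := by
    ext y
    simp only [Set.mem_union, Set.mem_diff, Set.mem_preimage, Set.mem_setOf_eq, Set.mem_compl_iff]
    by_cases hy : φ y = u
    · have k2 : g' y ≠ 1 := fun hg => by
        have : y ∈ ({y | φ y = u ∧ g' y = 1} : Set Y) := ⟨hy, hg⟩
        rw [p2] at this; exact this
      have k3 : g' y ≠ 2 := fun hg => by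
        have : y ∈ ({y | φ y = u ∧ g' y = 2} : Set Y) := ⟨hy, hg⟩
        rw [p3] at this; exact this
      have k1 : g' y = 0 := by
        generalize g' y = z at k2 k3 ⊢
        revert z; decide
      simp [hy, u1, u2, u3, k1]
    · have c0 := hcov _ hy; have c1 := s12 (φ y); have c2 := s13 (φ y); have c3 := s23 (φ y)
      clear * - c0 c1 c2 c3 hy
      tauto
  rw [hB, dcut_compl] at q1
  have hd23 : dcut G (φ ⁻¹' side T u v2) + dcut G (φ ⁻¹' side T u v3) ≤
      dcut G ((φ ⁻¹' side T u v2) ∪ (φ ⁻¹' side T u v3)) +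
      2 * ee G (φ ⁻¹' side T u v2) (φ ⁻¹' side T u v3) := by
    rw [two_mul]
    nth_rewrite 2 [ee_comm]
    unfold dcut ee
    simp only [← Finset.sum_add_distrib]
    refine Finset.sum_le_sum fun y _ => Finset.sum_le_sum fun z _ => ?_
    have w1 := s23 (φ y); have w2 := s23 (φ z)
    simp only [Set.mem_union, Set.mem_compl_iff, Set.mem_preimage]
    by_cases h0 : G.Adj y z <;> by_cases h1 : φ y ∈ side T u v2 <;> by_cases h2 : φ y ∈ side T u v3 <;>
      by_cases h3 : φ z ∈ side T u v2 <;> by_cases h4 : φ z ∈ side T u v3 <;>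
      first | (exfalso; exact w1 h1 h2) | (exfalso; exact w2 h3 h4) | simp [h0, h1, h2, h3, h4]
  omega

end Node


section Node2
variable {U Y X : Type} [Fintype U] [Fintype Y]

set_option maxHeartbeats 1000000 in
lemma node_internal {T : SimpleGraph U} {G : SimpleGraph Y} {l : X → U} {l' : X → Y} {r : U}
    (hTc : T.Connected) (hTa : T.IsAcyclic) (hGa : G.IsAcyclic)
    (hG3 : ∀ y, (∀ x, l' x ≠ y) → (G.neighborSet y).ncard = 3)
    (hH : HH T G l l') {φ : Y → U} (h : Opt T G l l' r φ)
    {u v1 v2 v3 : U} (a1 : T.Adj u v1) (a2 : T.Adj u v2) (a3 : T.Adj u v3)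
    (n12 : v1 ≠ v2) (n13 : v1 ≠ v3) (n23 : v2 ≠ v3)
    (hall : ∀ v, T.Adj u v → v = v1 ∨ v = v2 ∨ v = v3) (hl : ∀ x, l x ≠ u) (hru : r ≠ u) :
    (φ ⁻¹' {u}).ncard + (ee G (φ ⁻¹' side T u v1) (φ ⁻¹' side T u v2) +
      ee G (φ ⁻¹' side T u v1) (φ ⁻¹' side T u v3) +
      ee G (φ ⁻¹' side T u v2) (φ ⁻¹' side T u v3)) ≤ 3 := by
  classical
  have hφ := h.1
  have s12 : ∀ w, w ∈ side T u v1 → w ∉ side T u v2 := fun w p q => side_disj_nbr hTa a1 a2 n12 p q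
  have s13 : ∀ w, w ∈ side T u v1 → w ∉ side T u v3 := fun w p q => side_disj_nbr hTa a1 a3 n13 p q
  have s23 : ∀ w, w ∈ side T u v2 → w ∉ side T u v3 := fun w p q => side_disj_nbr hTa a2 a3 n23 p q
  have u1 := side_not_mem hTa a1
  have u2 := side_not_mem hTa a2
  have u3 := side_not_mem hTa a3
  have hcov : ∀ w, w ≠ u → w ∈ side T u v1 ∨ w ∈ side T u v2 ∨ w ∈ side T u v3 := by
    intro w hw
    obtain ⟨v, hv, hwv⟩ := side_cover_nbr hTc u w hw
    rcases hall v hv with rfl | rfl | rfl <;> tauto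
  have c1 := opt_cut_le_two hTc hTa hH h a1
  have c2 := opt_cut_le_two hTc hTa hH h a2
  have c3 := opt_cut_le_two hTc hTa hH h a3
  have bad : dcut G (φ ⁻¹' side T u v1) = 2 → dcut G (φ ⁻¹' side T u v2) = 2 →
      dcut G (φ ⁻¹' side T u v3) = 2 → ee G (φ ⁻¹' side T u v1) (φ ⁻¹' side T u v2) = 0 →
      ee G (φ ⁻¹' side T u v1) (φ ⁻¹' side T u v3) = 0 →
      ee G (φ ⁻¹' side T u v2) (φ ⁻¹' side T u v3) = 0 → False := by
    intro d1 d2 d3 e12 e13 e23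
    rcases hcov r hru with hr | hr | hr
    · exact node_bad hTc hTa hH h a1 a2 a3 n12 n13 n23 hall hl hr d1 d2 d3 e23
    · exact node_bad hTc hTa hH h a2 a1 a3 n12.symm n23 n13 (fun v hv => by
        rcases hall v hv with h | h | h <;> simp [h]) hl hr d2 d1 d3 e13
    · exact node_bad hTc hTa hH h a3 a1 a2 n13.symm n23.symm n12 (fun v hv => by
        rcases hall v hv with h | h | h <;> simp [h]) hl hr d3 d1 d2 e12
  have hdeg : ee G (φ ⁻¹' {u}) Set.univ = 3 * (φ ⁻¹' {u}).ncard := by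
    rw [ee_univ_deg G (φ ⁻¹' {u}) (fun _ => 3)]
    · rw [← Finset.sum_filter, Finset.sum_const, Set.ncard_eq_toFinset_card', smul_eq_mul, mul_comm]
      congr 2
      ext y; simp
    · intro y hy
      refine hG3 y fun x hx => ?_
      have : φ y = u := hy
      rw [← hx, hφ] at this
      exact hl x this
  have hsp := ee_split G (φ ⁻¹' {u})
  have compl_expand : ∀ (S A B C : Set Y), (∀ y, y ∉ S ↔ y ∈ A ∨ y ∈ B ∨ y ∈ C) →
      (∀ y ∈ A, y ∉ B) → (∀ y ∈ A, y ∉ C) → (∀ y ∈ B, y ∉ C) →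
      dcut G S = ee G S A + ee G S B + ee G S C := by
    intro S A B C hS hAB hAC hBC
    have : Sᶜ = (A ∪ B) ∪ C := by
      ext y; simp only [Set.mem_compl_iff, hS, Set.mem_union]; tauto
    rw [dcut, this, ee_union_right, ee_union_right]
    · exact hAB
    · rintro y (hy | hy)
      · exact hAC y hy
      · exact hBC y hy
  have part : ∀ w, (w = u ∧ w ∉ side T u v1 ∧ w ∉ side T u v2 ∧ w ∉ side T u v3) ∨
      (w ≠ u ∧ w ∈ side T u v1 ∧ w ∉ side T u v2 ∧ w ∉ side T u v3) ∨
      (w ≠ u ∧ w ∉ side T u v1 ∧ w ∈ side T u v2 ∧ w ∉ side T u v3) ∨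
      (w ≠ u ∧ w ∉ side T u v1 ∧ w ∉ side T u v2 ∧ w ∈ side T u v3) := by
    intro w
    by_cases hw : w = u
    · subst hw; exact Or.inl ⟨rfl, u1, u2, u3⟩
    · have c0 := hcov _ hw; have c1 := s12 w; have c2 := s13 w; have c3 := s23 w
      clear * - c0 c1 c2 c3 hw
      tauto
  set S1 := φ ⁻¹' side T u v1 with hS1
  set S2 := φ ⁻¹' side T u v2 with hS2
  set S3 := φ ⁻¹' side T u v3 with hS3
  set M := φ ⁻¹' {u} with hM
  have part' : ∀ y, (y ∈ M ∧ y ∉ S1 ∧ y ∉ S2 ∧ y ∉ S3) ∨ (y ∉ M ∧ y ∈ S1 ∧ y ∉ S2 ∧ y ∉ S3) ∨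
      (y ∉ M ∧ y ∉ S1 ∧ y ∈ S2 ∧ y ∉ S3) ∨ (y ∉ M ∧ y ∉ S1 ∧ y ∉ S2 ∧ y ∈ S3) :=
    fun y => part (φ y)
  clear_value S1 S2 S3 M
  clear part hcov s12 s13 s23 u1 u2 u3 hS1 hS2 hS3 hM
  have x1 := compl_expand S1 S2 S3 M (fun y => by have := part' y; clear * - this; tauto)
    (fun y => by have := part' y; clear * - this; tauto)
    (fun y => by have := part' y; clear * - this; tauto)
    (fun y => by have := part' y; clear * - this; tauto)
  have x2 := compl_expand S2 S1 S3 M (fun y => by have := part' y; clear * - this; tauto)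
    (fun y => by have := part' y; clear * - this; tauto)
    (fun y => by have := part' y; clear * - this; tauto)
    (fun y => by have := part' y; clear * - this; tauto)
  have x3 := compl_expand S3 S1 S2 M (fun y => by have := part' y; clear * - this; tauto)
    (fun y => by have := part' y; clear * - this; tauto)
    (fun y => by have := part' y; clear * - this; tauto)
    (fun y => by have := part' y; clear * - this; tauto)
  have x4 := compl_expand M S1 S2 S3 (fun y => by have := part' y; clear * - this; tauto)
    (fun y => by have := part' y; clear * - this; tauto)
    (fun y => by have := part' y; clear * - this; tauto)
    (fun y => by have := part' y; clear * - this; tauto)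
  have y1 := ee_comm G S2 S1
  have y2 := ee_comm G S3 S1
  have y3 := ee_comm G S3 S2
  have y4 := ee_comm G M S1
  have y5 := ee_comm G M S2
  have y6 := ee_comm G M S3
  by_cases hMn : M.Nonempty
  · have hf := ee_forest hGa hMn
    by_contra hcon
    refine bad ?_ ?_ ?_ ?_ ?_ ?_ <;> omega
  · rw [Set.not_nonempty_iff_eq_empty] at hMn
    have : M.ncard = 0 := by rw [hMn]; simp
    omega

lemma node_leaf {T : SimpleGraph U} {G : SimpleGraph Y} {l : X → U} {l' : X → Y} {r : U}
    (hTc : T.Connected) (hTa : T.IsAcyclic) (hGa : G.IsAcyclic) (hli : Function.Injective l)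
    (hG1 : ∀ x, (G.neighborSet (l' x)).ncard = 1)
    (hG3 : ∀ y, (∀ x, l' x ≠ y) → (G.neighborSet y).ncard = 3)
    (hH : HH T G l l') {φ : Y → U} (h : Opt T G l l' r φ)
    {x : X} {v : U} (hv : T.Adj (l x) v) (hall : ∀ w, T.Adj (l x) w → w = v) :
    (φ ⁻¹' {l x}).ncard ≤ 2 := by
  classical
  have hφ := h.1
  have c1 := opt_cut_le_two hTc hTa hH h hv.symm
  have hs : side T v (l x) = {l x} := by
    ext w
    rw [side_decomp hTc hTa hv.symm]
    constructor
    · rintro (h | ⟨w', h1, h2, -⟩)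
      · exact h
      · exact absurd (hall _ h1) h2
    · exact fun h => Or.inl h
  rw [hs] at c1
  have hsp := ee_split G (φ ⁻¹' {l x})
  have hmem : l' x ∈ φ ⁻¹' {l x} := hφ x
  have hf := ee_forest hGa ⟨_, hmem⟩
  have hdeg : ee G (φ ⁻¹' {l x}) Set.univ + 2 = 3 * (φ ⁻¹' {l x}).ncard := by
    rw [ee_univ_deg G (φ ⁻¹' {l x}) (fun y => if y = l' x then 1 else 3)]
    · rw [← Finset.sum_filter, Set.ncard_eq_toFinset_card']
      have he : (Finset.univ.filter fun y => y ∈ φ ⁻¹' {l x}) = (φ ⁻¹' {l x}).toFinset := by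
        ext y; simp
      rw [he, ← Finset.add_sum_erase _ _ (Set.mem_toFinset.2 hmem)]
      rw [Finset.sum_congr rfl (g := fun _ => 3) (by
        intro y hy
        simp [(Finset.mem_erase.1 hy).1])]
      rw [Finset.sum_const, Finset.card_erase_of_mem (Set.mem_toFinset.2 hmem)]
      have : 0 < (φ ⁻¹' {l x}).toFinset.card := Finset.card_pos.2 ⟨_, Set.mem_toFinset.2 hmem⟩
      simp only [if_true, smul_eq_mul]
      omega
    · intro y hy
      split_ifs with hyx
      · rw [hyx]; exact hG1 x
      · refine hG3 y fun x' hx' => hyx ?_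
        have : φ y = l x := hy
        rw [← hx', hφ] at this
        rw [← hx', hli this]
  omega

end Node2


section Display

lemma leaf_nbr {V X : Type*} (T : PhyloTree V X) (x : X) :
    ∃ v, T.graph.Adj (T.leaf x) v ∧ ∀ w, T.graph.Adj (T.leaf x) w → w = v := by
  obtain ⟨v, hv⟩ := Set.ncard_eq_one.1 (T.leaf_deg x)
  have h : ∀ w, T.graph.Adj (T.leaf x) w ↔ w = v := by
    intro w
    rw [← mem_neighborSet, hv, Set.mem_singleton_iff]
  exact ⟨v, (h v).2 rfl, fun w => (h w).1⟩

lemma int_nbr {V X : Type*} (T : PhyloTree V X) (u : V) (hu : ∀ x, T.leaf x ≠ u) :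
    ∃ v1 v2 v3, T.graph.Adj u v1 ∧ T.graph.Adj u v2 ∧ T.graph.Adj u v3 ∧ v1 ≠ v2 ∧ v1 ≠ v3 ∧
      v2 ≠ v3 ∧ ∀ w, T.graph.Adj u w → w = v1 ∨ w = v2 ∨ w = v3 := by
  obtain ⟨a, b, c, h1, h2, h3, hv⟩ := Set.ncard_eq_three.1 (T.internal_deg u hu)
  have h : ∀ w, T.graph.Adj u w ↔ w = a ∨ w = b ∨ w = c := by
    intro w
    rw [← mem_neighborSet, hv]; simp
  exact ⟨a, b, c, (h a).2 (by simp), (h b).2 (by simp), (h c).2 (by simp), h1, h2, h3,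
    fun w => (h w).1⟩

/-- projection of the display graph. -/
def psi {V1 V2 X : Type} {l1 : X → V1} {l2 : X → V2} (φ : V2 → V1) (d : DisplayVertex l1 l2) : V1 :=
  Sum.elim id φ d.1

lemma psi_inl {V1 V2 X : Type} {l1 : X → V1} {l2 : X → V2} (φ : V2 → V1) (u : V1) :
    psi φ (toDisplay l1 l2 (Sum.inl u)) = u := rfl

lemma psi_inr {V1 V2 X : Type} {l1 : X → V1} {l2 : X → V2} {φ : V2 → V1}
    (hφ : ∀ x, φ (l2 x) = l1 x) (y : V2) :
    psi φ (toDisplay l1 l2 (Sum.inr y)) = φ y := by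
  unfold psi toDisplay mergeMap
  simp only
  split_ifs with h
  · have h1 := h.choose_spec
    have h2 := hφ h.choose
    rw [h1] at h2
    simp [h2]
  · rfl

lemma toDisplay_surj {V1 V2 X : Type} {l1 : X → V1} {l2 : X → V2} (d : DisplayVertex l1 l2) :
    (∃ u, d = toDisplay l1 l2 (Sum.inl u)) ∨ ∃ y, d = toDisplay l1 l2 (Sum.inr y) := by
  obtain ⟨s, hs⟩ := d
  cases s with
  | inl u => exact Or.inl ⟨u, Subtype.ext hs.symm⟩
  | inr y => exact Or.inr ⟨y, Subtype.ext hs.symm⟩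

lemma display_adj {V1 V2 X : Type*} {G1 : SimpleGraph V1} {l1 : X → V1}
    {G2 : SimpleGraph V2} {l2 : X → V2} {a b : DisplayVertex l1 l2}
    (h : (displayGraph G1 l1 G2 l2).Adj a b) :
    (∃ u v : V1, G1.Adj u v ∧ a = toDisplay l1 l2 (Sum.inl u) ∧ b = toDisplay l1 l2 (Sum.inl v)) ∨
    (∃ u v : V2, G2.Adj u v ∧ a = toDisplay l1 l2 (Sum.inr u) ∧ b = toDisplay l1 l2 (Sum.inr v)) := by
  obtain ⟨-, (h | h) | (⟨u, v, h, h1, h2⟩ | ⟨u, v, h, h1, h2⟩)⟩ := h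
  · exact Or.inl h
  · exact Or.inr h
  · exact Or.inl ⟨v, u, h.symm, h2, h1⟩
  · exact Or.inr ⟨v, u, h.symm, h2, h1⟩

set_option maxHeartbeats 1000000 in
theorem display_tw3 {V1 V2 X : Type} (T : PhyloTree V1 X) (T' : PhyloTree V2 X) (x₀ : X)
    (hH : HH T.graph T'.graph T.leaf T'.leaf) :
    HasTreeDecompWidthLE (displayGraph T.graph T.leaf T'.graph T'.leaf) 3 := by
  classical
  haveI := T.finite
  haveI := T'.finite
  haveI := Fintype.ofFinite V1
  haveI := Fintype.ofFinite V2
  have hTc := T.connected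
  have hTa := T.acyclic
  obtain ⟨φ, hopt⟩ := exists_opt T.graph T'.graph T.leaf T'.leaf T'.leaf_inj (T.leaf x₀)
  have hφ := hopt.1
  haveI : Finite (DisplayVertex T.leaf T'.leaf) := Subtype.finite
  haveI : Nonempty (DisplayVertex T.leaf T'.leaf) := ⟨toDisplay _ _ (Sum.inl (T.leaf x₀))⟩
  set D := displayGraph T.graph T.leaf T'.graph T'.leaf with hD
  let ψ : DisplayVertex T.leaf T'.leaf → V1 := psi φ
  have ψl : ∀ u, ψ (toDisplay T.leaf T'.leaf (Sum.inl u)) = u := psi_inl φ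
  have ψr : ∀ y, ψ (toDisplay T.leaf T'.leaf (Sum.inr y)) = φ y := psi_inr hφ
  refine hasTD_of_good ?_ ?_
  · intro d
    have toL : ∀ u v, T.graph.Adj u v → D.Adj (toDisplay _ _ (Sum.inl u)) (toDisplay _ _ (Sum.inl v)) := by
      intro u v h
      refine ⟨?_, Or.inl (Or.inl ⟨u, v, h, rfl, rfl⟩)⟩
      intro he
      have := congrArg ψ he
      rw [ψl, ψl] at this
      exact h.ne this
    have lnbr : ∀ u, ∃ w, T.graph.Adj u w := by
      intro u
      by_cases hu : ∃ x, T.leaf x = u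
      · obtain ⟨x, rfl⟩ := hu
        obtain ⟨v, hv, -⟩ := leaf_nbr T x
        exact ⟨v, hv⟩
      · push Not at hu
        obtain ⟨v, _, _, hv, -⟩ := int_nbr T u hu
        exact ⟨v, hv⟩
    rcases toDisplay_surj d with ⟨u, rfl⟩ | ⟨y, rfl⟩
    · obtain ⟨w, hw⟩ := lnbr u
      exact ⟨_, toL _ _ hw⟩
    · by_cases hy : ∃ x, T'.leaf x = y
      · have : ∃ u, toDisplay T.leaf T'.leaf (Sum.inr y) = toDisplay T.leaf T'.leaf (Sum.inl u) := by
          refine ⟨T.leaf hy.choose, ?_⟩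
          apply Subtype.ext
          simp [toDisplay, mergeMap, hy]
        obtain ⟨u, hu⟩ := this
        obtain ⟨w, hw⟩ := lnbr u
        rw [hu]
        exact ⟨_, toL _ _ hw⟩
      · have hy' : ∀ x, T'.leaf x ≠ y := by push Not at hy; exact hy
        obtain ⟨v, _, _, hv, -⟩ := int_nbr T' y hy'
        refine ⟨toDisplay _ _ (Sum.inr v), ?_, Or.inl (Or.inr ⟨y, v, hv, rfl, rfl⟩)⟩
        intro he
        have h1 := congrArg Subtype.val he
        simp only [toDisplay, mergeMap, hy, dif_neg, not_false_eq_true] at h1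
        split_ifs at h1
        exact hv.ne (Sum.inr_injective h1)
  · obtain ⟨v₀, hv₀, hv₀'⟩ := leaf_nbr T x₀
    refine good_sweep hTc hTa ψ ?_ (T.leaf x₀) v₀ hv₀ hv₀' ?_ ?_
    · intro w u hwu
      by_cases hu : ∃ x, T.leaf x = u
      · obtain ⟨x, rfl⟩ := hu
        obtain ⟨v, hv, hv'⟩ := leaf_nbr T x
        left
        intro z hz
        rw [hv' z hz, hv' w hwu.symm]
      · push Not at hu
        obtain ⟨a, b, c, ha, hb, hc, hab, hac, hbc, hall⟩ := int_nbr T u hu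
        right
        rcases hall w hwu.symm with rfl | rfl | rfl
        · exact ⟨b, c, hbc, hab.symm, hac.symm, hb, hc, hall⟩
        · exact ⟨a, c, hac, hab, hbc.symm, ha, hc, fun v hv => by
            rcases hall v hv with h | h | h <;> simp [h]⟩
        · exact ⟨a, b, hab, hac, hbc, ha, hb, fun v hv => by
            rcases hall v hv with h | h | h <;> simp [h]⟩
    · intro p q hpq
      have hc := opt_cut_le_two hTc hTa hH hopt hpq
      rw [dcut, ee_eq_ncard] at hc
      let R : Set (V2 × V2) := {z | T'.graph.Adj z.1 z.2 ∧ z.1 ∈ φ ⁻¹' side T.graph p q ∧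
        z.2 ∈ (φ ⁻¹' side T.graph p q)ᶜ}
      let F : V2 × V2 → Sym2 (DisplayVertex T.leaf T'.leaf) := fun z =>
        s(toDisplay _ _ (Sum.inr z.1), toDisplay _ _ (Sum.inr z.2))
      have hsub : deltaE D (ψ ⁻¹' side T.graph p q) ⊆
          {s(toDisplay _ _ (Sum.inl p), toDisplay _ _ (Sum.inl q))} ∪ F '' R := by
        intro e he
        obtain ⟨a, b, ha, hb, rfl⟩ := deltaE_eq he
        have hadj : D.Adj a b := he.1
        rcases display_adj hadj with ⟨u, v, huv, rfl, rfl⟩ | ⟨u, v, huv, rfl, rfl⟩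
        · left
          simp only [Set.mem_preimage, ψl] at ha hb
          obtain ⟨rfl, rfl⟩ := side_cross hTa hpq huv ha hb
          exact Sym2.eq_swap
        · right
          simp only [Set.mem_preimage, ψr] at ha hb
          exact ⟨(u, v), ⟨huv, ha, hb⟩, rfl⟩
      have h1 := Set.ncard_le_ncard hsub (Set.toFinite _)
      have h2 := Set.ncard_union_le {s(toDisplay T.leaf T'.leaf (Sum.inl p),
        toDisplay T.leaf T'.leaf (Sum.inl q))} (F '' R)
      have h3 := Set.ncard_image_le (f := F) (Set.toFinite R)
      rw [Set.ncard_singleton] at h2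
      have h4 : R.ncard ≤ 2 := hc
      omega
    · intro u
      have hfib : (ψ ⁻¹' {u}).ncard ≤ 1 + (φ ⁻¹' {u}).ncard := by
        have hsub : ψ ⁻¹' {u} ⊆ {toDisplay _ _ (Sum.inl u)} ∪
            (fun y => toDisplay T.leaf T'.leaf (Sum.inr y)) '' (φ ⁻¹' {u}) := by
          intro d hd
          rcases toDisplay_surj d with ⟨w, rfl⟩ | ⟨y, rfl⟩
          · left
            have : ψ (toDisplay T.leaf T'.leaf (Sum.inl w)) = u := hd
            rw [ψl] at this
            rw [this]; rfl
          · right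
            have : ψ (toDisplay T.leaf T'.leaf (Sum.inr y)) = u := hd
            rw [ψr] at this
            exact ⟨y, this, rfl⟩
        have h1 := Set.ncard_le_ncard hsub (Set.toFinite _)
        have h2 := Set.ncard_union_le {toDisplay T.leaf T'.leaf (Sum.inl u)}
          ((fun y => toDisplay T.leaf T'.leaf (Sum.inr y)) '' (φ ⁻¹' {u}))
        have h3 := Set.ncard_image_le (f := fun y => toDisplay T.leaf T'.leaf (Sum.inr y))
          (Set.toFinite (φ ⁻¹' {u}))
        rw [Set.ncard_singleton] at h2
        omega
      -- direct edges
      have hdir : ∀ e ∈ {e | (∃ v, T.graph.Adj u v ∧ e ∈ deltaE D (ψ ⁻¹' side T.graph u v)) ∧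
          ∀ x ∈ e, ψ x ≠ u}, ∃ v v' y z, T.graph.Adj u v ∧ T.graph.Adj u v' ∧ v ≠ v' ∧
          T'.graph.Adj y z ∧ φ y ∈ side T.graph u v ∧ φ z ∈ side T.graph u v' ∧
          e = s(toDisplay _ _ (Sum.inr y), toDisplay _ _ (Sum.inr z)) := by
        rintro e ⟨⟨v, hv, he⟩, hne⟩
        obtain ⟨a, b, ha, hb, rfl⟩ := deltaE_eq he
        have hadj : D.Adj a b := he.1
        rcases display_adj hadj with ⟨p, q, huv, rfl, rfl⟩ | ⟨y, z, huv, rfl, rfl⟩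
        · exfalso
          simp only [Set.mem_preimage, ψl] at ha hb
          obtain ⟨rfl, rfl⟩ := side_cross hTa hv huv ha hb
          exact hne _ (Sym2.mem_mk_right _ _) (ψl q)
        · simp only [Set.mem_preimage, ψr] at ha hb
          have hz : φ z ≠ u := fun h => hne _ (Sym2.mem_mk_right _ _) ((ψr z).trans h)
          obtain ⟨v', hv', hzv⟩ := side_cover_nbr hTc u _ hz
          refine ⟨v, v', y, z, hv, hv', ?_, huv, ha, hzv, rfl⟩
          rintro rfl
          exact hb hzv
      by_cases hu : ∃ x, T.leaf x = u
      · obtain ⟨x, rfl⟩ := hu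
        obtain ⟨v, hv, hv'⟩ := leaf_nbr T x
        have hm := node_leaf hTc hTa T'.acyclic T.leaf_inj T'.leaf_deg T'.internal_deg hH hopt hv hv'
        have : {e | (∃ v, T.graph.Adj (T.leaf x) v ∧ e ∈ deltaE D (ψ ⁻¹' side T.graph (T.leaf x) v)) ∧
          ∀ z ∈ e, ψ z ≠ T.leaf x} = ∅ := by
          rw [Set.eq_empty_iff_forall_notMem]
          intro e he
          obtain ⟨w, w', -, -, hw, hw', hne, -⟩ := hdir e he
          exact hne ((hv' w hw).trans (hv' w' hw').symm)
        rw [this, Set.ncard_empty]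
        omega
      · push Not at hu
        obtain ⟨v1, v2, v3, a1, a2, a3, n12, n13, n23, hall⟩ := int_nbr T u hu
        have hm := node_internal hTc hTa T'.acyclic T'.internal_deg hH hopt a1 a2 a3 n12 n13 n23
          hall hu (hu x₀)
        rw [ee_eq_ncard, ee_eq_ncard, ee_eq_ncard] at hm
        let R : V1 → V1 → Set (V2 × V2) := fun v v' => {z | T'.graph.Adj z.1 z.2 ∧
          z.1 ∈ φ ⁻¹' side T.graph u v ∧ z.2 ∈ φ ⁻¹' side T.graph u v'}
        let F : V2 × V2 → Sym2 (DisplayVertex T.leaf T'.leaf) := fun z =>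
          s(toDisplay _ _ (Sum.inr z.1), toDisplay _ _ (Sum.inr z.2))
        have hm' : (φ ⁻¹' {u}).ncard + ((R v1 v2).ncard + (R v1 v3).ncard + (R v2 v3).ncard) ≤ 3 := hm
        have hsub : {e | (∃ v, T.graph.Adj u v ∧ e ∈ deltaE D (ψ ⁻¹' side T.graph u v)) ∧
          ∀ x ∈ e, ψ x ≠ u} ⊆ F '' ((R v1 v2 ∪ R v1 v3) ∪ R v2 v3) := by
          intro e he
          obtain ⟨v, v', y, z, hv, hv', hne, hyz, hy, hz, rfl⟩ := hdir e he
          have k1 : (y, z) ∈ R v v' := ⟨hyz, hy, hz⟩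
          have k2 : (z, y) ∈ R v' v := ⟨hyz.symm, hz, hy⟩
          have f1 : F (y, z) = s(toDisplay _ _ (Sum.inr y), toDisplay _ _ (Sum.inr z)) := rfl
          have f2 : F (z, y) = s(toDisplay _ _ (Sum.inr y), toDisplay _ _ (Sum.inr z)) := Sym2.eq_swap
          rcases hall v hv with rfl | rfl | rfl <;> rcases hall v' hv' with rfl | rfl | rfl
          · exact absurd rfl hne
          · exact ⟨(y, z), Or.inl (Or.inl k1), f1⟩
          · exact ⟨(y, z), Or.inl (Or.inr k1), f1⟩
          · exact ⟨(z, y), Or.inl (Or.inl k2), f2⟩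
          · exact absurd rfl hne
          · exact ⟨(y, z), Or.inr k1, f1⟩
          · exact ⟨(z, y), Or.inl (Or.inr k2), f2⟩
          · exact ⟨(z, y), Or.inr k2, f2⟩
          · exact absurd rfl hne
        have h1 := Set.ncard_le_ncard hsub (Set.toFinite _)
        have h2 := Set.ncard_union_le (R v1 v2 ∪ R v1 v3) (R v2 v3)
        have h3 := Set.ncard_union_le (R v1 v2) (R v1 v3)
        have h4 := Set.ncard_image_le (f := F) (Set.toFinite ((R v1 v2 ∪ R v1 v3) ∪ R v2 v3))
        omega

end Display


section TD3sec

/-- `S` is connected in `t`. -/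
def Conn {ι : Type*} (t : SimpleGraph ι) (S : Set ι) : Prop :=
  ∀ A : Set ι, (∃ a ∈ S, a ∈ A) → (∀ u v, t.Adj u v → u ∈ S → v ∈ S → u ∈ A → v ∈ A) → S ⊆ A

lemma conn_of_induce {ι : Type*} {t : SimpleGraph ι} {S : Set ι} (h : (t.induce S).Connected) :
    Conn t S := by
  rintro A ⟨a, haS, haA⟩ hA s hs
  have := closed_of_connected h {x : S | x.1 ∈ A} (a := ⟨a, haS⟩) haA
    (fun u v huv hu => hA u.1 v.1 huv u.2 v.2 hu) ⟨s, hs⟩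
  exact this

/-- A tree decomposition of width at most two of a relation on an active set. -/
def TD3 {W : Type} (Ω : Set W) (K : W → W → Prop) : Prop :=
  ∃ (ι : Type) (_ : Finite ι) (t : SimpleGraph ι) (σ : W → Set ι), t.Connected ∧ t.IsAcyclic ∧
    (∀ w ∈ Ω, (σ w).Nonempty ∧ Conn t (σ w)) ∧
    (∀ w ∈ Ω, ∀ w' ∈ Ω, K w w' → (σ w ∩ σ w').Nonempty) ∧
    ∀ i, {w | w ∈ Ω ∧ i ∈ σ w}.ncard ≤ 3

lemma td_contract {W W' : Type} [Finite W] {Ω : Set W} {K : W → W → Prop}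
    {Ω' : Set W'} {K' : W' → W' → Prop} (h : TD3 Ω K) (f : W → W') (c : W' → W)
    (h1 : ∀ w ∈ Ω', c w ∈ Ω ∧ f (c w) = w)
    (h2 : ∀ z ∈ Ω, f z ∈ Ω' → z = c (f z) ∨ K z (c (f z)))
    (h3 : ∀ w ∈ Ω', ∀ w' ∈ Ω', K' w w' → ∃ z ∈ Ω, ∃ z' ∈ Ω, f z = w ∧ f z' = w' ∧ K z z') :
    TD3 Ω' K' := by
  obtain ⟨ι, hι, t, σ, tc, ta, hσ, hK, hb⟩ := h
  refine ⟨ι, hι, t, fun w => {i | ∃ z ∈ Ω, f z = w ∧ i ∈ σ z}, tc, ta, ?_, ?_, ?_⟩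
  · intro w hw
    obtain ⟨hc, hfc⟩ := h1 w hw
    constructor
    · obtain ⟨i, hi⟩ := (hσ _ hc).1
      exact ⟨i, c w, hc, hfc, hi⟩
    · rintro A ⟨a, ⟨z, hz, hfz, haz⟩, haA⟩ hA
      have sub : ∀ y ∈ Ω, f y = w → (∃ b ∈ σ y, b ∈ A) → σ y ⊆ A := by
        intro y hy hfy hb
        refine (hσ y hy).2 A hb ?_
        intro u v huv hu hv huA
        exact hA u v huv ⟨y, hy, hfy, hu⟩ ⟨y, hy, hfy, hv⟩ huA
      have meet : ∀ y ∈ Ω, f y = w → (σ y ∩ σ (c w)).Nonempty := by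
        intro y hy hfy
        rcases h2 y hy (by rw [hfy]; exact hw) with h | h
        · rw [hfy] at h
          rw [h, Set.inter_self]
          exact (hσ _ hc).1
        · rw [hfy] at h
          exact hK y hy _ hc h
      have hcA : σ (c w) ⊆ A := by
        obtain ⟨b, hb1, hb2⟩ := meet z hz hfz
        exact sub _ hc hfc ⟨b, hb2, sub z hz hfz ⟨a, haz, haA⟩ hb1⟩
      rintro j ⟨y, hy, hfy, hj⟩
      obtain ⟨b, hb1, hb2⟩ := meet y hy hfy
      exact sub y hy hfy ⟨b, hb1, hcA hb2⟩ hj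
  · intro w hw w' hw' hk
    obtain ⟨z, hz, z', hz', hf, hf', hk'⟩ := h3 w hw w' hw' hk
    obtain ⟨i, hi, hi'⟩ := hK z hz z' hz' hk'
    exact ⟨i, ⟨z, hz, hf, hi⟩, ⟨z', hz', hf', hi'⟩⟩
  · intro i
    refine le_trans (Set.ncard_le_ncard (t := f '' {w | w ∈ Ω ∧ i ∈ σ w}) ?_ (Set.toFinite _))
      ((Set.ncard_image_le (Set.toFinite _)).trans (hb i))
    rintro w ⟨hw, z, hz, hf, hi⟩
    exact ⟨z, ⟨hz, hi⟩, hf⟩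

lemma depth_lt_side {U : Type} [Fintype U] {T : SimpleGraph U} (hTc : T.Connected)
    (hTa : T.IsAcyclic) {r p i z : U}
    (h : T.Adj p i) (hr : r ∉ side T p i) (hz : z ∈ side T p i) (hzi : z ≠ i) :
    depth T r i < depth T r z := by
  unfold depth
  refine Set.ncard_lt_ncard ?_ (Set.toFinite _)
  rw [Set.ssubset_iff_of_subset]
  · obtain ⟨c, hc, hzc⟩ := side_cover_nbr hTc i z hzi
    refine ⟨(i, c), ⟨hc, ?_, hzc⟩, fun h' => side_not_mem hTa hc h'.2.2⟩
    intro hrc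
    have hrp : r ∈ side T i p := (side_compl hTc hTa h).2 hr
    have hcp : c ≠ p := by
      rintro rfl
      exact side_disj hTa h hz hzc
    exact side_disj_nbr hTa hc h.symm hcp hrc hrp
  · rintro ⟨a, b⟩ ⟨h1, h2, h3⟩
    refine ⟨h1, h2, ?_⟩
    simp only at h1 h2 h3 ⊢
    by_contra hza
    have hra : r ∈ side T b a := (side_compl hTc hTa h1).2 h2
    have hza' : z ∈ side T b a := (side_compl hTc hTa h1).2 hza
    have hia : i ∉ side T b a := fun h => side_disj hTa h1 h3 h
    -- side b a ⊆ side p i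
    by_cases ha : a ∈ side T p i
    · exact hr (side_subset hTa h ha hia hra)
    · -- then `side p i` avoids `side b a`
      have : side T p i ⊆ side T a b := by
        refine side_induct _ h3 ?_
        intro x y hxy hx hy hxA
        by_contra hyA
        have := side_cross hTa h1 hxy hxA hyA
        rw [this.2] at hy
        exact ha hy
      exact hza (this hz)

lemma low_degree {W : Type} [Finite W] {Ω : Set W} (hne : Ω.Nonempty) {ι : Type} [Finite ι]
    {t : SimpleGraph ι} (tc : t.Connected) (ta : t.IsAcyclic) {σ : W → Set ι}
    (hσ : ∀ w ∈ Ω, (σ w).Nonempty ∧ Conn t (σ w)) :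
    ∃ v ∈ Ω, ∃ i ∈ σ v, ∀ w ∈ Ω, (σ v ∩ σ w).Nonempty → i ∈ σ w := by
  classical
  haveI := Fintype.ofFinite ι
  obtain ⟨r⟩ := tc.nonempty
  have htop : ∀ w, ∃ i, w ∈ Ω → i ∈ σ w ∧ ∀ j ∈ σ w, depth t r i ≤ depth t r j := by
    intro w
    by_cases hw : w ∈ Ω
    · obtain ⟨i, hi, hi'⟩ := Set.exists_min_image (σ w) (depth t r) (Set.toFinite _) (hσ w hw).1
      exact ⟨i, fun _ => ⟨hi, hi'⟩⟩
    · exact ⟨r, fun h => absurd h hw⟩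
  choose top htop using htop
  obtain ⟨v, hv, hmax⟩ := Set.exists_max_image Ω (fun w => depth t r (top w)) (Set.toFinite _) hne
  refine ⟨v, hv, top v, (htop v hv).1, ?_⟩
  rintro w hw ⟨j, hjv, hjw⟩
  have d0 : depth t r r = 0 := by
    unfold depth
    rw [Set.ncard_eq_zero]
    rw [Set.eq_empty_iff_forall_notMem]
    rintro pq ⟨-, h1, h2⟩
    exact h1 h2
  by_cases hir : top v = r
  · -- every other top is `r`
    have h1 := hmax w hw
    simp only [hir, d0] at h1
    by_contra hcon
    rw [hir] at hcon
    have hne : top w ≠ r := fun h => hcon (h ▸ (htop w hw).1)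
    obtain ⟨c, hc, hwc⟩ := side_cover_nbr tc r _ hne
    have hlt : depth t r r < depth t r c := depth_lt tc ta hc (side_not_mem ta hc)
    by_cases hwc' : top w = c
    · rw [hwc'] at h1; omega
    · have := depth_lt_side tc ta hc (side_not_mem ta hc) hwc hwc'
      omega
  · obtain ⟨p, hp, hrp⟩ := side_cover_nbr tc (top v) r (fun h => hir h.symm)
    have hr : r ∉ side t p (top v) := fun h => side_disj ta hp.symm h hrp
    have hpd : depth t r p < depth t r (top v) := depth_lt tc ta hp.symm hr
    have hpv : p ∉ σ v := fun h => absurd ((htop v hv).2 p h) (not_le.2 hpd)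
    have hsub : σ v ⊆ side t p (top v) := by
      refine (hσ v hv).2 _ ⟨top v, (htop v hv).1, side_self _ _ _⟩ ?_
      intro a b hab ha hb haA
      by_contra hbA
      have := side_cross ta hp.symm hab haA hbA
      exact hpv (this.2 ▸ hb)
    by_contra hcon
    have hsub' : σ w ⊆ side t p (top v) := by
      refine (hσ w hw).2 _ ⟨j, hjw, hsub hjv⟩ ?_
      intro a b hab ha hb haA
      by_contra hbA
      have := side_cross ta hp.symm hab haA hbA
      exact hcon (this.1 ▸ ha)
    have h1 := depth_lt_side tc ta hp.symm hr (hsub' (htop w hw).1)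
      (fun h => hcon (h ▸ (htop w hw).1))
    exact absurd (hmax w hw) (not_le.2 h1)

end TD3sec


section Matching
variable {V1 V2 X : Type}

/-- One side of the invariants of a partial matching between two trees. -/
structure Half (T : PhyloTree V1 X) (T' : PhyloTree V2 X) (M : V1 → V2 → Prop) : Prop where
  leaf : ∀ x, M (T.leaf x) (T'.leaf x)
  inj : ∀ u v w, M u v → M u w → v = w
  adj : ∀ u u' v v', M u u' → M v v' → T.graph.Adj u v → T'.graph.Adj u' v'
  uniq : ∀ c c' n m, M c c' → T.graph.Adj c n → T.graph.Adj c m →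
    (∀ z, ¬ M n z) → (∀ z, ¬ M m z) → n = m
  ex : ∀ c c' n, M c c' → T.graph.Adj c n → (∀ z, ¬ M n z) →
    ∃ n', T'.graph.Adj c' n' ∧ ∀ z, ¬ M z n'
  con : Conn T.graph {n | ∀ z, ¬ M n z}

/-- The unmatched vertices. -/
def om (M : V1 → V2 → Prop) : Set (V1 ⊕ V2) :=
  {w | (∀ u, w = Sum.inl u → ∀ z, ¬ M u z) ∧ (∀ u, w = Sum.inr u → ∀ z, ¬ M z u)}

/-- Adjacency of unmatched vertices after contracting. -/
def KK (T : PhyloTree V1 X) (T' : PhyloTree V2 X) (M : V1 → V2 → Prop) :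
    V1 ⊕ V2 → V1 ⊕ V2 → Prop
  | Sum.inl u, Sum.inl v => T.graph.Adj u v
  | Sum.inr u, Sum.inr v => T'.graph.Adj u v
  | Sum.inl u, Sum.inr v => ∃ c c', M c c' ∧ T.graph.Adj c u ∧ T'.graph.Adj c' v
  | Sum.inr v, Sum.inl u => ∃ c c', M c c' ∧ T.graph.Adj c u ∧ T'.graph.Adj c' v

lemma om_inl {M : V1 → V2 → Prop} {u : V1} : (Sum.inl u : V1 ⊕ V2) ∈ om M ↔ ∀ z, ¬ M u z := by
  simp [om]

lemma om_inr {M : V1 → V2 → Prop} {u : V2} : (Sum.inr u : V1 ⊕ V2) ∈ om M ↔ ∀ z, ¬ M z u := by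
  simp [om]

lemma half_count {T : PhyloTree V1 X} {T' : PhyloTree V2 X} {M : V1 → V2 → Prop}
    (h : Half T T' M) (h' : Half T' T (fun a b => M b a)) {p : V1}
    (hp : ∀ n, (∀ z, ¬ M n z) → n = p) (hp0 : ∀ z, ¬ M p z) {p' q' : V2} (hp' : ∀ z, ¬ M z p')
    (hq' : ∀ z, ¬ M z q') : q' = p' := by
  classical
  haveI := T.finite
  haveI := T'.finite
  haveI := Fintype.ofFinite V1
  haveI := Fintype.ofFinite V2
  set N : Set V2 := {n | ∀ z, ¬ M z n} with hN
  have e1 := ee_forest T'.acyclic (M := N) ⟨p', hp'⟩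
  have e2 := ee_split T'.graph N
  have e3 : ee T'.graph N Set.univ = 3 * N.ncard := by
    rw [ee_univ_deg T'.graph N (fun _ => 3)]
    · rw [← Finset.sum_filter, Finset.sum_const, Set.ncard_eq_toFinset_card']
      rw [smul_eq_mul, mul_comm]
      congr 2
      ext; simp
    · intro y hy
      refine T'.internal_deg y ?_
      rintro x rfl
      exact hy _ (h.leaf x)
  have e4 : dcut T'.graph N ≤ 3 := by
    have hdeg : (T.graph.neighborSet p).ncard = 3 := by
      refine T.internal_deg p ?_
      rintro x rfl
      exact hp0 _ (h.leaf x)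
    rw [← hdeg, dcut, ee_eq_ncard]
    have key : ∀ q : V2 × V2, T'.graph.Adj q.1 q.2 → q.1 ∈ N → q.2 ∈ Nᶜ →
        ∃ c, M c q.2 ∧ T.graph.Adj p c := by
      rintro ⟨n, c'⟩ ha hn hc
      have : ∃ c, M c c' := by
        by_contra hh
        push Not at hh
        exact hc hh
      obtain ⟨c, hc⟩ := this
      obtain ⟨m, hm, hm'⟩ := h'.ex c' c n hc ha.symm hn
      rw [hp m hm'] at hm
      exact ⟨c, hc, hm.symm⟩
    have : ∃ F : V2 × V2 → V1, ∀ q : V2 × V2, T'.graph.Adj q.1 q.2 → q.1 ∈ N → q.2 ∈ Nᶜ →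
        M (F q) q.2 ∧ T.graph.Adj p (F q) := by
      refine ⟨fun q => if hq : ∃ c, M c q.2 ∧ T.graph.Adj p c then hq.choose else p, ?_⟩
      intro q h1 h2 h3
      have hq := key q h1 h2 h3
      simp only [dif_pos hq]
      exact hq.choose_spec
    obtain ⟨F, hF⟩ := this
    refine Set.ncard_le_ncard_of_injOn F ?_ ?_ (Set.toFinite _)
    · rintro q ⟨h1, h2, h3⟩
      exact (hF q h1 h2 h3).2
    · rintro q ⟨h1, h2, h3⟩ r ⟨g1, g2, g3⟩ he
      have a1 := (hF q h1 h2 h3).1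
      have a2 := (hF r g1 g2 g3).1
      rw [he] at a1
      have a3 := h.inj _ _ _ a1 a2
      rw [a3] at h1
      have a4 := h'.uniq _ _ _ _ a2 h1.symm g1.symm h2 g2
      exact Prod.ext a4 a3
  have e5 : N.ncard ≤ 1 := by omega
  exact (Set.ncard_le_one (Set.toFinite _)).1 e5 _ hq' _ hp'

/-- The extended matching. -/
def ext2 (M : V1 → V2 → Prop) (p : V1) (p' : V2) : V1 → V2 → Prop :=
  fun u u' => M u u' ∨ (u = p ∧ u' = p')

/-- The local configuration where a matching is extended. -/
structure Loc (T : PhyloTree V1 X) (M : V1 → V2 → Prop) (p c1 c2 c3 : V1) (c1' c2' : V2) :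
    Prop where
  n : ∀ z, ¬ M p z
  m1 : M c1 c1'
  m2 : M c2 c2'
  a1 : T.graph.Adj p c1
  a2 : T.graph.Adj p c2
  a3 : T.graph.Adj p c3
  d12 : c1 ≠ c2
  d13 : c1 ≠ c3
  d23 : c2 ≠ c3
  all : ∀ w, T.graph.Adj p w → w = c1 ∨ w = c2 ∨ w = c3

lemma ext_adj {T : PhyloTree V1 X} {T' : PhyloTree V2 X} {M : V1 → V2 → Prop}
    (h : Half T T' M) (h' : Half T' T (fun a b => M b a)) {p c1 c2 c3 : V1} {p' c1' c2' c3' : V2}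
    (l : Loc T M p c1 c2 c3 c1' c2') (l' : Loc T' (fun a b => M b a) p' c1' c2' c3' c1 c2) :
    ∀ u u', M u u' → T.graph.Adj p u → T'.graph.Adj p' u' := by
  intro u u' hu ha
  rcases l.all u ha with rfl | rfl | rfl
  · rw [h.inj _ _ _ hu l.m1]; exact l'.a1
  · rw [h.inj _ _ _ hu l.m2]; exact l'.a2
  · have hN : {n | ∀ z, ¬ M n z} ⊆ {p} := by
      refine h.con {p} ⟨p, l.n, rfl⟩ ?_
      rintro x y hxy hx hy rfl
      exfalso
      rcases l.all y hxy with rfl | rfl | rfl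
      · exact hy _ l.m1
      · exact hy _ l.m2
      · exact hy _ hu
    obtain ⟨n', hn1, hn2⟩ := h.ex _ _ _ hu ha.symm l.n
    have := half_count h h' (p := p) (fun n hn => hN hn) l.n l'.n hn2
    rw [this] at hn1
    exact hn1.symm

lemma ext_half {T : PhyloTree V1 X} {T' : PhyloTree V2 X} {M : V1 → V2 → Prop}
    (h : Half T T' M) (h' : Half T' T (fun a b => M b a)) {p c1 c2 c3 : V1} {p' c1' c2' c3' : V2}
    (l : Loc T M p c1 c2 c3 c1' c2') (l' : Loc T' (fun a b => M b a) p' c1' c2' c3' c1 c2) :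
    Half T T' (ext2 M p p') := by
  have E := ext_adj h h' l l'
  have E' := ext_adj h' h l' l
  have hnd : ∀ {n}, (∀ z, ¬ ext2 M p p' n z) ↔ (∀ z, ¬ M n z) ∧ n ≠ p := by
    intro n
    constructor
    · intro hn
      refine ⟨fun z hz => hn z (Or.inl hz), ?_⟩
      rintro rfl
      exact hn p' (Or.inr ⟨rfl, rfl⟩)
    · rintro ⟨h1, h2⟩ z (hz | hz)
      · exact h1 z hz
      · exact h2 hz.1
  have pc3 : ∀ {w}, T.graph.Adj p w → (∀ z, ¬ M w z) → w = c3 := by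
    intro w hw hn
    rcases l.all w hw with rfl | rfl | rfl
    · exact absurd l.m1 (hn _)
    · exact absurd l.m2 (hn _)
    · rfl
  refine ⟨fun x => Or.inl (h.leaf x), ?_, ?_, ?_, ?_, ?_⟩
  · rintro u v w (h1 | ⟨rfl, rfl⟩) (h2 | ⟨h2, rfl⟩)
    · exact h.inj _ _ _ h1 h2
    · subst h2; exact absurd h1 (l.n _)
    · exact absurd h2 (l.n _)
    · rfl
  · rintro u u' v v' (h1 | ⟨rfl, rfl⟩) (h2 | ⟨rfl, rfl⟩) ha
    · exact h.adj _ _ _ _ h1 h2 ha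
    · exact (E _ _ h1 ha.symm).symm
    · exact E _ _ h2 ha
    · exact absurd rfl ha.ne
  · rintro c c' n m (h1 | ⟨rfl, rfl⟩) an am hn hm
    · exact h.uniq _ _ _ _ h1 an am (hnd.1 hn).1 (hnd.1 hm).1
    · rw [pc3 an (hnd.1 hn).1, pc3 am (hnd.1 hm).1]
  · rintro c c' n (h1 | ⟨rfl, rfl⟩) an hn
    · rw [hnd] at hn
      obtain ⟨n', hn1, hn2⟩ := h.ex _ _ _ h1 an hn.1
      refine ⟨n', hn1, ?_⟩
      rintro z (hz | ⟨rfl, rfl⟩)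
      · exact hn2 z hz
      · have := E' _ _ h1 hn1.symm
        exact hn.2 (h.uniq _ _ _ _ h1 an this.symm hn.1 l.n)
    · rw [hnd] at hn
      have hc := pc3 an hn.1
      subst hc
      refine ⟨c3', l'.a3, ?_⟩
      rintro z (hz | ⟨rfl, hz⟩)
      · have := E' _ _ hz l'.a3
        rcases l.all z this with rfl | rfl | rfl
        · exact l'.d13 (h.inj _ _ _ l.m1 hz)
        · exact l'.d23 (h.inj _ _ _ l.m2 hz)
        · exact hn.1 _ hz
      · exact l'.a3.ne hz.symm
  · intro A hA hcl
    have hB : {n | ∀ z, ¬ M n z} ⊆ {u | (u ≠ p ∧ u ∈ A) ∨ (u = p ∧ c3 ∈ A)} := by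
      refine h.con _ ?_ ?_
      · obtain ⟨a, ha, haA⟩ := hA
        exact ⟨a, (hnd.1 ha).1, Or.inl ⟨(hnd.1 ha).2, haA⟩⟩
      · rintro u v huv hu hv (⟨h1, h2⟩ | ⟨rfl, h2⟩)
        · by_cases hvp : v = p
          · subst hvp
            right
            rw [pc3 huv.symm hu] at h2
            exact ⟨rfl, h2⟩
          · left
            exact ⟨hvp, hcl u v huv (hnd.2 ⟨hu, h1⟩) (hnd.2 ⟨hv, hvp⟩) h2⟩
        · left
          rw [pc3 huv hv]
          exact ⟨l.a3.ne', h2⟩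
    intro n hn
    have hn' := hnd.1 hn
    rcases hB hn'.1 with h1 | h1
    · exact h1.2
    · exact absurd h1.1 hn'.2

lemma om_ext {M : V1 → V2 → Prop} {p : V1} {p' : V2} {w : V1 ⊕ V2} :
    w ∈ om (ext2 M p p') → w ∈ om M ∧ w ≠ Sum.inl p ∧ w ≠ Sum.inr p' := by
  intro h
  refine ⟨⟨fun u hu z hz => h.1 u hu z (Or.inl hz), fun u hu z hz => h.2 u hu z (Or.inl hz)⟩,
    ?_, ?_⟩
  · rintro rfl
    exact h.1 p rfl p' (Or.inr ⟨rfl, rfl⟩)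
  · rintro rfl
    exact h.2 p' rfl p (Or.inr ⟨rfl, rfl⟩)

lemma ext_td {T : PhyloTree V1 X} {T' : PhyloTree V2 X} {M : V1 → V2 → Prop}
    {p c1 c2 c3 : V1} {p' c1' c2' c3' : V2}
    (l : Loc T M p c1 c2 c3 c1' c2') (l' : Loc T' (fun a b => M b a) p' c1' c2' c3' c1 c2)
    (td : TD3 (om M) (KK T T' M)) : TD3 (om (ext2 M p p')) (KK T T' (ext2 M p p')) := by
  classical
  haveI := T.finite
  haveI := T'.finite
  let f : V1 ⊕ V2 → V1 ⊕ V2 := fun w => if w = Sum.inl p then Sum.inl c3 else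
    if w = Sum.inr p' then Sum.inr c3' else w
  have f1 : f (Sum.inl p) = Sum.inl c3 := by simp [f]
  have f2 : f (Sum.inr p') = Sum.inr c3' := by simp [f]
  have f3 : ∀ w, w ≠ Sum.inl p → w ≠ Sum.inr p' → f w = w := by
    intro w h1 h2; simp [f, h1, h2]
  have fo : ∀ w ∈ om (ext2 M p p'), f w = w := fun w hw => f3 w (om_ext hw).2.1 (om_ext hw).2.2
  have pc3 : ∀ {w}, T.graph.Adj p w → (∀ z, ¬ M w z) → w = c3 := by
    intro w hw hn
    rcases l.all w hw with rfl | rfl | rfl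
    · exact absurd l.m1 (hn _)
    · exact absurd l.m2 (hn _)
    · rfl
  have pc3' : ∀ {w}, T'.graph.Adj p' w → (∀ z, ¬ M z w) → w = c3' := by
    intro w hw hn
    rcases l'.all w hw with rfl | rfl | rfl
    · exact absurd l.m1 (hn _)
    · exact absurd l.m2 (hn _)
    · rfl
  refine td_contract td f id ?_ ?_ ?_
  · intro w hw
    exact ⟨(om_ext hw).1, fo w hw⟩
  · intro z hz hfz
    by_cases h1 : z = Sum.inl p
    · subst h1; right; rw [f1]; exact l.a3
    by_cases h2 : z = Sum.inr p'
    · subst h2; right; rw [f2]; exact l'.a3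
    left
    exact (f3 z h1 h2).symm
  · intro w hw w' hw' hk
    have hwo := om_ext hw
    have hwo' := om_ext hw'
    rcases w with u | u <;> rcases w' with v | v
    · exact ⟨_, hwo.1, _, hwo'.1, fo _ hw, fo _ hw', hk⟩
    · obtain ⟨c, c', hc | ⟨rfl, rfl⟩, h1, h2⟩ := hk
      · exact ⟨_, hwo.1, _, hwo'.1, fo _ hw, fo _ hw', c, c', hc, h1, h2⟩
      · refine ⟨Sum.inl c, om_inl.2 l.n, Sum.inr c', om_inr.2 l'.n, ?_, ?_, c1, c1', l.m1,
          l.a1.symm, l'.a1.symm⟩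
        · rw [f1, pc3 h1 (om_inl.1 hwo.1)]
        · rw [f2, pc3' h2 (om_inr.1 hwo'.1)]
    · obtain ⟨c, c', hc | ⟨rfl, rfl⟩, h1, h2⟩ := hk
      · exact ⟨_, hwo.1, _, hwo'.1, fo _ hw, fo _ hw', c, c', hc, h1, h2⟩
      · refine ⟨Sum.inr c', om_inr.2 l'.n, Sum.inl c, om_inl.2 l.n, ?_, ?_, c1, c1', l.m1,
          l.a1.symm, l'.a1.symm⟩
        · rw [f2, pc3' h2 (om_inr.1 hwo.1)]
        · rw [f1, pc3 h1 (om_inl.1 hwo'.1)]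
    · exact ⟨_, hwo.1, _, hwo'.1, fo _ hw, fo _ hw', hk⟩

/-- The full state. -/
structure St (T : PhyloTree V1 X) (T' : PhyloTree V2 X) (M : V1 → V2 → Prop) : Prop where
  h : Half T T' M
  h' : Half T' T (fun a b => M b a)
  td : TD3 (om M) (KK T T' M)

lemma td_flip {T : PhyloTree V1 X} {T' : PhyloTree V2 X} {M : V1 → V2 → Prop}
    (td : TD3 (om M) (KK T T' M)) :
    TD3 (om (fun a b => M b a)) (KK T' T (fun a b => M b a)) := by
  haveI := T.finite
  haveI := T'.finite
  have ho : ∀ w : V2 ⊕ V1, w ∈ om (fun a b => M b a) → w.swap ∈ om M := by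
    rintro (u | u) hw
    · exact om_inr.2 (om_inl.1 hw)
    · exact om_inl.2 (om_inr.1 hw)
  refine td_contract td Sum.swap Sum.swap ?_ ?_ ?_
  · intro w hw
    exact ⟨ho w hw, Sum.swap_swap w⟩
  · intro z _ _
    left; exact (Sum.swap_swap z).symm
  · intro w hw w' hw' hk
    refine ⟨_, ho w hw, _, ho w' hw', Sum.swap_swap _, Sum.swap_swap _, ?_⟩
    rcases w with u | u <;> rcases w' with v | v
    · exact hk
    · obtain ⟨c, c', h1, h2, h3⟩ := hk; exact ⟨c', c, h1, h3, h2⟩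
    · obtain ⟨c, c', h1, h2, h3⟩ := hk; exact ⟨c', c, h1, h3, h2⟩
    · exact hk

lemma St.flip {T : PhyloTree V1 X} {T' : PhyloTree V2 X} {M : V1 → V2 → Prop} (s : St T T' M) :
    St T' T (fun a b => M b a) := ⟨s.h', s.h, td_flip s.td⟩

lemma loc_of {T : PhyloTree V1 X} {M : V1 → V2 → Prop} {p c1 c2 : V1} {c1' c2' : V2}
    (hl : ∀ x, T.leaf x ≠ p) (n : ∀ z, ¬ M p z) (m1 : M c1 c1') (m2 : M c2 c2')
    (a1 : T.graph.Adj p c1) (a2 : T.graph.Adj p c2) (d12 : c1 ≠ c2) :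
    ∃ c3, Loc T M p c1 c2 c3 c1' c2' := by
  obtain ⟨v1, v2, v3, b1, b2, b3, e1, e2, e3, hall⟩ := int_nbr T p hl
  rcases hall c1 a1 with h1 | h1 | h1 <;> rcases hall c2 a2 with h2 | h2 | h2 <;>
    subst h1 <;> subst h2 <;> first | (exact absurd rfl d12) | skip
  · exact ⟨v3, n, m1, m2, a1, a2, b3, d12, e2, e3, hall⟩
  · exact ⟨v2, n, m1, m2, a1, a2, b2, d12, e1, e3.symm, fun w hw => by have := hall w hw; tauto⟩
  · exact ⟨v3, n, m1, m2, a1, a2, b3, d12, e3, e2, fun w hw => by have := hall w hw; tauto⟩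
  · exact ⟨v1, n, m1, m2, a1, a2, b1, d12, e1.symm, e2.symm,
      fun w hw => by have := hall w hw; tauto⟩
  · exact ⟨v2, n, m1, m2, a1, a2, b2, d12, e3.symm, e1, fun w hw => by have := hall w hw; tauto⟩
  · exact ⟨v1, n, m1, m2, a1, a2, b1, d12, e2.symm, e1.symm,
      fun w hw => by have := hall w hw; tauto⟩

lemma four_collide {W : Type*} [Finite W] {S : Set W} (hS : S.ncard ≤ 3) {v a b c : W}
    (hv : v ∈ S) (ha : a ∈ S) (hb : b ∈ S) (hc : c ∈ S) (h1 : a ≠ v) (h2 : b ≠ v) (h3 : c ≠ v) :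
    a = b ∨ a = c ∨ b = c := by
  classical
  by_contra hh
  push Not at hh
  have : ({v, a, b, c} : Set W).ncard ≤ S.ncard := by
    refine Set.ncard_le_ncard ?_ (Set.toFinite _)
    rintro x (rfl | rfl | rfl | rfl) <;> assumption
  rw [Set.ncard_insert_of_notMem, Set.ncard_insert_of_notMem, Set.ncard_insert_of_notMem,
    Set.ncard_singleton] at this
  · omega
  · simp [hh.2.2]
  · simp [hh.1, hh.2.1]
  · simp [h1.symm, h2.symm, h3.symm]

lemma step_left {T : PhyloTree V1 X} {T' : PhyloTree V2 X} {M : V1 → V2 → Prop}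
    (s : St T T' M) {p : V1} (hp : ∀ z, ¬ M p z) {S : Set (V1 ⊕ V2)} (hS : S.ncard ≤ 3)
    (hpS : Sum.inl p ∈ S) (hK : ∀ w ∈ om M, KK T T' M (Sum.inl p) w → w ∈ S) :
    ∃ p', (∀ z, ¬ M z p') ∧ St T T' (ext2 M p p') := by
  haveI := T.finite
  haveI := T'.finite
  have hpl : ∀ x, T.leaf x ≠ p := by
    rintro x rfl; exact hp _ (s.h.leaf x)
  obtain ⟨v1, v2, v3, b1, b2, b3, e1, e2, e3, hall⟩ := int_nbr T p hpl
  have W : ∀ c, T.graph.Adj p c → ∃ w ∈ S, w ≠ Sum.inl p ∧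
      (w = Sum.inl c ∨ ∃ c' n', M c c' ∧ T'.graph.Adj c' n' ∧ (∀ z, ¬ M z n') ∧
        w = Sum.inr n') := by
    intro c hc
    by_cases hd : ∃ c', M c c'
    · obtain ⟨c', hc'⟩ := hd
      obtain ⟨n', h1, h2⟩ := s.h.ex _ _ _ hc' hc.symm hp
      exact ⟨Sum.inr n', hK _ (om_inr.2 h2) ⟨c, c', hc', hc.symm, h1⟩, by simp,
        Or.inr ⟨c', n', hc', h1, h2, rfl⟩⟩
    · push Not at hd
      refine ⟨Sum.inl c, hK _ (om_inl.2 hd) hc, ?_, Or.inl rfl⟩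
      intro h
      exact hc.ne (Sum.inl_injective h).symm
  obtain ⟨w1, hw1, n1, r1⟩ := W v1 b1
  obtain ⟨w2, hw2, n2, r2⟩ := W v2 b2
  obtain ⟨w3, hw3, n3, r3⟩ := W v3 b3
  have fin : ∀ c d w, c ≠ d → T.graph.Adj p c → T.graph.Adj p d →
      (w = Sum.inl c ∨ ∃ c' n', M c c' ∧ T'.graph.Adj c' n' ∧ (∀ z, ¬ M z n') ∧
        w = Sum.inr n') →
      (w = Sum.inl d ∨ ∃ c' n', M d c' ∧ T'.graph.Adj c' n' ∧ (∀ z, ¬ M z n') ∧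
        w = Sum.inr n') → ∃ p', (∀ z, ¬ M z p') ∧ St T T' (ext2 M p p') := by
    rintro c d w hcd hc hd (rfl | ⟨c', n', h1, h2, h3, rfl⟩) (h | ⟨d', m', g1, g2, g3, g4⟩)
    · exact absurd (Sum.inl_injective h) hcd
    · cases g4
    · cases h
    · have := Sum.inr_injective g4
      subst this
      obtain ⟨c3, l⟩ := loc_of hpl hp h1 g1 hc hd hcd
      have hcd' : c' ≠ d' := by
        rintro rfl
        exact hcd (s.h'.inj _ _ _ h1 g1)
      obtain ⟨c3', l'⟩ := loc_of (T := T') (M := fun a b => M b a) (p := n')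
        (by rintro x rfl; exact h3 _ (s.h.leaf x)) h3 h1 g1 h2.symm g2.symm hcd'
      refine ⟨n', h3, ext_half s.h s.h' l l', ?_, ext_td l l' s.td⟩
      have := ext_half s.h' s.h l' l
      convert this using 3
      unfold ext2
      rw [and_comm]
  rcases four_collide hS hpS hw1 hw2 hw3 n1 n2 n3 with h | h | h
  · subst h; exact fin _ _ _ e1 b1 b2 r1 r2
  · subst h; exact fin _ _ _ e2 b1 b3 r1 r3
  · subst h; exact fin _ _ _ e3 b2 b3 r2 r3

lemma step_any {T : PhyloTree V1 X} {T' : PhyloTree V2 X} {M : V1 → V2 → Prop}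
    (s : St T T' M) (hne : (om M).Nonempty) :
    ∃ p p', (∀ z, ¬ M p z) ∧ (∀ z, ¬ M z p') ∧ St T T' (ext2 M p p') := by
  haveI := T.finite
  haveI := T'.finite
  obtain ⟨ι, hι, t, σ, tc, ta, hσ, hK, hb⟩ := s.td
  obtain ⟨v, hv, i, hi, hw⟩ := low_degree hne tc ta hσ
  rcases v with p | p'
  · have hp := om_inl.1 hv
    obtain ⟨p', h1, h2⟩ := step_left s hp (hb i) ⟨hv, hi⟩
      (fun w hwo hk => ⟨hwo, hw w hwo (hK _ hv _ hwo hk)⟩)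
    exact ⟨p, p', hp, h1, h2⟩
  · have hp := om_inr.1 hv
    obtain ⟨p, h1, h2⟩ := step_left s.flip hp (S := Sum.swap '' {w | w ∈ om M ∧ i ∈ σ w})
      (by rw [Set.ncard_image_of_injective _ (Function.LeftInverse.injective Sum.swap_swap)]
          exact hb i) ⟨_, ⟨hv, hi⟩, rfl⟩ (by
        intro w hwo hk
        have hwo' : w.swap ∈ om M := by
          rcases w with u | u
          · exact om_inr.2 (om_inl.1 hwo)
          · exact om_inl.2 (om_inr.1 hwo)
        refine ⟨w.swap, ⟨hwo', hw _ hwo' (hK _ hv _ hwo' ?_)⟩, Sum.swap_swap w⟩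
        rcases w with u | u
        · exact hk
        · obtain ⟨c, c', h1, h2, h3⟩ := hk; exact ⟨c', c, h1, h3, h2⟩)
    refine ⟨p, p', h1, hp, ?_⟩
    have := h2.flip
    convert this using 3
    unfold ext2
    rw [and_comm]

lemma compat_of_st {T : PhyloTree V1 X} {T' : PhyloTree V2 X} {M : V1 → V2 → Prop}
    (s : St T T' M) : Compatible T T' := by
  classical
  haveI := T.finite
  haveI := T'.finite
  induction hn : (om M).ncard using Nat.strong_induction_on generalizing M with
  | _ n ih =>
    by_cases hne : (om M).Nonempty
    · obtain ⟨p, p', h1, h2, h3⟩ := step_any s hne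
      refine ih _ ?_ h3 rfl
      rw [← hn]
      refine Set.ncard_lt_ncard ?_ (Set.toFinite _)
      refine ⟨fun w hw => (om_ext hw).1, fun hh => ?_⟩
      exact (om_ext (hh (om_inl.2 h1))).2.1 rfl
    · have t1 : ∀ u, ∃ u', M u u' := by
        intro u
        by_contra hh
        push Not at hh
        exact hne ⟨_, om_inl.2 hh⟩
      have t2 : ∀ u', ∃ u, M u u' := by
        intro u
        by_contra hh
        push Not at hh
        exact hne ⟨_, om_inr.2 hh⟩
      choose F hF using t1
      choose G hG using t2
      refine ⟨⟨⟨F, G, fun u => s.h'.inj _ _ _ (hG _) (hF _),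
        fun u => s.h.inj _ _ _ (hF _) (hG _)⟩, ?_⟩, fun x => s.h.inj _ _ _ (hF _) (s.h.leaf x)⟩
      intro a b
      exact ⟨fun h => s.h'.adj _ _ _ _ (hF _) (hF _) h, fun h => s.h.adj _ _ _ _ (hF _) (hF _) h⟩

end Matching


section Initial
variable {V1 V2 X : Type}

lemma leaf_nbr_int (T : PhyloTree V1 X) (hX : 3 ≤ Nat.card X) {x : X} {v : V1}
    (h : T.graph.Adj (T.leaf x) v) (y : X) : T.leaf y ≠ v := by
  rintro rfl
  have hall := closed_of_connected T.connected {T.leaf x, T.leaf y} (a := T.leaf x) (by simp) (by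
    obtain ⟨a, ha, ha'⟩ := leaf_nbr T x
    obtain ⟨b, hb, hb'⟩ := leaf_nbr T y
    rintro u v huv (rfl | rfl)
    · right; rw [ha' _ huv, ha' _ h]; rfl
    · left; rw [hb' _ huv, hb' _ h.symm])
  have : Finite V1 := T.finite
  have h1 : Nat.card X ≤ Nat.card V1 := Nat.card_le_card_of_injective _ T.leaf_inj
  have h2 : Nat.card V1 ≤ 2 := by
    rw [← Set.ncard_univ]
    refine le_trans (Set.ncard_le_ncard (t := {T.leaf x, T.leaf y}) (fun w _ => hall w)
      (Set.toFinite _)) ?_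
    refine le_trans (Set.ncard_insert_le _ _) ?_
    rw [Set.ncard_singleton]
  omega

/-- The initial matching of the leaves. -/
def M0 (T : PhyloTree V1 X) (T' : PhyloTree V2 X) : V1 → V2 → Prop :=
  fun u u' => ∃ x, u = T.leaf x ∧ u' = T'.leaf x

lemma m0_not {T : PhyloTree V1 X} {T' : PhyloTree V2 X} {u : V1} :
    (∀ z, ¬ M0 T T' u z) ↔ ∀ x, T.leaf x ≠ u := by
  constructor
  · rintro h x rfl
    exact h _ ⟨x, rfl, rfl⟩
  · rintro h z ⟨x, rfl, -⟩
    exact h x rfl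

lemma m0_flip (T : PhyloTree V1 X) (T' : PhyloTree V2 X) :
    (fun a b => M0 T T' b a) = M0 T' T := by
  funext a b
  unfold M0
  simp only [and_comm]

lemma m0_half (T : PhyloTree V1 X) (T' : PhyloTree V2 X) (hX : 3 ≤ Nat.card X) :
    Half T T' (M0 T T') := by
  refine ⟨fun x => ⟨x, rfl, rfl⟩, ?_, ?_, ?_, ?_, ?_⟩
  · rintro u v w ⟨x, rfl, rfl⟩ ⟨y, h, rfl⟩
    rw [T.leaf_inj h]
  · rintro u u' v v' ⟨x, rfl, rfl⟩ ⟨y, rfl, rfl⟩ ha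
    exact absurd rfl (leaf_nbr_int T hX ha y)
  · rintro c c' n m ⟨x, rfl, rfl⟩ hn hm - -
    obtain ⟨a, ha, ha'⟩ := leaf_nbr T x
    rw [ha' _ hn, ha' _ hm]
  · rintro c c' n ⟨x, rfl, rfl⟩ - -
    obtain ⟨a, ha, ha'⟩ := leaf_nbr T' x
    refine ⟨a, ha, ?_⟩
    rintro z ⟨y, rfl, rfl⟩
    exact absurd rfl (leaf_nbr_int T' hX ha y)
  · rintro A ⟨a, ha, haA⟩ hcl
    have hall := closed_of_connected T.connected
      {u | (u ∈ A ∧ ∀ z, ¬ M0 T T' u z) ∨ ((∃ x, u = T.leaf x) ∧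
        ∃ v, T.graph.Adj u v ∧ v ∈ A ∧ ∀ z, ¬ M0 T T' v z)} (a := a) (Or.inl ⟨haA, ha⟩) (by
      rintro u v huv (⟨h1, h2⟩ | ⟨⟨x, rfl⟩, w, h1, h2, h3⟩)
      · by_cases hv : ∀ z, ¬ M0 T T' v z
        · exact Or.inl ⟨hcl u v huv h2 hv h1, hv⟩
        · right
          rw [m0_not] at hv
          push Not at hv
          obtain ⟨x, hx⟩ := hv
          exact ⟨⟨x, hx.symm⟩, u, huv.symm, h1, h2⟩
      · left
        obtain ⟨b, hb, hb'⟩ := leaf_nbr T x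
        rw [hb' _ huv, ← hb' _ h1]
        exact ⟨h2, h3⟩)
    intro n hn
    rcases hall n with h | ⟨⟨x, rfl⟩, -⟩
    · exact h.1
    · exact absurd ⟨x, rfl, rfl⟩ (hn (T'.leaf x))

lemma toD_leaf {l1 : X → V1} {l2 : X → V2} (hl : Function.Injective l2) (x : X) :
    toDisplay l1 l2 (Sum.inr (l2 x)) = toDisplay l1 l2 (Sum.inl (l1 x)) := by
  have h : ∃ y, l2 y = l2 x := ⟨x, rfl⟩
  apply Subtype.ext
  simp only [toDisplay, mergeMap, h, dif_pos]
  rw [hl h.choose_spec]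

lemma toD_inr_val {l1 : X → V1} {l2 : X → V2} {y : V2} (hy : ∀ x, l2 x ≠ y) :
    (toDisplay l1 l2 (Sum.inr y)).1 = Sum.inr y := by
  have h : ¬ ∃ x, l2 x = y := by push Not; exact hy
  simp [toDisplay, mergeMap, h]

lemma td_initial (T : PhyloTree V1 X) (T' : PhyloTree V2 X)
    {k : ℕ} (hk : k ≤ 2)
    (h : HasTreeDecompWidthLE (displayGraph T.graph T.leaf T'.graph T'.leaf) k) :
    TD3 (Set.univ : Set (DisplayVertex T.leaf T'.leaf))
      (displayGraph T.graph T.leaf T'.graph T'.leaf).Adj := by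
  obtain ⟨n, t, bag, ht, h1, h2, h3, h4⟩ := h
  refine ⟨Fin (n + 1), inferInstance, t, fun v => {i | v ∈ bag i}, ht.1, ht.2, ?_, ?_, ?_⟩
  · intro w _
    exact ⟨h1 w, conn_of_induce (h3 w)⟩
  · intro w _ w' _ ha
    obtain ⟨i, hi, hi'⟩ := h2 w w' ha
    exact ⟨i, hi, hi'⟩
  · intro i
    have : {w | w ∈ (Set.univ : Set (DisplayVertex T.leaf T'.leaf)) ∧ i ∈ {i | w ∈ bag i}} =
        (bag i : Set _) := by
      ext w; simp
    rw [this, Set.ncard_coe_finset]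
    have := h4 i
    omega

lemma td_m0 (T : PhyloTree V1 X) (T' : PhyloTree V2 X)
    (td : TD3 (Set.univ : Set (DisplayVertex T.leaf T'.leaf))
      (displayGraph T.graph T.leaf T'.graph T'.leaf).Adj) :
    TD3 (om (M0 T T')) (KK T T' (M0 T T')) := by
  classical
  have := T.finite
  have := T'.finite
  have : Finite (DisplayVertex T.leaf T'.leaf) := Subtype.finite
  choose p hp hp' using leaf_nbr T
  let f0 : V1 ⊕ V2 → V1 ⊕ V2 := fun w => if hw : ∃ x, w = Sum.inl (T.leaf x) then
    Sum.inl (p hw.choose) else w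
  have f1 : ∀ x, f0 (Sum.inl (T.leaf x)) = Sum.inl (p x) := by
    intro x
    have hw : ∃ y, (Sum.inl (T.leaf x) : V1 ⊕ V2) = Sum.inl (T.leaf y) := ⟨x, rfl⟩
    simp only [f0, dif_pos hw]
    rw [← T.leaf_inj (Sum.inl_injective hw.choose_spec)]
  have f2 : ∀ w, (∀ x, w ≠ Sum.inl (T.leaf x)) → f0 w = w := by
    intro w hw
    have : ¬ ∃ x, w = Sum.inl (T.leaf x) := by push Not; exact hw
    simp only [f0, dif_neg this]
  have oi : ∀ u : V1, (Sum.inl u : V1 ⊕ V2) ∈ om (M0 T T') → ∀ x, T.leaf x ≠ u := by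
    intro u hu; exact m0_not.1 (om_inl.1 hu)
  have or : ∀ u : V2, (Sum.inr u : V1 ⊕ V2) ∈ om (M0 T T') → ∀ x, T'.leaf x ≠ u := by
    rintro u hu x rfl
    exact om_inr.1 hu _ ⟨x, rfl, rfl⟩
  have val : ∀ w ∈ om (M0 T T'), (toDisplay T.leaf T'.leaf w).1 = w := by
    rintro (u | u) hw
    · rfl
    · exact toD_inr_val (or u hw)
  have fo : ∀ w ∈ om (M0 T T'), f0 w = w := by
    rintro (u | u) hw
    · refine f2 _ ?_
      intro x hx
      exact oi u hw x (Sum.inl_injective hx).symm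
    · exact f2 _ (by simp)
  have toL : ∀ u v, T.graph.Adj u v → (displayGraph T.graph T.leaf T'.graph T'.leaf).Adj
      (toDisplay _ _ (Sum.inl u)) (toDisplay _ _ (Sum.inl v)) := by
    intro u v h
    refine ⟨?_, Or.inl (Or.inl ⟨u, v, h, rfl, rfl⟩)⟩
    intro he
    exact h.ne (Sum.inl_injective (congrArg Subtype.val he))
  have toR : ∀ u v, (∀ x, T'.leaf x ≠ v) → T'.graph.Adj u v →
      (displayGraph T.graph T.leaf T'.graph T'.leaf).Adj
      (toDisplay _ _ (Sum.inr u)) (toDisplay _ _ (Sum.inr v)) := by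
    intro u v hv h
    refine ⟨?_, Or.inl (Or.inr ⟨u, v, h, rfl, rfl⟩)⟩
    intro he
    have he' := congrArg Subtype.val he
    rw [toD_inr_val hv] at he'
    by_cases hu : ∃ x, T'.leaf x = u
    · obtain ⟨x, rfl⟩ := hu
      rw [toD_leaf T'.leaf_inj] at he'
      cases he'
    · push Not at hu
      rw [toD_inr_val hu] at he'
      exact h.ne (Sum.inr_injective he')
  refine td_contract td (fun d => f0 d.1) (toDisplay T.leaf T'.leaf) ?_ ?_ ?_
  · intro w hw
    refine ⟨trivial, ?_⟩
    simp only [val w hw, fo w hw]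
  · rintro ⟨z, hz⟩ - ho
    simp only at ho ⊢
    by_cases hx : ∃ x, z = Sum.inl (T.leaf x)
    · obtain ⟨x, rfl⟩ := hx
      right
      rw [f1]
      exact toL _ _ (hp x)
    · left
      push Not at hx
      rw [f2 z hx]
      exact Subtype.ext hz.symm
  · intro w hw w' hw' hk
    have g : ∀ w ∈ om (M0 T T'), f0 (toDisplay T.leaf T'.leaf w).1 = w := by
      intro w hw
      rw [val w hw, fo w hw]
    rcases w with u | u <;> rcases w' with v | v
    · exact ⟨_, trivial, _, trivial, g _ hw, g _ hw', toL _ _ hk⟩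
    · obtain ⟨c, c', ⟨x, rfl, rfl⟩, h1, h2⟩ := hk
      refine ⟨toDisplay _ _ (Sum.inl (T.leaf x)), trivial, _, trivial, ?_, g _ hw', ?_⟩
      · rw [hp' x _ h1]
        exact f1 x
      · rw [← toD_leaf T'.leaf_inj]
        exact toR _ _ (or _ hw') h2
    · obtain ⟨c, c', ⟨x, rfl, rfl⟩, h1, h2⟩ := hk
      refine ⟨_, trivial, toDisplay _ _ (Sum.inl (T.leaf x)), trivial, g _ hw, ?_, ?_⟩
      · rw [hp' x _ h1]
        exact f1 x
      · rw [← toD_leaf T'.leaf_inj]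
        exact (toR _ _ (or _ hw) h2).symm
    · exact ⟨_, trivial, _, trivial, g _ hw, g _ hw', toR _ _ (or _ hw') hk⟩

theorem compat_of_tw2 (T : PhyloTree V1 X) (T' : PhyloTree V2 X) (hX : 3 ≤ Nat.card X)
    {k : ℕ} (hk : k ≤ 2)
    (h : HasTreeDecompWidthLE (displayGraph T.graph T.leaf T'.graph T'.leaf) k) :
    Compatible T T' := by
  refine compat_of_st (M := M0 T T') ⟨m0_half T T' hX, ?_, td_m0 T T' (td_initial T T' hk h)⟩
  rw [m0_flip]
  exact m0_half T' T hX

end Initial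


section Parsimony

lemma changes_comp {Y : Type} [Finite Y] (G : SimpleGraph Y) {k j : ℕ} (g : Y → Fin k)
    (r : Fin k → Fin j) : changes G (fun y => r (g y)) ≤ changes G g := by
  unfold changes
  refine Set.ncard_le_ncard ?_ (Set.toFinite _)
  rintro e ⟨h1, u, v, h2, h3⟩
  exact ⟨h1, u, v, h2, fun h => h3 (congrArg r h)⟩

variable {V1 V2 X : Type}

lemma score_le (T : PhyloTree V1 X) {k : ℕ} (f : X → Fin k) (g : V1 → Fin k)
    (hg : ∀ x, g (T.leaf x) = f x) : parsimonyScore T.graph T.leaf f ≤ changes T.graph g :=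
  Nat.sInf_le ⟨g, hg, rfl⟩

lemma score_att (T : PhyloTree V1 X) (x₀ : X) {k : ℕ} (f : X → Fin k) :
    ∃ g : V1 → Fin k, (∀ x, g (T.leaf x) = f x) ∧
      changes T.graph g = parsimonyScore T.graph T.leaf f := by
  have := Nat.sInf_mem (s := {m | ∃ g : V1 → Fin k, (∀ x, g (T.leaf x) = f x) ∧
    {e | e ∈ T.graph.edgeSet ∧ ∃ u v : V1, e = s(u, v) ∧ g u ≠ g v}.ncard = m})
    ⟨_, Function.extend T.leaf f (fun _ => f x₀), fun x => T.leaf_inj.extend_apply _ _ _, rfl⟩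
  exact this

lemma score_bd (T : PhyloTree V1 X) (x₀ : X) {k : ℕ} (f : X → Fin k) :
    parsimonyScore T.graph T.leaf f ≤ T.graph.edgeSet.ncard := by
  have := T.finite
  obtain ⟨g, -, h⟩ := score_att T x₀ f
  rw [← h]
  refine Set.ncard_le_ncard ?_ (Set.toFinite _)
  exact fun e he => he.1

lemma hh_of_dMP (T : PhyloTree V1 X) (T' : PhyloTree V2 X) (x₀ : X) (h : dMP T T' ≤ 1) :
    HH T.graph T'.graph T.leaf T'.leaf := by
  classical
  have := T.finite
  have := T'.finite
  have key : ∀ (k : ℕ) (f : X → Fin k), Function.Surjective f →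
      parsimonyScore T'.graph T'.leaf f ≤ parsimonyScore T.graph T.leaf f + 1 := by
    intro k f hf
    have h1 : max (parsimonyScore T.graph T.leaf f - parsimonyScore T'.graph T'.leaf f)
        (parsimonyScore T'.graph T'.leaf f - parsimonyScore T.graph T.leaf f) ≤ dMP T T' := by
      refine le_csSup ?_ ⟨k, f, hf, rfl⟩
      refine ⟨T.graph.edgeSet.ncard + T'.graph.edgeSet.ncard, ?_⟩
      rintro m ⟨k, f, hf, rfl⟩
      have := score_bd T x₀ f
      have := score_bd T' x₀ f
      omega
    omega
  intro k g
  let f : X → Fin k := fun x => g (T.leaf x)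
  have : Finite (Set.range f) := Subtype.finite
  obtain ⟨j, ⟨e⟩⟩ := Finite.exists_equiv_fin (Set.range f)
  let r : Fin k → Fin j := fun c => if h : c ∈ Set.range f then e ⟨c, h⟩ else e ⟨f x₀, ⟨x₀, rfl⟩⟩
  have hr : ∀ x, r (f x) = e ⟨f x, ⟨x, rfl⟩⟩ := by
    intro x
    have : f x ∈ Set.range f := ⟨x, rfl⟩
    simp only [r, dif_pos this]
  have hsurj : Function.Surjective (fun x => r (f x)) := by
    intro c
    obtain ⟨⟨_, x, rfl⟩, hx⟩ := e.surjective c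
    exact ⟨x, by simp only [hr, hx]⟩
  have k1 := key j _ hsurj
  obtain ⟨g2, h1, h2⟩ := score_att T' x₀ (fun x => r (f x))
  refine ⟨fun y => (e.symm (g2 y)).1, ?_, ?_⟩
  · intro x
    show (e.symm (g2 (T'.leaf x))).1 = _
    rw [h1, hr, Equiv.symm_apply_apply]
  · have a1 := changes_comp T'.graph g2 (fun c => (e.symm c).1)
    have a2 := score_le T (fun x => r (f x)) (fun v => r (g v)) (fun x => rfl)
    have a3 := changes_comp T.graph g r
    omega

lemma changes_iso {G : SimpleGraph V1} {G' : SimpleGraph V2} [Finite V1] [Finite V2]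
    (φ : G ≃g G') {k : ℕ} (g : V2 → Fin k) :
    changes G (fun v => g (φ v)) ≤ changes G' g := by
  unfold changes
  refine Set.ncard_le_ncard_of_injOn (Sym2.map φ) ?_
    (Sym2.map.injective φ.injective).injOn (Set.toFinite _)
  rintro e ⟨h1, u, v, rfl, h3⟩
  exact ⟨φ.map_adj_iff.2 h1, φ u, φ v, rfl, h3⟩

lemma score_compat {T : PhyloTree V1 X} {T' : PhyloTree V2 X} (x₀ : X) (h : Compatible T T')
    {k : ℕ} (f : X → Fin k) :
    parsimonyScore T.graph T.leaf f ≤ parsimonyScore T'.graph T'.leaf f := by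
  have := T.finite
  have := T'.finite
  obtain ⟨φ, hφ⟩ := h
  obtain ⟨g, h1, h2⟩ := score_att T' x₀ f
  rw [← h2]
  refine le_trans (score_le T f (fun v => g (φ v)) ?_) (changes_iso φ g)
  intro x
  simp only [hφ, h1]

lemma compat_symm {T : PhyloTree V1 X} {T' : PhyloTree V2 X} (h : Compatible T T') :
    Compatible T' T := by
  obtain ⟨φ, hφ⟩ := h
  refine ⟨φ.symm, fun x => ?_⟩
  rw [← hφ x]
  exact φ.symm_apply_apply _

lemma compat_dMP {T : PhyloTree V1 X} {T' : PhyloTree V2 X} (x₀ : X) (h : Compatible T T') :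
    dMP T T' = 0 := by
  refine Nat.le_zero.1 (csSup_le' ?_)
  rintro m ⟨k, f, hf, rfl⟩
  have h1 := score_compat x₀ h f
  have h2 := score_compat x₀ (compat_symm h) f
  omega

lemma compat_dTBR {T : PhyloTree V1 X} {T' : PhyloTree V2 X} (h : Compatible T T') :
    dTBR T T' = 0 := by
  refine Nat.le_zero.1 (Nat.sInf_le ?_)
  exact h

theorem final_of_hh (T : PhyloTree V1 X) (T' : PhyloTree V2 X) (hX : 3 ≤ Nat.card X)
    (h : dMP T T' = 1 ∨ dTBR T T' = 1)
    (hH : HH T.graph T'.graph T.leaf T'.leaf) : dtw T T' = 1 := by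
  obtain ⟨x₀⟩ : Nonempty X := (Nat.card_pos_iff.1 (by omega)).1
  have h3 := display_tw3 T T' x₀ hH
  have hle : treewidth (displayGraph T.graph T.leaf T'.graph T'.leaf) ≤ 3 := Nat.sInf_le h3
  have hmem : HasTreeDecompWidthLE (displayGraph T.graph T.leaf T'.graph T'.leaf)
      (treewidth (displayGraph T.graph T.leaf T'.graph T'.leaf)) :=
    Nat.sInf_mem (s := {k | HasTreeDecompWidthLE (displayGraph T.graph T.leaf T'.graph T'.leaf) k})
      ⟨3, h3⟩
  have hge : ¬ treewidth (displayGraph T.graph T.leaf T'.graph T'.leaf) ≤ 2 := by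
    intro hk
    have hc := compat_of_tw2 T T' hX hk hmem
    have := compat_dMP x₀ hc
    have := compat_dTBR hc
    omega
  unfold dtw
  omega

end Parsimony


section Smooth
variable {W : Type}

/-- `Fwd H u v b`: following the dart `u → v` through degree two vertices ends in `b`. -/
inductive Fwd (H : SimpleGraph W) : W → W → W → Prop
  | halt (u v : W) (h : (H.neighborSet v).ncard ≠ 2) : Fwd H u v v
  | go (u v w b : W) (h : (H.neighborSet v).ncard = 2) (hu : H.Adj v u) (hw : H.Adj v w)
      (hne : w ≠ u) (hf : Fwd H v w b) : Fwd H u v b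

lemma fwd_det {H : SimpleGraph W} {u v b b' : W} (h : Fwd H u v b) (h' : Fwd H u v b') :
    b = b' := by
  induction h with
  | halt u v h =>
    cases h' with
    | halt _ _ h2 => rfl
    | go _ _ w _ h2 => exact absurd h2 h
  | go u v w b h hu hw hne hf ih =>
    cases h' with
    | halt _ _ h2 => exact absurd h h2
    | go _ _ w' _ h2 hu' hw' hne' hf' =>
      have : w = w' := by
        obtain ⟨x, y, hxy, hs⟩ := Set.ncard_eq_two.1 h
        have k : ∀ z, H.Adj v z → z = x ∨ z = y := by
          intro z hz
          have : z ∈ H.neighborSet v := hz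
          rw [hs] at this
          exact this
        have k1 := k u hu
        have k2 := k w hw
        have k3 := k w' hw'
        clear * - k1 k2 k3 hne hne'
        grind
      subst this
      exact ih hf'

lemma fwd_of_walk {H : SimpleGraph W} {a b : W} (p : H.Walk a b) (hp : p.IsPath)
    (hb : (H.neighborSet b).ncard ≠ 2)
    (hi : ∀ x ∈ p.support, x ≠ a → x ≠ b → (H.neighborSet x).ncard = 2) :
    ∀ d ∈ p.darts, Fwd H d.fst d.snd b := by
  induction p with
  | nil => intro d hd; simp at hd
  | @cons a v b h p ih =>
    rw [Walk.cons_isPath_iff] at hp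
    have hav : ∀ x ∈ p.support, x ≠ a := by
      rintro x hx rfl
      exact hp.2 hx
    have ih' := ih hp.1 hb (fun x hx _ hxb =>
      hi x (by rw [Walk.support_cons]; exact List.mem_cons_of_mem _ hx) (hav x hx) hxb)
    intro d hd
    rw [Walk.darts_cons, List.mem_cons] at hd
    rcases hd with rfl | hd
    · by_cases hvb : v = b
      · subst hvb
        exact Fwd.halt _ _ hb
      · have hv2 := hi v (by simp) h.ne' hvb
        cases p with
        | nil => exact absurd rfl hvb
        | @cons _ w _ h2 p2 =>
          refine Fwd.go _ _ w _ hv2 h.symm h2 (hav w (by simp)) ?_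
          exact ih' ⟨(v, w), h2⟩ (by simp)
    · exact ih' d hd

lemma changed_dart {H : SimpleGraph W} {C : Type} (g : W → C) {a b : W} (p : H.Walk a b)
    (hg : g a ≠ g b) : ∃ d ∈ p.darts, g d.fst ≠ g d.snd := by
  induction p with
  | nil => exact absurd rfl hg
  | @cons a v b h p ih =>
    by_cases hv : g a = g v
    · rw [hv] at hg
      obtain ⟨d, hd, h1⟩ := ih hg
      exact ⟨d, by simp [hd], h1⟩
    · exact ⟨⟨(a, v), h⟩, by simp, hv⟩

lemma changes_smoothing [Finite W] (H : SimpleGraph W) {k : ℕ} (g : W → Fin k) :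
    changes (Smoothing H) (fun w => g w.1) ≤ changes H g := by
  classical
  have key : ∀ e : Sym2 {w : W // (H.neighborSet w).ncard ≠ 2},
      (e ∈ (Smoothing H).edgeSet ∧ ∃ u v, e = s(u, v) ∧ g u.1 ≠ g v.1) →
      ∃ u v, H.Adj u v ∧ g u ≠ g v ∧ ∃ a b, e = s(a, b) ∧ Fwd H u v b.1 ∧ Fwd H v u a.1 := by
    rintro e ⟨he, u, v, rfl, huv⟩
    have main : ∀ a b : {w : W // (H.neighborSet w).ncard ≠ 2}, g a.1 ≠ g b.1 →
        (∃ p : H.Walk a.1 b.1, p.IsPath ∧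
          ∀ x ∈ p.support, x = a.1 ∨ x = b.1 ∨ (H.neighborSet x).ncard = 2) →
        ∃ u v, H.Adj u v ∧ g u ≠ g v ∧ ∃ a' b', s(a, b) = s(a', b') ∧
          Fwd H u v b'.1 ∧ Fwd H v u a'.1 := by
      rintro a b hab ⟨p, hp, hx⟩
      obtain ⟨d, hd, hgd⟩ := changed_dart g p hab
      refine ⟨d.fst, d.snd, d.adj, hgd, a, b, rfl, ?_, ?_⟩
      · refine fwd_of_walk p hp b.2 ?_ d hd
        intro x h1 h2 h3
        have := hx x h1
        tauto
      · refine fwd_of_walk p.reverse hp.reverse a.2 ?_ d.symm ?_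
        · intro x h1 h2 h3
          rw [Walk.support_reverse, List.mem_reverse] at h1
          have := hx x h1
          tauto
        · rw [Walk.mem_darts_reverse, Dart.symm_symm]
          exact hd
    obtain ⟨-, h | h⟩ := he
    · exact main u v huv h
    · rw [Sym2.eq_swap]
      exact main v u huv.symm h
  unfold changes
  rcases isEmpty_or_nonempty W with hW | hW
  · rw [Set.eq_empty_of_isEmpty {e | e ∈ (Smoothing H).edgeSet ∧ _}, Set.ncard_empty]
    exact Nat.zero_le _
  choose! F G hF using key
  refine Set.ncard_le_ncard_of_injOn (fun e => s(F e, G e)) ?_ ?_ (Set.toFinite _)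
  · intro e he
    obtain ⟨h1, h2, -⟩ := hF e he
    exact ⟨h1, _, _, rfl, h2⟩
  · intro e he e' he' heq
    obtain ⟨h1, h2, a, b, h3, h4, h5⟩ := hF e he
    obtain ⟨k1, k2, a', b', k3, k4, k5⟩ := hF e' he'
    simp only [Sym2.eq_iff] at heq
    rw [h3, k3, Sym2.eq_iff]
    rcases heq with ⟨q1, q2⟩ | ⟨q1, q2⟩
    · rw [q1, q2] at h4 h5
      exact Or.inl ⟨Subtype.ext (fwd_det h5 k5), Subtype.ext (fwd_det h4 k4)⟩
    · rw [q1, q2] at h4 h5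
      exact Or.inr ⟨Subtype.ext (fwd_det h5 k4), Subtype.ext (fwd_det h4 k5)⟩

end Smooth

section TBR
variable {V1 V2 X : Type}

/-- Value of the new vertex. -/
def atv {V C : Type} (g : V → C) (s : (V × V) ⊕ V) : C :=
  match s with
  | Sum.inl (p, _) => g p
  | Sum.inr v => g v

/-- Extension of a colouring to the auxiliary graph. -/
def gH {V C : Type} (g : V → C) (s1 s2 : (V × V) ⊕ V) : V ⊕ Fin 2 → C
  | Sum.inl v => g v
  | Sum.inr i => if i = 0 then atv g s1 else atv g s2

lemma changes_tbr (T : PhyloTree V1 X) {a b : V1} {s1 s2 : (V1 × V1) ⊕ V1}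
    (hab : T.graph.Adj a b) (h1 : ValidAttach T a b a s1) (h2 : ValidAttach T a b b s2)
    {k : ℕ} (g : V1 → Fin k) :
    changes (tbrGraph T a b s1 s2) (gH g s1 s2) ≤ changes T.graph g + 1 := by
  classical
  have := T.finite
  let x : Sym2 (V1 ⊕ Fin 2) := s(Sum.inr 0, Sum.inr 1)
  let G : Sym2 V1 → Sym2 (V1 ⊕ Fin 2) := fun e =>
    if h : ∃ q : V1 × V1, s1 = Sum.inl q ∧ e = s(q.1, q.2) then s(Sum.inl h.choose.2, Sum.inr 0)
    else if h : ∃ q : V1 × V1, s2 = Sum.inl q ∧ e = s(q.1, q.2) then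
      s(Sum.inl h.choose.2, Sum.inr 1)
    else Sym2.map Sum.inl e
  have G1 : ∀ q : V1 × V1, s1 = Sum.inl q → G s(q.1, q.2) = s(Sum.inl q.2, Sum.inr 0) := by
    intro q hq
    have h : ∃ r : V1 × V1, s1 = Sum.inl r ∧ s(q.1, q.2) = s(r.1, r.2) := ⟨q, hq, rfl⟩
    have e : h.choose = q := Sum.inl_injective (h.choose_spec.1.symm.trans hq)
    simp only [G, dif_pos h]
    rw [e]
  have G2 : ∀ q : V1 × V1, s2 = Sum.inl q →
      (∀ r : V1 × V1, s1 = Sum.inl r → s(q.1, q.2) ≠ s(r.1, r.2)) →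
      G s(q.1, q.2) = s(Sum.inl q.2, Sum.inr 1) := by
    intro q hq hn
    have h0 : ¬ ∃ r : V1 × V1, s1 = Sum.inl r ∧ s(q.1, q.2) = s(r.1, r.2) := by
      rintro ⟨r, hr, hr'⟩
      exact hn r hr hr'
    have h : ∃ r : V1 × V1, s2 = Sum.inl r ∧ s(q.1, q.2) = s(r.1, r.2) := ⟨q, hq, rfl⟩
    have e : h.choose = q := Sum.inl_injective (h.choose_spec.1.symm.trans hq)
    simp only [G, dif_pos h, dif_neg h0]
    rw [e]
  have G3 : ∀ e, (∀ r : V1 × V1, s1 = Sum.inl r → e ≠ s(r.1, r.2)) →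
      (∀ r : V1 × V1, s2 = Sum.inl r → e ≠ s(r.1, r.2)) → G e = Sym2.map Sum.inl e := by
    intro e k1 k2
    have h0 : ¬ ∃ r : V1 × V1, s1 = Sum.inl r ∧ e = s(r.1, r.2) := by
      rintro ⟨r, hr, hr'⟩
      exact k1 r hr hr'
    have h00 : ¬ ∃ r : V1 × V1, s2 = Sum.inl r ∧ e = s(r.1, r.2) := by
      rintro ⟨r, hr, hr'⟩
      exact k2 r hr hr'
    simp only [G, dif_neg h0, dif_neg h00]
  have hbr : ¬ (T.graph.deleteEdges {s(a, b)}).Reachable a b := by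
    have := isAcyclic_iff_forall_adj_isBridge.1 T.acyclic hab
    rwa [isBridge_iff] at this
  have hsep : ∀ q r : V1 × V1, s2 = Sum.inl q → s1 = Sum.inl r → s(q.1, q.2) ≠ s(r.1, r.2) := by
    rintro ⟨q, q'⟩ ⟨r, r'⟩ rfl rfl he
    obtain ⟨-, b1, b2⟩ := h1
    obtain ⟨-, c1, c2⟩ := h2
    rcases Sym2.eq_iff.1 he with ⟨e1, e2⟩ | ⟨e1, e2⟩
    · simp only at e1; subst e1; exact hbr (b1.trans c1.symm)
    · simp only at e1; subst e1; exact hbr (b2.trans c1.symm)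
  let E : Set (Sym2 V1) := {e | e ∈ T.graph.edgeSet ∧ ∃ u v, e = s(u, v) ∧ g u ≠ g v}
  have main : ∀ y z : V1 ⊕ Fin 2, gH g s1 s2 y ≠ gH g s1 s2 z →
      ((∃ p q : V1, T.graph.Adj p q ∧ y = Sum.inl p ∧ z = Sum.inl q ∧
      s(p, q) ≠ s(a, b) ∧
      (∀ r r' : V1, s1 = Sum.inl (r, r') → s(p, q) ≠ s(r, r')) ∧
      (∀ r r' : V1, s2 = Sum.inl (r, r') → s(p, q) ≠ s(r, r'))) ∨
    (∃ p : V1, y = Sum.inl p ∧ z = Sum.inr 0 ∧ attachAt s1 p) ∨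
    (∃ p : V1, y = Sum.inl p ∧ z = Sum.inr 1 ∧ attachAt s2 p) ∨
    (y = Sum.inr 0 ∧ z = Sum.inr 1)) → s(y, z) ∈ insert x (G '' E) := by
    rintro y z hg (⟨p, q, hpq, rfl, rfl, -, k1, k2⟩ | ⟨p, rfl, rfl, hp⟩ | ⟨p, rfl, rfl, hp⟩ |
      ⟨rfl, rfl⟩)
    · right
      refine ⟨s(p, q), ⟨hpq, p, q, rfl, hg⟩, ?_⟩
      rw [G3]
      · rfl
      · intro r hr; exact k1 _ _ hr
      · intro r hr; exact k2 _ _ hr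
    · right
      rcases hs : s1 with ⟨r, r'⟩ | v
      · rw [hs] at hp h1 hg
        simp only [gH, atv, if_pos] at hg
        rcases hp with rfl | rfl
        · exact absurd rfl hg
        · exact ⟨s(r, p), ⟨h1.1, p, r, Sym2.eq_swap, hg⟩, G1 (r, p) hs⟩
      · rw [hs] at hp hg
        simp only [gH, atv, if_pos] at hg
        exact absurd (congrArg g hp) hg
    · right
      rcases hs : s2 with ⟨r, r'⟩ | v
      · rw [hs] at hp h2 hg
        simp only [gH, atv] at hg
        rcases hp with rfl | rfl
        · exact absurd rfl hg
        · exact ⟨s(r, p), ⟨h2.1, p, r, Sym2.eq_swap, hg⟩, G2 (r, p) hs (hsep _ · hs)⟩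
      · rw [hs] at hp hg
        simp only [gH, atv] at hg
        exact absurd (congrArg g hp) hg
    · left; rfl
  have hsub : {e | e ∈ (tbrGraph T a b s1 s2).edgeSet ∧ ∃ u v, e = s(u, v) ∧
      gH g s1 s2 u ≠ gH g s1 s2 v} ⊆ insert x (G '' E) := by
    rintro e ⟨he, y, z, rfl, hg⟩
    obtain ⟨-, h | h⟩ := he
    · exact main y z hg h
    · rw [Sym2.eq_swap]
      exact main z y hg.symm h
  unfold changes
  calc _ ≤ (insert x (G '' E)).ncard := Set.ncard_le_ncard hsub (Set.toFinite _)
    _ ≤ (G '' E).ncard + 1 := Set.ncard_insert_le _ _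
    _ ≤ E.ncard + 1 := by
      have := Set.ncard_image_le (f := G) (Set.toFinite E)
      omega

lemma hh_of_dTBR (T : PhyloTree V1 X) (T' : PhyloTree V2 X) (h : dTBR T T' = 1) :
    HH T.graph T'.graph T.leaf T'.leaf := by
  have hmem : tbrChain 1 ⟨V1, T⟩ ⟨V2, T'⟩ := by
    have hne : {n | tbrChain n (⟨V1, T⟩ : PTree X) ⟨V2, T'⟩}.Nonempty := by
      by_contra hh
      rw [Set.not_nonempty_iff_eq_empty] at hh
      unfold dTBR at h
      rw [hh, Nat.sInf_empty] at h
      omega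
    have := Nat.sInf_mem hne
    unfold dTBR at h
    rw [h] at this
    exact this
  obtain ⟨⟨VC, C⟩, ⟨a, b, s1, s2, hab, h1, h2, e, he⟩, hC⟩ := hmem
  obtain ⟨φ, hφ⟩ := compat_symm hC
  simp only at e he φ hφ
  have := T.finite
  have := T'.finite
  have := C.finite
  intro k g
  refine ⟨fun y => gH g s1 s2 (e (φ y)).1, ?_, ?_⟩
  · intro x
    simp only [hφ, he]
    rfl
  · have a1 := changes_iso φ (fun c => gH g s1 s2 (e c).1)
    have a2 := changes_iso e (fun c => gH g s1 s2 c.1)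
    have a3 := changes_smoothing (tbrGraph T a b s1 s2) (gH g s1 s2)
    have a4 := changes_tbr T hab h1 h2 g
    omega

end TBR


/-- If two unrooted binary phylogenetic trees are at maximum parsimony distance 1
or at TBR distance 1, then they are at treewidth distance 1. -/
theorem dtw_of_dMP_or_dTBR_eq_one {V1 V2 X : Type}
    (T : PhyloTree V1 X) (T' : PhyloTree V2 X) (hX : 3 ≤ Nat.card X)
    (h : dMP T T' = 1 ∨ dTBR T T' = 1) :
    dtw T T' = 1 := by
  obtain ⟨x₀⟩ : Nonempty X := (Nat.card_pos_iff.1 (by omega)).1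
  refine final_of_hh T T' hX h ?_
  rcases h with h | h
  · exact hh_of_dMP T T' x₀ h.le
  · exact hh_of_dTBR T T' h
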